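/- Let g ∈ ℤ[X] be a fixed polynomial of degree k ≥ 2 and let η(k) = 2^{1-k} for 2 ≤ k ≤ 5 and η(k) = 1/(k(k-1)) for k ≥ 6. Then for all integers m, N, h ≥ 1, |∑_{n=1}^{N} e(h g(n)/m)| ≤ N^{1+o(1)} ( gcd(h,m)/m + 1/N + m/(gcd(h,m) N^k) )^{η(k)}. -/

import Mathlib

open Polynomial

/-- The Weyl-sum exponent `η(k)`. -/
noncomputable def eta (k : ℕ) : ℝ :=
  if k ≤ 5 then (2 : ℝ) ^ ((1 : ℤ) - (k : ℤ)) else 1 / ((k : ℝ) * ((k : ℝ) - 1))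

namespace WeylSum

/-- The triangular number `k(k+1)/2`. -/
def tri (k : ℕ) : ℕ := k * (k + 1) / 2

theorem two_mul_tri (k : ℕ) : 2 * tri k = k * (k + 1) :=
  Nat.mul_div_cancel' (Nat.even_mul_succ_self k).two_dvd

section Decoupling

set_option linter.unusedSectionVars false

variable (p : ℕ) [Fact p.Prime]

/-- The value at `x` of the polynomial phase with coefficient vector `t` modulo `p ^ M`. -/
noncomputable def phase {k M : ℕ} (t : Fin (k + 1) → ZMod (p ^ M)) (x : ℤ) : ℂ :=
  ZMod.stdAddChar (∑ j, t j * (x : ZMod (p ^ M)) ^ (j : ℕ))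

/-- The exponential sum over `S` with coefficients `b`, along the points `y x`. -/
noncomputable def expSum {k M : ℕ} (t : Fin (k + 1) → ZMod (p ^ M)) (y : ℤ → ℤ) (b : ℤ → ℂ)
    (S : Finset ℤ) : ℂ :=
  ∑ x ∈ S, b x * phase p t (y x)

/-- The part of `S` on which `y` lies in the residue class `j` modulo `p ^ n`. -/
def fiber (S : Finset ℤ) (y : ℤ → ℤ) (n : ℕ) (j : ZMod (p ^ n)) : Finset ℤ :=
  S.filter fun x => (y x : ZMod (p ^ n)) = j

/-- The `p`-adic `ℓ^{k(k+1)}` decoupling inequality for the moment curve of degree `k`, at scale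
`p ^ n` and with constant `K`. -/
def Dec (k n : ℕ) (K : ℝ) : Prop :=
  ∀ (S : Finset ℤ) (y : ℤ → ℤ) (b : ℤ → ℂ),
    ∑ t : Fin (k + 1) → ZMod (p ^ (k * n)), ‖expSum p t y b S‖ ^ (2 * tri k) ≤
      K * ((p : ℝ) ^ n) ^ (tri k - 1) *
        ∑ j : ZMod (p ^ n), ∑ t : Fin (k + 1) → ZMod (p ^ (k * n)),
          ‖expSum p t y b (fiber p S y n j)‖ ^ (2 * tri k)

variable {p}

theorem phase_add {k M : ℕ} (t u : Fin (k + 1) → ZMod (p ^ M)) (x : ℤ) :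
    phase p (t + u) x = phase p t x * phase p u x := by
  simp only [phase, Pi.add_apply, add_mul, Finset.sum_add_distrib, AddChar.map_add_eq_mul]

theorem norm_phase {k M : ℕ} (t : Fin (k + 1) → ZMod (p ^ M)) (x : ℤ) : ‖phase p t x‖ = 1 :=
  AddChar.norm_apply _ _

theorem Dec.mono {k n : ℕ} {K K' : ℝ} (h : Dec p k n K) (hK : K ≤ K') : Dec p k n K' := by
  intro S y b
  refine (h S y b).trans ?_
  gcongr

theorem fiber_subset (S : Finset ℤ) (y : ℤ → ℤ) (n : ℕ) (j : ZMod (p ^ n)) :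
    fiber p S y n j ⊆ S := Finset.filter_subset _ _

theorem sum_expSum_fiber {k M : ℕ} (t : Fin (k + 1) → ZMod (p ^ M)) (y z : ℤ → ℤ) (b : ℤ → ℂ)
    (S : Finset ℤ) (n : ℕ) :
    ∑ j : ZMod (p ^ n), expSum p t y b (fiber p S z n j) = expSum p t y b S := by
  simp only [expSum, fiber]
  exact Finset.sum_fiberwise S (fun x => (z x : ZMod (p ^ n))) _

theorem expSum_empty {k M : ℕ} (t : Fin (k + 1) → ZMod (p ^ M)) (y : ℤ → ℤ) (b : ℤ → ℂ) :
    expSum p t y b ∅ = 0 := by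
  simp [expSum]

/-- A decoupling inequality passes to any phase group into which the moment curve embeds. -/
theorem Dec.transfer {k M l n : ℕ} {K : ℝ} (hD : Dec p l n K) (S : Finset ℤ) (b : ℤ → ℂ)
    (y : ℤ → ℤ) (w : (Fin (k + 1) → ZMod (p ^ M)) → ℝ) (hw : ∀ t, 0 ≤ w t)
    (ι : (Fin (l + 1) → ZMod (p ^ (l * n))) → (Fin (k + 1) → ZMod (p ^ M)))
    (ξ : (Fin (l + 1) → ZMod (p ^ (l * n))) → ℂ) (hξ : ∀ v, ‖ξ v‖ = 1)
    (hwι : ∀ t v, w (t + ι v) = w t)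
    (hι : ∀ v, ∀ x ∈ S, phase p (ι v) x = ξ v * phase p v (y x)) :
    ∑ t, w t * ‖expSum p t id b S‖ ^ (2 * tri l) ≤
      K * ((p : ℝ) ^ n) ^ (tri l - 1) *
        ∑ j : ZMod (p ^ n), ∑ t, w t * ‖expSum p t id b (fiber p S y n j)‖ ^ (2 * tri l) := by
  classical
  have key : ∀ S' ⊆ S, ∀ (t) (v : Fin (l + 1) → ZMod (p ^ (l * n))), ‖expSum p (t + ι v) id b S'‖ =
      ‖expSum p v y (fun x => b x * phase p t x) S'‖ := by
    intro S' hS' t v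
    have : expSum p (t + ι v) id b S' = ξ v * expSum p v y (fun x => b x * phase p t x) S' := by
      simp only [expSum, id, Finset.mul_sum]
      refine Finset.sum_congr rfl fun x hx => ?_
      rw [phase_add, hι v x (hS' hx)]
      ring
    rw [this, norm_mul, hξ, one_mul]
  have avg : ∀ S' ⊆ S, (Fintype.card (Fin (l + 1) → ZMod (p ^ (l * n))) : ℝ) * ∑ t, w t * ‖expSum p t id b S'‖ ^ (2 * tri l) =
      ∑ t, w t * ∑ v : Fin (l + 1) → ZMod (p ^ (l * n)),
        ‖expSum p v y (fun x => b x * phase p t x) S'‖ ^ (2 * tri l) := by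
    intro S' hS'
    calc (Fintype.card (Fin (l + 1) → ZMod (p ^ (l * n))) : ℝ) * ∑ t, w t * ‖expSum p t id b S'‖ ^ (2 * tri l)
        = ∑ v : Fin (l + 1) → ZMod (p ^ (l * n)), ∑ t, w t * ‖expSum p t id b S'‖ ^ (2 * tri l) := by simp
      _ = ∑ v : Fin (l + 1) → ZMod (p ^ (l * n)), ∑ t, w (t + ι v) * ‖expSum p (t + ι v) id b S'‖ ^ (2 * tri l) := by
          refine Finset.sum_congr rfl fun v _ => ?_
          exact (Equiv.sum_comp (Equiv.addRight (ι v))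
            (fun t => w t * ‖expSum p t id b S'‖ ^ (2 * tri l))).symm
      _ = _ := by
          rw [Finset.sum_comm]
          refine Finset.sum_congr rfl fun t _ => ?_
          rw [Finset.mul_sum]
          refine Finset.sum_congr rfl fun v _ => ?_
          rw [hwι, key S' hS']
  have hV : (0 : ℝ) < Fintype.card (Fin (l + 1) → ZMod (p ^ (l * n))) := by exact_mod_cast Fintype.card_pos
  refine le_of_mul_le_mul_left ?_ hV
  rw [avg S subset_rfl]
  calc _ ≤ ∑ t, w t * (K * ((p : ℝ) ^ n) ^ (tri l - 1) * ∑ j : ZMod (p ^ n),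
          ∑ v : Fin (l + 1) → ZMod (p ^ (l * n)), ‖expSum p v y (fun x => b x * phase p t x) (fiber p S y n j)‖ ^ (2 * tri l)) := by
        gcongr with t
        · exact hw t
        · exact hD S y _
    _ = K * ((p : ℝ) ^ n) ^ (tri l - 1) * ∑ j : ZMod (p ^ n), ∑ t, w t *
          ∑ v : Fin (l + 1) → ZMod (p ^ (l * n)), ‖expSum p v y (fun x => b x * phase p t x) (fiber p S y n j)‖ ^ (2 * tri l) := by
        rw [Finset.sum_comm, Finset.mul_sum]
        refine Finset.sum_congr rfl fun t _ => ?_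
        rw [← Finset.mul_sum]
        ring
    _ = _ := by
        simp only [← avg _ (fiber_subset S y n _), ← Finset.mul_sum]
        ring

theorem phase_coeff {k M : ℕ} (T : (ZMod (p ^ M))[X]) (hT : T.natDegree ≤ k) (x : ℤ) :
    phase p (fun j : Fin (k + 1) => T.coeff j) x = ZMod.stdAddChar (T.eval (x : ZMod (p ^ M))) := by
  rw [phase, Polynomial.eval_eq_sum_range' (Nat.lt_succ_of_le hT),
    Fin.sum_univ_eq_sum_range (fun j => T.coeff j * (x : ZMod (p ^ M)) ^ j)]

theorem stdAddChar_pow_mul {M N : ℕ} (h : M ≤ N) (z : ℤ) :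
    (ZMod.stdAddChar ((p ^ (N - M) * z : ℤ) : ZMod (p ^ N)) : ℂ) =
      ZMod.stdAddChar (z : ZMod (p ^ M)) := by
  rw [ZMod.stdAddChar_coe, ZMod.stdAddChar_coe]
  congr 1
  have hp : (p : ℂ) ≠ 0 := by exact_mod_cast (Fact.out : p.Prime).ne_zero
  have : (p : ℂ) ^ N = (p : ℂ) ^ (N - M) * (p : ℂ) ^ M := by
    rw [← pow_add, Nat.sub_add_cancel h]
  push_cast
  rw [this]
  field_simp

theorem sum_fiber_le (Φ : Finset ℤ → ℝ) (hΦ : ∀ S, 0 ≤ Φ S) (S : Finset ℤ) (y : ℤ → ℤ) (c : ℤ)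
    {r n : ℕ} (h : ∀ x ∈ S, x = c + p ^ r * y x) :
    ∑ j : ZMod (p ^ n), Φ (fiber p S y n j) ≤
      ∑ j : ZMod (p ^ (r + n)), Φ (fiber p S id (r + n) j) := by
  classical
  have hp : (p : ℤ) ≠ 0 := by exact_mod_cast (Fact.out : p.Prime).ne_zero
  have aux : ∀ u v : ℤ, ((c + p ^ r * u : ℤ) : ZMod (p ^ (r + n))) = (c + p ^ r * v : ℤ) ↔
      (u : ZMod (p ^ n)) = v := by
    intro u v
    rw [ZMod.intCast_eq_intCast_iff_dvd_sub, ZMod.intCast_eq_intCast_iff_dvd_sub]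
    push_cast
    rw [pow_add, show c + (p : ℤ) ^ r * v - (c + p ^ r * u) = p ^ r * (v - u) by ring]
    exact mul_dvd_mul_iff_left (pow_ne_zero _ hp)
  let g : ZMod (p ^ n) → ZMod (p ^ (r + n)) := fun j => ((c + p ^ r * (j.val : ℤ) : ℤ) : ZMod _)
  have hv : ∀ j : ZMod (p ^ n), (((j.val : ℤ)) : ZMod (p ^ n)) = j := fun j => by simp
  have hg : Function.Injective g := fun i j hij => by
    have := (aux _ _).1 hij
    rwa [hv, hv] at this
  have hf : ∀ j, fiber p S y n j = fiber p S id (r + n) (g j) := by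
    intro j
    refine Finset.filter_congr fun x hx => ?_
    have h1 := aux (y x) j.val
    rw [hv, ← h x hx] at h1
    exact h1.symm
  calc ∑ j : ZMod (p ^ n), Φ (fiber p S y n j) = ∑ j : ZMod (p ^ n),
        Φ (fiber p S id (r + n) (g j)) := by simp only [hf]
    _ = ∑ j ∈ Finset.univ.image g, Φ (fiber p S id (r + n) j) :=
        by rw [Finset.sum_image fun i _ j _ hij => hg hij]
    _ ≤ _ := Finset.sum_le_univ_sum_of_nonneg fun j => hΦ _

theorem sum_fiber_fiber (Φ : Finset ℤ → ℝ) (hΦ : Φ ∅ = 0) (S : Finset ℤ) {r n : ℕ} (h : r ≤ n) :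
    ∑ j : ZMod (p ^ r), ∑ i : ZMod (p ^ n), Φ (fiber p (fiber p S id r j) id n i) =
      ∑ i : ZMod (p ^ n), Φ (fiber p S id n i) := by
  classical
  rw [Finset.sum_comm]
  refine Finset.sum_congr rfl fun i _ => ?_
  set q := ZMod.castHom (pow_dvd_pow p h) (ZMod (p ^ r)) with hq
  have key : ∀ j, fiber p (fiber p S id r j) id n i = if j = q i then fiber p S id n i else ∅ := by
    intro j
    split_ifs with hj
    · ext x
      simp only [fiber, Finset.mem_filter, id]
      constructor
      · rintro ⟨⟨h1, _⟩, h3⟩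
        exact ⟨h1, h3⟩
      · rintro ⟨h1, h3⟩
        refine ⟨⟨h1, ?_⟩, h3⟩
        rw [hj, ← h3, map_intCast]
    · refine Finset.filter_eq_empty_iff.2 fun x hx hxi => hj ?_
      rw [← (Finset.mem_filter.1 hx).2, ← hxi, id, map_intCast]
  rw [Finset.sum_eq_single (q i)]
  · rw [key, if_pos rfl]
  · intro j _ hj
    rw [key, if_neg hj, hΦ]
  · simp

/-- All elements of `S` lie in one residue class modulo `p ^ a`. -/
def InClass (p a : ℕ) (S : Finset ℤ) : Prop := ∀ x ∈ S, ∀ y ∈ S, (p ^ a : ℤ) ∣ x - y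

theorem InClass.subset {a : ℕ} {S S' : Finset ℤ} (h : InClass p a S) (hS : S' ⊆ S) :
    InClass p a S' := fun x hx y hy => h x (hS hx) y (hS hy)

theorem InClass.mono {a b : ℕ} {S : Finset ℤ} (h : InClass p a S) (hab : b ≤ a) :
    InClass p b S := fun x hx y hy => (pow_dvd_pow _ hab).trans (h x hx y hy)

theorem inClass_fiber (S : Finset ℤ) (n : ℕ) (j : ZMod (p ^ n)) :
    InClass p n (fiber p S id n j) := by
  intro x hx y hy
  have hx := (Finset.mem_filter.1 hx).2
  have hy := (Finset.mem_filter.1 hy).2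
  have := (ZMod.intCast_eq_intCast_iff_dvd_sub y x (p ^ n)).1 (by simpa using hy.trans hx.symm)
  exact_mod_cast this

/-- The total `2 * s`-th moment of the pieces of `S` modulo `p ^ n`. -/
noncomputable def pieces (p : ℕ) [Fact p.Prime] (k n : ℕ) (b : ℤ → ℂ) (S : Finset ℤ) : ℝ :=
  ∑ j : ZMod (p ^ n), ∑ t : Fin (k + 1) → ZMod (p ^ (k * n)),
    ‖expSum p t id b (fiber p S id n j)‖ ^ (2 * tri k)

theorem pieces_nonneg (k n : ℕ) (b : ℤ → ℂ) (S : Finset ℤ) : 0 ≤ pieces p k n b S := by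
  unfold pieces; positivity

theorem tri_pos {k : ℕ} (hk : 1 ≤ k) : 1 ≤ tri k := by
  have := two_mul_tri k
  nlinarith

theorem sum_pieces_fiber {k n r : ℕ} (hk : 1 ≤ k) (h : r ≤ n) (b : ℤ → ℂ) (S : Finset ℤ) :
    ∑ j : ZMod (p ^ r), pieces p k n b (fiber p S id r j) = pieces p k n b S := by
  refine sum_fiber_fiber (fun S => ∑ t : Fin (k + 1) → ZMod (p ^ (k * n)),
    ‖expSum p t id b S‖ ^ (2 * tri k)) ?_ S h
  have := tri_pos hk
  simp [expSum_empty, show tri k ≠ 0 by omega]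

theorem pieces_empty {k n : ℕ} (hk : 1 ≤ k) (b : ℤ → ℂ) : pieces p k n b ∅ = 0 := by
  have := tri_pos hk
  simp [pieces, fiber, expSum_empty, show tri k ≠ 0 by omega]

/-- Decoupling of a single residue class, by rescaling. -/
theorem Dec.rescale {k n a : ℕ} {K : ℝ} (hk : 1 ≤ k) (ha : a ≤ n) (hK : 0 ≤ K)
    (hD : Dec p k (n - a) K)
    (b : ℤ → ℂ) (S : Finset ℤ) (hS : InClass p a S) :
    ∑ t : Fin (k + 1) → ZMod (p ^ (k * n)), ‖expSum p t id b S‖ ^ (2 * tri k) ≤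
      K * (((p : ℝ) ^ (n - a)) ^ (tri k - 1) * pieces p k n b S) := by
  rcases S.eq_empty_or_nonempty with rfl | ⟨c, hc⟩
  · have := tri_pos hk
    simp [pieces_empty hk, expSum_empty, show tri k ≠ 0 by omega]
  have hp : (p : ℤ) ≠ 0 := by exact_mod_cast (Fact.out : p.Prime).ne_zero
  let y : ℤ → ℤ := fun x => (x - c) / p ^ a
  have hy : ∀ x ∈ S, x = c + p ^ a * y x := fun x hx => by
    have := Int.mul_ediv_cancel' (hS x hx c hc)
    simp only [y]
    linarith
  let Z : (Fin (k + 1) → ZMod (p ^ (k * (n - a)))) → (ZMod (p ^ (k * n)))[X] := fun v =>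
    ∑ i : Fin (k + 1), C (((p : ℤ) ^ (a * (k - i)) * ((v i).val : ℤ) : ℤ) : ZMod (p ^ (k * n))) *
      (X - C (c : ZMod (p ^ (k * n)))) ^ (i : ℕ)
  have hZ : ∀ v, (Z v).natDegree ≤ k := by
    intro v
    refine Polynomial.natDegree_sum_le_of_forall_le _ _ fun i _ => ?_
    refine (Polynomial.natDegree_C_mul_le _ _).trans ?_
    refine (Polynomial.natDegree_pow_le).trans ?_
    calc (i : ℕ) * _ ≤ (i : ℕ) * 1 := Nat.mul_le_mul_left _ (natDegree_X_sub_C_le _)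
      _ ≤ k := by omega
  have hle : k * (n - a) ≤ k * n := Nat.mul_le_mul_left _ (Nat.sub_le _ _)
  have hsub : k * n - k * (n - a) = a * k := by
    rw [← Nat.mul_sub, Nat.sub_sub_self ha, mul_comm]
  have h := hD.transfer (M := k * n) S b y (fun _ => 1) (fun _ => zero_le_one)
    (fun v => fun j : Fin (k + 1) => (Z v).coeff j) (fun _ => 1) (by simp) (by simp) (by
      intro v x hx
      rw [phase_coeff _ (hZ v), one_mul, phase]
      have e1 : (Z v).eval (x : ZMod (p ^ (k * n))) =
          ((p ^ (k * n - k * (n - a)) * ∑ i : Fin (k + 1), ((v i).val : ℤ) * y x ^ (i : ℕ) : ℤ) :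
            ZMod (p ^ (k * n))) := by
        rw [hsub, Finset.mul_sum, Int.cast_sum, Polynomial.eval_finsetSum]
        refine Finset.sum_congr rfl fun i _ => ?_
        simp only [eval_mul, eval_C, eval_pow, eval_sub, eval_X]
        rw [← Int.cast_sub, ← Int.cast_pow, ← Int.cast_mul]
        congr 1
        have : x - c = p ^ a * y x := by linarith [hy x hx]
        rw [this, mul_pow, ← pow_mul]
        have : a * k = a * (k - i) + a * i := by
          rw [← Nat.mul_add, Nat.sub_add_cancel (by omega)]
        rw [this, pow_add]
        ring
      rw [e1, stdAddChar_pow_mul hle]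
      congr 1
      push_cast
      simp)
  simp only [one_mul] at h
  refine h.trans ?_
  rw [mul_assoc]
  gcongr
  have := sum_fiber_le (p := p) (fun S => ∑ t : Fin (k + 1) → ZMod (p ^ (k * n)),
    ‖expSum p t id b S‖ ^ (2 * tri k)) (fun S => by positivity) S y c (n := n - a) hy
  rw [Nat.add_sub_cancel' ha] at this
  exact this

end Decoupling

/-- Polynomials vanishing to high order at the origin interpolate arbitrary Taylor data at a unit. -/
theorem exists_taylor_coeff {A : Type*} [CommRing A] [Finite A] {m l : ℕ}
    (hunit : ∀ i : ℕ, 1 ≤ i → i ≤ m + l → IsUnit (i : A)) {u : A} (hu : IsUnit u)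
    (q : Fin l → A) :
    ∃ r : Fin l → A, ∀ i : Fin l,
      (taylor u (X ^ (m + 1) * ∑ j : Fin l, C (r j) * X ^ (j : ℕ))).coeff (i + 1) = q i := by
  classical
  let L : (Fin l → A) →+ (Fin l → A) :=
    { toFun := fun r i =>
        (taylor u (X ^ (m + 1) * ∑ j : Fin l, C (r j) * X ^ (j : ℕ))).coeff (i + 1)
      map_zero' := by ext i; simp
      map_add' := fun r s => by
        ext i
        simp only [Pi.add_apply, add_mul, Finset.sum_add_distrib, mul_add, map_add,
          coeff_add] }
  have hinj : Function.Injective L := by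
    rw [injective_iff_map_eq_zero]
    intro r hr
    set R : A[X] := ∑ j : Fin l, C (r j) * X ^ (j : ℕ) with hR
    have hRc : ∀ j : Fin l, R.coeff j = r j := by
      intro j
      simp only [hR, finsetSum_coeff, coeff_C_mul, coeff_X_pow, mul_ite, mul_one, mul_zero]
      rw [Finset.sum_eq_single j]
      · simp
      · intro i _ hij
        rw [if_neg fun h => hij (Fin.ext h.symm)]
      · simp
    have hRc' : ∀ j : ℕ, l ≤ j → R.coeff j = 0 := by
      intro j hj
      simp only [hR, finsetSum_coeff, coeff_C_mul, coeff_X_pow, mul_ite, mul_one, mul_zero]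
      refine Finset.sum_eq_zero fun i _ => ?_
      rw [if_neg (by omega)]
    set G : A[X] := C ((m + 1 : ℕ) : A) * R + X * derivative R with hG
    have hGc : ∀ j : ℕ, G.coeff j = ((m + 1 + j : ℕ) : A) * R.coeff j := by
      intro j
      rw [hG, coeff_add, coeff_C_mul]
      cases j with
      | zero => simp
      | succ j =>
        rw [coeff_X_mul, coeff_derivative]
        push_cast
        ring
    have hder : derivative (X ^ (m + 1) * R) = X ^ m * G := by
      rw [derivative_mul, derivative_X_pow, hG]
      simp only [Nat.add_sub_cancel]
      ring
    have h1 : X ^ l ∣ taylor u (X ^ m * G) := by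
      rw [X_pow_dvd_iff]
      intro d hd
      have h2 : (taylor u (X ^ (m + 1) * R)).coeff (d + 1) = 0 := congrFun hr ⟨d, hd⟩
      have h3 : taylor u (X ^ m * G) = derivative (taylor u (X ^ (m + 1) * R)) := by
        rw [← hder]
        simp only [taylor_apply, derivative_comp, derivative_add, derivative_X, derivative_C,
          add_zero, one_mul]
      rw [h3, coeff_derivative, h2, zero_mul]
    rw [taylor_mul, taylor_pow, taylor_X] at h1
    have hcop : IsCoprime (X ^ l : A[X]) ((X + C u) ^ m) := by
      refine IsCoprime.pow ?_
      obtain ⟨v, hv⟩ := hu.exists_right_inv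
      refine ⟨-C v, C v, ?_⟩
      rw [← C_1, ← hv, C_mul]
      ring
    have h2 : X ^ l ∣ taylor u G := hcop.dvd_of_dvd_mul_left h1
    have h3 : taylor u G = 0 := by
      ext d
      rw [coeff_zero]
      by_cases hd : d < l
      · exact X_pow_dvd_iff.1 h2 d hd
      · rcases Nat.eq_zero_or_pos l with rfl | hl
        · have : G = 0 := by
            ext j
            rw [hGc, hRc' j (Nat.zero_le _), mul_zero, coeff_zero]
          simp [this]
        · refine coeff_eq_zero_of_natDegree_lt ?_
          rw [natDegree_taylor]
          have : G.natDegree ≤ l - 1 := by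
            rw [natDegree_le_iff_coeff_eq_zero]
            intro N hN
            rw [hGc, hRc' N (by omega), mul_zero]
          omega
    have h4 : G = 0 := taylor_injective u (by rw [h3, map_zero])
    ext j
    have h5 := hGc j
    rw [h4, coeff_zero, hRc] at h5
    exact ((hunit (m + 1 + j) (by omega) (by omega)).mul_right_eq_zero.1 h5.symm)
  obtain ⟨r, hr⟩ := (Finite.injective_iff_surjective.1 hinj) q
  exact ⟨r, fun i => congrFun hr i⟩

section Decoupling

set_option linter.unusedSectionVars false

variable {p : ℕ} [Fact p.Prime]

/-- No element of `S₁` is congruent to an element of `S₂` modulo `p`. -/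
def Separated (p : ℕ) (S₁ S₂ : Finset ℤ) : Prop := ∀ x ∈ S₁, ∀ y ∈ S₂, ¬ (p : ℤ) ∣ x - y

theorem Separated.subset {S₁ S₂ S₁' S₂' : Finset ℤ} (h : Separated p S₁ S₂) (h₁ : S₁' ⊆ S₁)
    (h₂ : S₂' ⊆ S₂) : Separated p S₁' S₂' := fun x hx y hy => h x (h₁ hx) y (h₂ hy)

theorem Separated.symm {S₁ S₂ : Finset ℤ} (h : Separated p S₁ S₂) : Separated p S₂ S₁ :=
  fun x hx y hy hd => h y hy x hx (by rw [← neg_sub]; exact hd.neg_right)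

theorem isUnit_intCast_zmod {M : ℕ} {z : ℤ} (h : ¬ (p : ℤ) ∣ z) : IsUnit (z : ZMod (p ^ M)) := by
  rw [ZMod.coe_int_isUnit_iff_isCoprime]
  have hp : Prime (p : ℤ) := Nat.prime_iff_prime_int.1 Fact.out
  have := ((Prime.coprime_iff_not_dvd hp).2 h).pow_left (m := M)
  exact_mod_cast this

/-- Lower-dimensional decoupling in the presence of a separated factor. -/
theorem Dec.step {k l n b r₀ r : ℕ} {K : ℝ} (hl : 1 ≤ l) (hlk : l < k) (hkp : k < p)
    (hr : r₀ ≤ r) (h₁ : l * r ≤ (l + 1) * r₀) (h₂ : l * r ≤ (k - l + 1) * b) (hb : b ≤ n)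
    (hK : 0 ≤ K) (hD : Dec p l (r - r₀) K) {q : ℕ} (hq : q ≠ 0) (a : ℤ → ℂ) {S₁ S₂ : Finset ℤ}
    (hS₁ : InClass p r₀ S₁) (hS₂ : InClass p b S₂) (hsep : Separated p S₁ S₂) :
    ∑ t : Fin (k + 1) → ZMod (p ^ (k * n)),
        ‖expSum p t id a S₂‖ ^ q * ‖expSum p t id a S₁‖ ^ (2 * tri l) ≤
      K * (((p : ℝ) ^ (r - r₀)) ^ (tri l - 1) * ∑ j : ZMod (p ^ r),
        ∑ t : Fin (k + 1) → ZMod (p ^ (k * n)),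
          ‖expSum p t id a S₂‖ ^ q * ‖expSum p t id a (fiber p S₁ id r j)‖ ^ (2 * tri l)) := by
  rcases S₁.eq_empty_or_nonempty with rfl | ⟨c, hc⟩
  · have := tri_pos hl
    simp [fiber, expSum_empty, show tri l ≠ 0 by omega]
  rcases S₂.eq_empty_or_nonempty with rfl | ⟨c', hc'⟩
  · simp [expSum_empty, hq]
  let y : ℤ → ℤ := fun x => (x - c) / p ^ r₀
  have hy : ∀ x ∈ S₁, x = c + p ^ r₀ * y x := fun x hx => by
    have := Int.mul_ediv_cancel' (hS₁ x hx c hc)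
    simp only [y]
    linarith
  have hMN : l * r ≤ k * n := h₂.trans (Nat.mul_le_mul (by omega) hb)
  have hM2 : l * (r - r₀) ≤ l * r := Nat.mul_le_mul_left _ (Nat.sub_le _ _)
  have hsub : l * r - l * (r - r₀) = r₀ * l := by
    rw [← Nat.mul_sub, Nat.sub_sub_self hr, mul_comm]
  set u : ZMod (p ^ (l * r)) := ((c - c' : ℤ) : ZMod (p ^ (l * r))) with hu
  have huu : IsUnit u := isUnit_intCast_zmod (hsep c hc c' hc')
  have hunit : ∀ i : ℕ, 1 ≤ i → i ≤ (k - l) + l → IsUnit (i : ZMod (p ^ (l * r))) := by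
    intro i h1 h2
    have : ¬ (p : ℤ) ∣ (i : ℤ) := by
      rw [Int.natCast_dvd_natCast]
      intro h
      have := Nat.le_of_dvd h1 h
      omega
    simpa using isUnit_intCast_zmod (p := p) (M := l * r) this
  choose ρ hρ using fun v : Fin (l + 1) → ZMod (p ^ (l * (r - r₀))) =>
    exists_taylor_coeff hunit huu
      (fun i : Fin l => (((p : ℤ) ^ (r₀ * (l - (i + 1))) * ((v i.succ).val : ℤ) : ℤ) :
        ZMod (p ^ (l * r))))
  let Q : (Fin (l + 1) → ZMod (p ^ (l * (r - r₀)))) → (ZMod (p ^ (l * r)))[X] := fun v =>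
    X ^ (k - l + 1) * ∑ j : Fin l, C (ρ v j) * X ^ (j : ℕ)
  have hQ : ∀ v, (Q v).natDegree ≤ k := by
    intro v
    have h1 : (∑ j : Fin l, C (ρ v j) * X ^ (j : ℕ) : (ZMod (p ^ (l * r)))[X]).natDegree ≤
        l - 1 := by
      refine natDegree_sum_le_of_forall_le _ _ fun j _ => ?_
      exact (natDegree_C_mul_X_pow_le _ _).trans (by omega)
    refine natDegree_mul_le.trans ?_
    have := natDegree_X_pow_le (R := ZMod (p ^ (l * r))) (k - l + 1)
    omega
  let Z : (Fin (l + 1) → ZMod (p ^ (l * (r - r₀)))) → ℤ → ℤ := fun v x =>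
    ∑ j : Fin l, ((ρ v j).val : ℤ) * (x - c') ^ (k - l + 1 + j)
  let T : (Fin (l + 1) → ZMod (p ^ (l * (r - r₀)))) → (ZMod (p ^ (k * n)))[X] := fun v =>
    ∑ j : Fin l, C (((p : ℤ) ^ (k * n - l * r) * ((ρ v j).val : ℤ) : ℤ) : ZMod (p ^ (k * n))) *
      (X - C (c' : ZMod (p ^ (k * n)))) ^ (k - l + 1 + (j : ℕ))
  have hT : ∀ v, (T v).natDegree ≤ k := by
    intro v
    refine natDegree_sum_le_of_forall_le _ _ fun j _ => ?_
    refine (natDegree_C_mul_le _ _).trans ?_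
    refine natDegree_pow_le.trans ?_
    calc (k - l + 1 + (j : ℕ)) * _ ≤ (k - l + 1 + (j : ℕ)) * 1 :=
        Nat.mul_le_mul_left _ (natDegree_X_sub_C_le _)
      _ ≤ k := by omega
  have hphase : ∀ v x, phase p (fun j : Fin (k + 1) => (T v).coeff j) x =
      ZMod.stdAddChar ((Z v x : ℤ) : ZMod (p ^ (l * r))) := by
    intro v x
    rw [phase_coeff _ (hT v), ← stdAddChar_pow_mul hMN]
    congr 1
    simp only [T, Z]
    rw [Finset.mul_sum, Int.cast_sum, Polynomial.eval_finsetSum]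
    refine Finset.sum_congr rfl fun i _ => ?_
    simp only [eval_mul, eval_C, eval_pow, eval_sub, eval_X]
    push_cast
    ring
  have hZQ : ∀ v x, ((Z v x : ℤ) : ZMod (p ^ (l * r))) =
      (taylor u (Q v)).eval ((x - c : ℤ) : ZMod (p ^ (l * r))) := by
    intro v x
    rw [taylor_eval, hu, ← Int.cast_add]
    simp only [Z, Q, eval_mul, eval_pow, eval_X, eval_finsetSum, eval_C, Finset.mul_sum]
    push_cast
    refine Finset.sum_congr rfl fun i _ => ?_
    simp only [ZMod.natCast_val, ZMod.cast_id', id]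
    ring
  have hZ : ∀ v, ∀ x ∈ S₁, ((Z v x : ℤ) : ZMod (p ^ (l * r))) =
      ((taylor u (Q v)).coeff 0 - ((p ^ (r₀ * l) * (v 0).val : ℤ) : ZMod (p ^ (l * r)))) +
        ((p ^ (r₀ * l) * ∑ i : Fin (l + 1), ((v i).val : ℤ) * y x ^ (i : ℕ) : ℤ) :
          ZMod (p ^ (l * r))) := by
    intro v x hx
    have hxc : x - c = p ^ r₀ * y x := by linarith [hy x hx]
    rw [hZQ, hxc, eval_eq_sum_range' (n := k + 1) (by rw [natDegree_taylor]; have := hQ v; omega),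
      ← Finset.sum_subset (s₁ := Finset.range (l + 1))]
    · rw [Finset.sum_range, Fin.sum_univ_succ, Fin.sum_univ_succ]
      have : ∀ i : Fin l, (taylor u (Q v)).coeff ((i.succ : Fin (l + 1)) : ℕ) *
          ((p ^ r₀ * y x : ℤ) : ZMod (p ^ (l * r))) ^ ((i.succ : Fin (l + 1)) : ℕ) =
          ((p ^ (r₀ * l) * (((v i.succ).val : ℤ) * y x ^ ((i.succ : Fin (l + 1)) : ℕ)) : ℤ) :
            ZMod (p ^ (l * r))) := by
        intro i
        rw [Fin.val_succ, hρ v i, ← Int.cast_pow, ← Int.cast_mul]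
        congr 1
        have e : r₀ * l = r₀ * (l - (i + 1)) + r₀ * (i + 1) := by
          rw [← Nat.mul_add, Nat.sub_add_cancel (by omega)]
        rw [e, pow_add, mul_pow, ← pow_mul]
        ring
      rw [Finset.sum_congr rfl fun i _ => this i]
      push_cast
      simp only [Fin.val_zero, pow_zero, mul_one]
      rw [mul_add, Finset.mul_sum]
      ring
    · exact Finset.range_subset_range.2 (by omega)
    · intro i hi hi'
      have hi1 : l + 1 ≤ i := by simpa using hi'
      have : ((p ^ r₀ * y x : ℤ) : ZMod (p ^ (l * r))) ^ i = 0 := by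
        rw [← Int.cast_pow, ZMod.intCast_zmod_eq_zero_iff_dvd, mul_pow, ← pow_mul]
        push_cast
        refine Dvd.dvd.mul_right (pow_dvd_pow _ (h₁.trans ?_)) _
        rw [mul_comm]
        exact Nat.mul_le_mul_left _ hi1
      rw [this, mul_zero]
  have hw : ∀ v, ∀ x ∈ S₂, phase p (fun j : Fin (k + 1) => (T v).coeff j) x = 1 := by
    intro v x hx
    rw [hphase]
    have : ((Z v x : ℤ) : ZMod (p ^ (l * r))) = 0 := by
      rw [ZMod.intCast_zmod_eq_zero_iff_dvd]
      refine Finset.dvd_sum fun j _ => Dvd.dvd.mul_left ?_ _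
      push_cast
      calc (p : ℤ) ^ (l * r) ∣ p ^ (b * (k - l + 1)) := pow_dvd_pow _ (by rw [mul_comm b]; exact h₂)
        _ ∣ (x - c') ^ (k - l + 1) := by rw [pow_mul]; exact pow_dvd_pow_of_dvd (hS₂ x hx c' hc') _
        _ ∣ _ := pow_dvd_pow _ (by omega)
    rw [this, AddChar.map_zero_eq_one]
  have h := hD.transfer (M := k * n) S₁ a y (fun t => ‖expSum p t id a S₂‖ ^ q)
    (fun _ => by positivity)
    (fun v => fun j : Fin (k + 1) => (T v).coeff j)
    (fun v => ZMod.stdAddChar ((taylor u (Q v)).coeff 0 -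
      ((p ^ (r₀ * l) * (v 0).val : ℤ) : ZMod (p ^ (l * r)))))
    (fun v => AddChar.norm_apply _ _)
    (fun t v => by
      congr 2
      refine Finset.sum_congr rfl fun x hx => ?_
      rw [phase_add, id, hw v x hx, mul_one])
    (by
      intro v x hx
      rw [hphase, hZ v x hx, AddChar.map_add_eq_mul, ← hsub, stdAddChar_pow_mul hM2]
      congr 1
      rw [phase]
      congr 1
      push_cast
      simp)
  refine h.trans ?_
  rw [mul_assoc]
  gcongr
  have := sum_fiber_le (p := p) (fun S => ∑ t : Fin (k + 1) → ZMod (p ^ (k * n)),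
    ‖expSum p t id a S₂‖ ^ q * ‖expSum p t id a S‖ ^ (2 * tri l)) (fun S => by positivity)
    S₁ y c (n := r - r₀) hy
  rw [Nat.add_sub_cancel' hr] at this
  exact this

/-- Decoupling with arbitrarily small exponential loss in the number of scales. -/
def DecEps (p : ℕ) [Fact p.Prime] (k : ℕ) : Prop :=
  ∀ β : ℝ, 1 < β → ∃ C : ℝ, 1 ≤ C ∧ ∀ n, Dec p k n (C * β ^ n)

/-- Mixed moment of two sets, with exponents `q` and `2 * tri l`. -/
noncomputable def mixed (p : ℕ) [Fact p.Prime] (k l n q : ℕ) (a : ℤ → ℂ) (S₂ S₁ : Finset ℤ) : ℝ :=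
  ∑ t : Fin (k + 1) → ZMod (p ^ (k * n)),
    ‖expSum p t id a S₂‖ ^ q * ‖expSum p t id a S₁‖ ^ (2 * tri l)

theorem mixed_nonneg (k l n q : ℕ) (a : ℤ → ℂ) (S₂ S₁ : Finset ℤ) :
    0 ≤ mixed p k l n q a S₂ S₁ := by
  unfold mixed; positivity

theorem mixed_empty {k l n q : ℕ} (hl : 1 ≤ l) (a : ℤ → ℂ) (S₂ : Finset ℤ) :
    mixed p k l n q a S₂ ∅ = 0 := by
  have := tri_pos hl
  simp [mixed, expSum_empty, show tri l ≠ 0 by omega]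

/-- The mixed moment can be decoupled in its second argument from scale `r` to scale `r'`. -/
def Cost (p : ℕ) [Fact p.Prime] (k l n q : ℕ) (a : ℤ → ℂ) (S₂ : Finset ℤ) (r r' : ℕ) (K : ℝ) :
    Prop :=
  ∀ S₁, InClass p r S₁ → Separated p S₁ S₂ → mixed p k l n q a S₂ S₁ ≤
    K * (((p : ℝ) ^ (r' - r)) ^ (tri l - 1) *
      ∑ j : ZMod (p ^ r'), mixed p k l n q a S₂ (fiber p S₁ id r' j))

theorem Cost.mono {k l n q : ℕ} {a : ℤ → ℂ} {S₂ : Finset ℤ} {r r' : ℕ} {K K' : ℝ}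
    (h : Cost p k l n q a S₂ r r' K) (hK : K ≤ K') : Cost p k l n q a S₂ r r' K' := by
  intro S₁ h₁ h₂
  refine (h S₁ h₁ h₂).trans ?_
  have : 0 ≤ ∑ j : ZMod (p ^ r'), mixed p k l n q a S₂ (fiber p S₁ id r' j) :=
    Finset.sum_nonneg fun _ _ => mixed_nonneg _ _ _ _ _ _ _
  gcongr

theorem Cost.comp {k l n q : ℕ} (hl : 1 ≤ l) {a : ℤ → ℂ} {S₂ : Finset ℤ} {r r' r'' : ℕ} {K K' : ℝ}
    (h : Cost p k l n q a S₂ r r' K) (h' : Cost p k l n q a S₂ r' r'' K') (hr : r ≤ r')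
    (hr' : r' ≤ r'') (hK : 0 ≤ K) : Cost p k l n q a S₂ r r'' (K * K') := by
  intro S₁ h₁ h₂
  refine (h S₁ h₁ h₂).trans ?_
  have e := sum_fiber_fiber (p := p) (fun S => mixed p k l n q a S₂ S) (mixed_empty hl a S₂) S₁ hr'
  rw [mul_assoc]
  refine mul_le_mul_of_nonneg_left ?_ hK
  calc ((p : ℝ) ^ (r' - r)) ^ (tri l - 1) *
      ∑ j : ZMod (p ^ r'), mixed p k l n q a S₂ (fiber p S₁ id r' j)
      ≤ ((p : ℝ) ^ (r' - r)) ^ (tri l - 1) * ∑ j : ZMod (p ^ r'),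
        K' * (((p : ℝ) ^ (r'' - r')) ^ (tri l - 1) *
          ∑ i : ZMod (p ^ r''), mixed p k l n q a S₂ (fiber p (fiber p S₁ id r' j) id r'' i)) := by
        gcongr with j
        exact h' _ (inClass_fiber _ _ _) (h₂.subset (fiber_subset _ _ _ _) subset_rfl)
    _ = _ := by
        rw [← Finset.mul_sum, ← Finset.mul_sum, e]
        have : r'' - r = (r' - r) + (r'' - r') := by omega
        rw [this, pow_add, mul_pow]
        ring

theorem norm_sum_pow_le {ι : Type*} (s : Finset ι) (f : ι → ℂ) {m : ℕ} (hm : m ≠ 0) :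
    ‖∑ i ∈ s, f i‖ ^ m ≤ (s.card : ℝ) ^ (m - 1) * ∑ i ∈ s, ‖f i‖ ^ m := by
  obtain ⟨m, rfl⟩ := Nat.exists_eq_succ_of_ne_zero hm
  calc ‖∑ i ∈ s, f i‖ ^ (m + 1) ≤ (∑ i ∈ s, ‖f i‖) ^ (m + 1) := by
        gcongr; exact norm_sum_le _ _
    _ ≤ _ := by
        exact pow_sum_le_card_mul_sum_pow (fun i _ => norm_nonneg _) m

theorem one_le_prime : (1 : ℝ) ≤ p := by exact_mod_cast (Fact.out : p.Prime).one_lt.le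

theorem cost_trivial {k l n q : ℕ} (hl : 1 ≤ l) (a : ℤ → ℂ) (S₂ : Finset ℤ) (r r' : ℕ) :
    Cost p k l n q a S₂ r r' (((p : ℝ) ^ r') ^ (2 * tri l)) := by
  intro S₁ _ _
  have hp := one_le_prime (p := p)
  have h : mixed p k l n q a S₂ S₁ ≤ ((p : ℝ) ^ r') ^ (2 * tri l) *
      ∑ j : ZMod (p ^ r'), mixed p k l n q a S₂ (fiber p S₁ id r' j) := by
    unfold mixed
    rw [Finset.sum_comm, Finset.mul_sum]
    refine Finset.sum_le_sum fun t _ => ?_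
    rw [← Finset.mul_sum, mul_left_comm]
    gcongr
    rw [← sum_expSum_fiber t id id a S₁ r']
    refine (norm_sum_pow_le _ _ (by have := tri_pos hl; omega)).trans ?_
    gcongr
    · simp only [Finset.card_univ, ZMod.card]
      push_cast
      gcongr
      · exact one_le_pow₀ hp
      · omega
  refine h.trans ?_
  gcongr
  have : 0 ≤ ∑ j : ZMod (p ^ r'), mixed p k l n q a S₂ (fiber p S₁ id r' j) :=
    Finset.sum_nonneg fun _ _ => mixed_nonneg _ _ _ _ _ _ _
  exact le_mul_of_one_le_left this (one_le_pow₀ (one_le_pow₀ hp))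

/-- Decoupling down to the scale permitted by the width of the separated factor. -/
theorem DecEps.cost {k l : ℕ} (hl : 1 ≤ l) (hlk : l < k) (hkp : k < p) (hD : DecEps p l) {β : ℝ}
    (hβ : 1 < β) : ∃ C : ℝ, 1 ≤ C ∧ ∀ (n b q r r' : ℕ), r ≤ r' → b ≤ n → l * r' ≤ (k - l + 1) * b →
      q ≠ 0 → ∀ (a : ℤ → ℂ) (S₂ : Finset ℤ), InClass p b S₂ →
        Cost p k l n q a S₂ r r' (C * β ^ r') := by
  have hp := one_le_prime (p := p)
  obtain ⟨γ, hγ1, hγ⟩ : ∃ γ : ℝ, 1 < γ ∧ γ ^ 2 ≤ β := by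
    refine ⟨Real.sqrt β, ?_, (Real.sq_sqrt (by linarith)).le⟩
    rw [Real.lt_sqrt (by norm_num)]; simpa
  obtain ⟨C, hC1, hC⟩ := hD γ hγ1
  obtain ⟨R₀, hR₀⟩ := pow_unbounded_of_one_lt C hγ1
  set R := l * (R₀ + 1) with hR
  have hstep : ∀ (n b q r r' : ℕ), r ≤ r' → b ≤ n → l * r' ≤ (k - l + 1) * b → r' ≤ r + r / l →
      q ≠ 0 → ∀ (a : ℤ → ℂ) (S₂ : Finset ℤ), InClass p b S₂ →
        Cost p k l n q a S₂ r r' (C * γ ^ (r' - r)) := by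
    intro n b q r r' hr hb hrb hrr hq a S₂ hS₂ S₁ h₁ h₂
    refine (hC (r' - r)).step hl hlk hkp hr ?_ hrb hb (by positivity) hq a h₁ hS₂ h₂
    have := Nat.mul_div_le r l
    nlinarith
  have hbig : ∀ (n b q r' : ℕ), b ≤ n → l * r' ≤ (k - l + 1) * b →
      q ≠ 0 → ∀ (a : ℤ → ℂ) (S₂ : Finset ℤ), InClass p b S₂ → ∀ d r, r + d = r' → R ≤ r →
        Cost p k l n q a S₂ r r' (C * β ^ d) := by
    intro n b q r' hb hrb hq a S₂ hS₂ d
    induction d using Nat.strong_induction_on with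
    | _ d ih =>
      intro r hrd hRr
      have hd : R₀ + 1 ≤ r / l := by
        rw [Nat.le_div_iff_mul_le hl, mul_comm]; exact hRr
      have hγβ : γ ≤ β := le_trans (by nlinarith) hγ
      rcases le_or_gt d (r / l) with h | h
      · refine (hstep n b q r r' (by omega) hb hrb (by omega) hq a S₂ hS₂).mono ?_
        rw [show r' - r = d by omega]
        gcongr
      · have h1 := hstep n b q r (r + r / l) (by omega) hb
          ((Nat.mul_le_mul_left l (by omega)).trans hrb) le_rfl hq a S₂ hS₂
        have h2 := ih (d - r / l) (by omega) (r + r / l) (by omega) (by omega)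
        refine (h1.comp hl h2 (by omega) (by omega) (by positivity)).mono ?_
        rw [Nat.add_sub_cancel_left]
        have h3 : C ≤ γ ^ (r / l) := hR₀.le.trans (pow_le_pow_right₀ hγ1.le (by omega))
        have h4 : β ^ d = β ^ (r / l) * β ^ (d - r / l) := by rw [← pow_add]; congr 1; omega
        have h5 : C * γ ^ (r / l) ≤ β ^ (r / l) := by
          calc _ ≤ γ ^ (r / l) * γ ^ (r / l) := by gcongr
            _ = (γ ^ 2) ^ (r / l) := by ring
            _ ≤ _ := by gcongr
        have h6 : (0 : ℝ) ≤ C * β ^ (d - r / l) := by positivity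
        rw [h4]
        nlinarith
  refine ⟨((p : ℝ) ^ R) ^ (2 * tri l) * C, ?_, ?_⟩
  · exact one_le_mul_of_one_le_of_one_le (one_le_pow₀ (one_le_pow₀ hp)) hC1
  intro n b q r r' hr hb hrb hq a S₂ hS₂
  have hpR : (1 : ℝ) ≤ ((p : ℝ) ^ R) ^ (2 * tri l) := one_le_pow₀ (one_le_pow₀ hp)
  rcases le_or_gt R r with h | h
  · refine (hbig n b q r' hb hrb hq a S₂ hS₂ (r' - r) r (by omega) h).mono ?_
    calc C * β ^ (r' - r) ≤ 1 * C * β ^ r' := by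
          rw [one_mul]
          gcongr
          · exact hβ.le
          · omega
      _ ≤ _ := by gcongr
  rcases le_or_gt r' R with h' | h'
  · refine (cost_trivial hl a S₂ r r').mono ?_
    calc ((p : ℝ) ^ r') ^ (2 * tri l) ≤ ((p : ℝ) ^ R) ^ (2 * tri l) * 1 * 1 := by
          rw [mul_one, mul_one]
          gcongr
      _ ≤ _ := by
        gcongr
        exact one_le_pow₀ hβ.le
  · refine ((cost_trivial hl a S₂ r R).comp hl
      (hbig n b q r' hb hrb hq a S₂ hS₂ (r' - R) R (by omega) le_rfl)
      h.le h'.le (by positivity)).mono ?_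
    rw [mul_assoc]
    gcongr
    · exact hβ.le
    · omega

end Decoupling

theorem sum_rpow_mul_rpow_le {ι : Type*} (s : Finset ι) (F G : ι → ℝ) (hF : ∀ i, 0 ≤ F i)
    (hG : ∀ i, 0 ≤ G i) {u v : ℝ} (hu : 0 < u) (hv : 0 < v) (huv : u + v = 1) :
    ∑ i ∈ s, F i ^ u * G i ^ v ≤ (∑ i ∈ s, F i) ^ u * (∑ i ∈ s, G i) ^ v := by
  have hpq : (1 / u).HolderConjugate (1 / v) := by
    rw [Real.holderConjugate_iff]
    refine ⟨?_, by simpa using huv⟩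
    rw [lt_div_iff₀ hu]; linarith
  have h := Real.inner_le_Lp_mul_Lq_of_nonneg s hpq (f := fun i => F i ^ u)
    (g := fun i => G i ^ v) (fun i _ => Real.rpow_nonneg (hF i) _)
    (fun i _ => Real.rpow_nonneg (hG i) _)
  simp only [one_div_one_div] at h
  refine h.trans (le_of_eq ?_)
  congr 2
  · refine Finset.sum_congr rfl fun i _ => ?_
    rw [← Real.rpow_mul (hF i), mul_one_div_cancel hu.ne', Real.rpow_one]
  · refine Finset.sum_congr rfl fun i _ => ?_
    rw [← Real.rpow_mul (hG i), mul_one_div_cancel hv.ne', Real.rpow_one]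

theorem pow_rpow_mul_pow_rpow {x : ℝ} (hx : 0 ≤ x) {e₁ e₂ e : ℕ} {u v : ℝ} (hu : 0 ≤ u)
    (hv : 0 ≤ v) (h : e₁ * u + e₂ * v = e) : (x ^ e₁) ^ u * (x ^ e₂) ^ v = x ^ e := by
  rw [← Real.rpow_natCast, ← Real.rpow_natCast, ← Real.rpow_natCast, ← Real.rpow_mul hx,
    ← Real.rpow_mul hx, ← Real.rpow_add_of_nonneg hx (by positivity) (by positivity), h]

theorem tri_le_tri {l k : ℕ} (h : l ≤ k) : tri l ≤ tri k := by
  have h1 := two_mul_tri l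
  have h2 := two_mul_tri k
  nlinarith

theorem tri_lt_tri {l k : ℕ} (h : l < k) : tri l < tri k := by
  have h1 := two_mul_tri l
  have h2 := two_mul_tri k
  nlinarith

section Decoupling

set_option linter.unusedSectionVars false

variable {p : ℕ} [Fact p.Prime]

/-- Bilinear decoupling inequality between separated sets in residue classes modulo `p ^ a` and
`p ^ b`. -/
def Bil (p : ℕ) [Fact p.Prime] (k l a b n : ℕ) (K : ℝ) : Prop :=
  ∀ (c : ℤ → ℂ) (S₁ S₂ : Finset ℤ), InClass p a S₁ → InClass p b S₂ → Separated p S₁ S₂ →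
    ∀ A B : ℝ, 0 ≤ A → 0 ≤ B →
      ((p : ℝ) ^ (n - a)) ^ (tri k - 1) * pieces p k n c S₁ ≤ A ^ (2 * tri k) →
      ((p : ℝ) ^ (n - b)) ^ (tri k - 1) * pieces p k n c S₂ ≤ B ^ (2 * tri k) →
      mixed p k l n (2 * tri k - 2 * tri l) c S₂ S₁ ≤
        K * (A ^ (2 * tri l) * B ^ (2 * tri k - 2 * tri l))

theorem Bil.mono {k l a b n : ℕ} {K K' : ℝ} (h : Bil p k l a b n K) (hK : K ≤ K') :
    Bil p k l a b n K' := by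
  intro c S₁ S₂ h₁ h₂ h₃ A B hA hB hA' hB'
  refine (h c S₁ S₂ h₁ h₂ h₃ A B hA hB hA' hB').trans ?_
  gcongr

theorem Bil.zero {k a b n : ℕ} {K : ℝ} (hk : 1 ≤ k) (hb : b ≤ n) (hK : 0 ≤ K)
    (hD : Dec p k (n - b) K) : Bil p k 0 a b n K := by
  intro c S₁ S₂ h₁ h₂ h₃ A B hA hB hA' hB'
  have h := hD.rescale hk hb hK c S₂ h₂
  have : tri 0 = 0 := rfl
  simp only [mixed, this, mul_zero, pow_zero, mul_one, one_mul, Nat.sub_zero]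
  refine h.trans ?_
  gcongr

theorem Bil.of_dec {k l a b n : ℕ} {K : ℝ} (hl : 1 ≤ l) (hlk : l < k) (ha : a ≤ n) (hb : b ≤ n)
    (hK : 0 ≤ K) (hD : Dec p k (n - a) K) (hD' : Dec p k (n - b) K) : Bil p k l a b n K := by
  intro c S₁ S₂ h₁ h₂ h₃ A B hA hB hA' hB'
  have hk : 1 ≤ k := by omega
  have h := (hD.rescale hk ha hK c S₁ h₁).trans (mul_le_mul_of_nonneg_left hA' hK)
  have h' := (hD'.rescale hk hb hK c S₂ h₂).trans (mul_le_mul_of_nonneg_left hB' hK)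
  have ht1 := tri_pos hl
  have ht2 := tri_lt_tri hlk
  have ht : (0 : ℝ) < tri k := by exact_mod_cast (by omega : 0 < tri k)
  set u : ℝ := (tri l : ℝ) / tri k with hu
  set v : ℝ := ((tri k - tri l : ℕ) : ℝ) / tri k with hv
  have hu0 : 0 < u := div_pos (by exact_mod_cast ht1) ht
  have hv0 : 0 < v := div_pos (by exact_mod_cast Nat.sub_pos_of_lt ht2) ht
  have huv : u + v = 1 := by
    rw [hu, hv, ← add_div, div_eq_one_iff_eq ht.ne']
    push_cast [Nat.cast_sub ht2.le]; ring
  have e1 : ((2 * tri k : ℕ) : ℝ) * u = (2 * tri l : ℕ) := by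
    rw [hu]; push_cast; field_simp
  have e2 : ((2 * tri k : ℕ) : ℝ) * v = (2 * tri k - 2 * tri l : ℕ) := by
    rw [hv, ← Nat.mul_sub]; push_cast; field_simp
  have E1 : ∀ x : ℝ, 0 ≤ x → (x ^ (2 * tri k)) ^ u = x ^ (2 * tri l) := by
    intro x hx
    rw [← Real.rpow_natCast, ← Real.rpow_mul hx, e1, Real.rpow_natCast]
  have E2 : ∀ x : ℝ, 0 ≤ x → (x ^ (2 * tri k)) ^ v = x ^ (2 * tri k - 2 * tri l) := by
    intro x hx
    rw [← Real.rpow_natCast, ← Real.rpow_mul hx, e2, Real.rpow_natCast]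
  calc mixed p k l n (2 * tri k - 2 * tri l) c S₂ S₁
      = ∑ t : Fin (k + 1) → ZMod (p ^ (k * n)), (‖expSum p t id c S₁‖ ^ (2 * tri k)) ^ u *
          (‖expSum p t id c S₂‖ ^ (2 * tri k)) ^ v := by
        refine Finset.sum_congr rfl fun t _ => ?_
        rw [E1 _ (norm_nonneg _), E2 _ (norm_nonneg _), mul_comm]
    _ ≤ _ := sum_rpow_mul_rpow_le _ _ _ (fun _ => by positivity) (fun _ => by positivity)
        hu0 hv0 huv
    _ ≤ (K * A ^ (2 * tri k)) ^ u * (K * B ^ (2 * tri k)) ^ v := by gcongr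
    _ = K ^ (u + v) * ((A ^ (2 * tri k)) ^ u * (B ^ (2 * tri k)) ^ v) := by
        rw [Real.mul_rpow hK (by positivity), Real.mul_rpow hK (by positivity),
          Real.rpow_add_of_nonneg hK hu0.le hv0.le]
        ring
    _ = _ := by rw [huv, Real.rpow_one, E1 _ hA, E2 _ hB]

theorem Bil.swap {k l a b n : ℕ} {K₁ K₂ θ : ℝ} (hl : 1 ≤ l) (hlk : l < k) (hK₁ : 0 ≤ K₁)
    (hK₂ : 0 ≤ K₂) (hθ : θ * (k - l + 1) = 1) (h₁ : Bil p k (k - l) b a n K₁)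
    (h₂ : Bil p k (l - 1) a b n K₂) : Bil p k l a b n (K₁ ^ θ * K₂ ^ (1 - θ)) := by
  intro c S₁ S₂ hS₁ hS₂ hsep A B hA hB hA' hB'
  have g₁ := h₁ c S₂ S₁ hS₂ hS₁ hsep.symm B A hB hA hB' hA'
  have g₂ := h₂ c S₁ S₂ hS₁ hS₂ hsep A B hA hB hA' hB'
  obtain ⟨m, rfl⟩ : ∃ m, l = m + 1 := ⟨l - 1, by omega⟩
  obtain ⟨d, rfl⟩ : ∃ d, k = m + 1 + d := ⟨k - (m + 1), by omega⟩
  simp only [Nat.add_sub_cancel, Nat.add_sub_cancel_left] at g₁ g₂ ⊢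
  have hθ' : θ = 1 / (d + 1) := by
    rw [eq_div_iff (by positivity)]
    push_cast at hθ
    linarith
  have hd : (1 : ℝ) ≤ d := by exact_mod_cast (by omega : 1 ≤ d)
  have hθ0 : 0 < θ := by rw [hθ']; positivity
  have hθ1 : 0 < 1 - θ := by
    rw [hθ', sub_pos, div_lt_one (by positivity)]; linarith
  have t1 := two_mul_tri d
  have t2 := two_mul_tri m
  have t3 := two_mul_tri (m + 1)
  have t4 := two_mul_tri (m + 1 + d)
  have e1 : (((2 * tri (m + 1 + d) - 2 * tri d : ℕ) : ℝ)) * θ + ((2 * tri m : ℕ) : ℝ) * (1 - θ) =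
      ((2 * tri (m + 1) : ℕ) : ℝ) := by
    rw [Nat.cast_sub (Nat.mul_le_mul_left _ (tri_le_tri (by omega))), t1, t2, t3, t4, hθ']
    push_cast
    field_simp
    ring
  have e2 : (((2 * tri d : ℕ) : ℝ)) * θ +
      ((2 * tri (m + 1 + d) - 2 * tri m : ℕ) : ℝ) * (1 - θ) =
      ((2 * tri (m + 1 + d) - 2 * tri (m + 1) : ℕ) : ℝ) := by
    rw [Nat.cast_sub (Nat.mul_le_mul_left _ (tri_le_tri (by omega))),
      Nat.cast_sub (Nat.mul_le_mul_left _ (tri_le_tri (by omega))), t1, t2, t3, t4, hθ']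
    push_cast
    field_simp
    ring
  calc mixed p (m + 1 + d) (m + 1) n (2 * tri (m + 1 + d) - 2 * tri (m + 1)) c S₂ S₁
      = ∑ t : Fin (m + 1 + d + 1) → ZMod (p ^ ((m + 1 + d) * n)),
          (‖expSum p t id c S₁‖ ^ (2 * tri (m + 1 + d) - 2 * tri d) *
            ‖expSum p t id c S₂‖ ^ (2 * tri d)) ^ θ *
          (‖expSum p t id c S₂‖ ^ (2 * tri (m + 1 + d) - 2 * tri m) *
            ‖expSum p t id c S₁‖ ^ (2 * tri m)) ^ (1 - θ) := by
        refine Finset.sum_congr rfl fun t _ => ?_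
        rw [← pow_rpow_mul_pow_rpow (norm_nonneg _) hθ0.le hθ1.le e1,
          ← pow_rpow_mul_pow_rpow (norm_nonneg _) hθ0.le hθ1.le e2,
          Real.mul_rpow (by positivity) (by positivity),
          Real.mul_rpow (by positivity) (by positivity)]
        ring
    _ ≤ _ := sum_rpow_mul_rpow_le _ _ _ (fun _ => by positivity) (fun _ => by positivity)
        hθ0 hθ1 (by ring)
    _ ≤ (K₁ * (B ^ (2 * tri d) * A ^ (2 * tri (m + 1 + d) - 2 * tri d))) ^ θ *
        (K₂ * (A ^ (2 * tri m) * B ^ (2 * tri (m + 1 + d) - 2 * tri m))) ^ (1 - θ) := by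
        have z₁ := mixed_nonneg (p := p) (m + 1 + d) d n (2 * tri (m + 1 + d) - 2 * tri d) c S₁ S₂
        have z₂ := mixed_nonneg (p := p) (m + 1 + d) m n (2 * tri (m + 1 + d) - 2 * tri m) c S₂ S₁
        exact mul_le_mul (Real.rpow_le_rpow z₁ g₁ hθ0.le) (Real.rpow_le_rpow z₂ g₂ hθ1.le)
          (Real.rpow_nonneg z₂ _) (Real.rpow_nonneg (z₁.trans g₁) _)
    _ = _ := by
        rw [← pow_rpow_mul_pow_rpow hA hθ0.le hθ1.le e1,
          ← pow_rpow_mul_pow_rpow hB hθ0.le hθ1.le e2,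
          Real.mul_rpow hK₁ (by positivity), Real.mul_rpow hK₂ (by positivity),
          Real.mul_rpow (by positivity) (by positivity),
          Real.mul_rpow (by positivity) (by positivity)]
        ring

theorem card_fiber_nonempty_le {a a' : ℕ} (h : a ≤ a') {S : Finset ℤ} (hS : InClass p a S) :
    (Finset.univ.filter fun j : ZMod (p ^ a') => (fiber p S id a' j).Nonempty).card ≤
      p ^ (a' - a) := by
  classical
  rcases S.eq_empty_or_nonempty with rfl | ⟨c, hc⟩
  · simp [fiber]
  have hp : (p : ℤ) ≠ 0 := by exact_mod_cast (Fact.out : p.Prime).ne_zero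
  calc _ ≤ (Finset.univ.image fun j : ZMod (p ^ (a' - a)) =>
        ((c + p ^ a * (j.val : ℤ) : ℤ) : ZMod (p ^ a'))).card := by
        refine Finset.card_le_card fun j hj => ?_
        obtain ⟨x, hx⟩ := (Finset.mem_filter.1 hj).2
        obtain ⟨hxS, hxj⟩ := Finset.mem_filter.1 hx
        obtain ⟨y, hy⟩ := hS x hxS c hc
        refine Finset.mem_image.2 ⟨(y : ZMod (p ^ (a' - a))), Finset.mem_univ _, ?_⟩
        rw [← hxj, id, ZMod.intCast_eq_intCast_iff_dvd_sub]
        have : ((p ^ (a' - a) : ℕ) : ℤ) ∣ y - ((y : ZMod (p ^ (a' - a))).val : ℤ) := by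
          rw [← ZMod.intCast_eq_intCast_iff_dvd_sub]; simp
        have e : x - (c + p ^ a * (((y : ZMod (p ^ (a' - a))).val : ℕ) : ℤ)) =
            p ^ a * (y - ((y : ZMod (p ^ (a' - a))).val : ℤ)) := by linarith
        rw [e]
        calc ((p ^ a' : ℕ) : ℤ) = p ^ a * ((p ^ (a' - a) : ℕ) : ℤ) := by
              push_cast; rw [← pow_add]; congr 1; omega
          _ ∣ _ := mul_dvd_mul_left _ this
    _ ≤ _ := Finset.card_image_le
    _ = _ := by rw [Finset.card_univ, ZMod.card]

theorem Bil.of_cost {k l a a' b n : ℕ} {K K' : ℝ} (hl : 1 ≤ l) (hlk : l < k) (ha : a ≤ a')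
    (han : a' ≤ n) (hK : 0 ≤ K) (hK' : 0 ≤ K')
    (hC : ∀ (c : ℤ → ℂ) (S₂ : Finset ℤ), InClass p b S₂ →
      Cost p k l n (2 * tri k - 2 * tri l) c S₂ a a' K)
    (hB : Bil p k l a' b n K') : Bil p k l a b n (K * K') := by
  classical
  intro c S₁ S₂ h₁ h₂ h₃ A B hA hB0 hA' hB'
  have hp : (1 : ℝ) ≤ p := one_le_prime
  have hk : 1 ≤ k := by omega
  have ht1 := tri_pos hl
  have ht2 := tri_lt_tri hlk
  have ht : (0 : ℝ) < tri k := by exact_mod_cast (by omega : 0 < tri k)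
  set m : ℝ := (p : ℝ) ^ (a' - a) with hm
  have hm0 : 0 < m := by positivity
  set u : ℝ := (tri l : ℝ) / tri k with hu
  set v : ℝ := ((tri k - tri l : ℕ) : ℝ) / tri k with hv
  have hu0 : 0 < u := div_pos (by exact_mod_cast ht1) ht
  have hv0 : 0 < v := div_pos (by exact_mod_cast Nat.sub_pos_of_lt ht2) ht
  have huv : u + v = 1 := by
    rw [hu, hv, ← add_div, div_eq_one_iff_eq ht.ne']
    push_cast [Nat.cast_sub ht2.le]; ring
  have e1 : ((2 * tri k : ℕ) : ℝ) * u = (2 * tri l : ℕ) := by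
    rw [hu]; push_cast; field_simp
  let z : ZMod (p ^ a') → ℝ := fun j =>
    ((p : ℝ) ^ (n - a')) ^ (tri k - 1) * pieces p k n c (fiber p S₁ id a' j)
  have hz0 : ∀ j, 0 ≤ z j := fun j => mul_nonneg (by positivity) (pieces_nonneg _ _ _ _)
  have hz : m ^ (tri k - 1) * ∑ j, z j ≤ A ^ (2 * tri k) := by
    refine le_trans (le_of_eq ?_) hA'
    simp only [z]
    rw [← Finset.mul_sum, sum_pieces_fiber hk han, ← mul_assoc, ← mul_pow, hm, ← pow_add]
    congr 4
    omega
  have hM0 : (0 : ℝ) < 2 * tri k := by positivity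
  have hzP : ∀ j, (z j ^ ((2 * tri k : ℕ) : ℝ)⁻¹) ^ (2 * tri k) = z j := fun j =>
    Real.rpow_inv_natCast_pow (hz0 j) (by omega)
  have hzp : ∀ j, (z j ^ ((2 * tri k : ℕ) : ℝ)⁻¹) ^ (2 * tri l) = z j ^ u := by
    intro j
    rw [← Real.rpow_natCast, ← Real.rpow_mul (hz0 j), ← e1, ← mul_assoc,
      inv_mul_cancel₀ (by push_cast; positivity), one_mul]
  have hj : ∀ j, mixed p k l n (2 * tri k - 2 * tri l) c S₂ (fiber p S₁ id a' j) ≤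
      K' * (z j ^ u * B ^ (2 * tri k - 2 * tri l)) := by
    intro j
    rw [← hzp]
    refine hB c _ S₂ (inClass_fiber _ _ _) h₂ (h₃.subset (fiber_subset _ _ _ _) subset_rfl) _ B
      (Real.rpow_nonneg (hz0 j) _) hB0 (by rw [hzP]) hB'
  set J := Finset.univ.filter fun j : ZMod (p ^ a') => (fiber p S₁ id a' j).Nonempty with hJ
  have hJm : (J.card : ℝ) ≤ m := by
    have := card_fiber_nonempty_le ha h₁
    rw [hm]; exact_mod_cast this
  have hsumz : ∑ j ∈ J, z j ^ u ≤ m ^ v * (∑ j, z j) ^ u := by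
    calc ∑ j ∈ J, z j ^ u = ∑ j ∈ J, z j ^ u * (1 : ℝ) ^ v := by simp
      _ ≤ (∑ j ∈ J, z j) ^ u * (∑ j ∈ J, (1 : ℝ)) ^ v :=
        sum_rpow_mul_rpow_le J z (fun _ => 1) hz0 (fun _ => zero_le_one) hu0 hv0 huv
      _ ≤ (∑ j, z j) ^ u * m ^ v := by
        have h1 : ∑ j ∈ J, z j ≤ ∑ j, z j := Finset.sum_le_univ_sum_of_nonneg hz0
        have h2 : 0 ≤ ∑ j ∈ J, z j := Finset.sum_nonneg fun j _ => hz0 j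
        have h3 : ∑ j ∈ J, (1 : ℝ) ≤ m := by simpa using hJm
        have h4 : 0 ≤ ∑ j ∈ J, (1 : ℝ) := by positivity
        exact mul_le_mul (Real.rpow_le_rpow h2 h1 hu0.le) (Real.rpow_le_rpow h4 h3 hv0.le)
          (Real.rpow_nonneg h4 _) (Real.rpow_nonneg (h2.trans h1) _)
      _ = _ := mul_comm _ _
  have hsum : ∑ j : ZMod (p ^ a'), mixed p k l n (2 * tri k - 2 * tri l) c S₂
      (fiber p S₁ id a' j) ≤ K' * (m ^ v * (∑ j, z j) ^ u * B ^ (2 * tri k - 2 * tri l)) := by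
    calc _ = ∑ j ∈ J, mixed p k l n (2 * tri k - 2 * tri l) c S₂ (fiber p S₁ id a' j) := by
          refine (Finset.sum_subset (Finset.subset_univ _) fun j _ hj => ?_).symm
          have : fiber p S₁ id a' j = ∅ := by
            by_contra h
            exact hj (Finset.mem_filter.2 ⟨Finset.mem_univ _, Finset.nonempty_iff_ne_empty.2 h⟩)
          rw [this, mixed_empty hl]
      _ ≤ ∑ j ∈ J, K' * (z j ^ u * B ^ (2 * tri k - 2 * tri l)) :=
          Finset.sum_le_sum fun j _ => hj j
      _ = K' * ((∑ j ∈ J, z j ^ u) * B ^ (2 * tri k - 2 * tri l)) := by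
          rw [← Finset.mul_sum, ← Finset.sum_mul]
      _ ≤ _ := by gcongr
  have hfin : m ^ (tri l - 1) * (m ^ v * (∑ j, z j) ^ u) ≤ A ^ (2 * tri l) := by
    have h4 : (m ^ (tri k - 1) * ∑ j, z j) ^ u ≤ A ^ (2 * tri l) := by
      refine (Real.rpow_le_rpow (mul_nonneg (by positivity)
        (Finset.sum_nonneg fun j _ => hz0 j)) hz hu0.le).trans (le_of_eq ?_)
      rw [← Real.rpow_natCast, ← Real.rpow_mul hA, e1, Real.rpow_natCast]
    refine le_trans (le_of_eq ?_) h4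
    rw [Real.mul_rpow (by positivity) (Finset.sum_nonneg fun j _ => hz0 j), ← mul_assoc]
    congr 1
    rw [← Real.rpow_natCast, ← Real.rpow_natCast, ← Real.rpow_mul hm0.le, ← Real.rpow_add hm0]
    congr 1
    rw [hu, hv, Nat.cast_sub ht1, Nat.cast_sub (show 1 ≤ tri k by omega),
      Nat.cast_sub ht2.le]
    field_simp
    push_cast
    ring
  calc mixed p k l n (2 * tri k - 2 * tri l) c S₂ S₁ ≤ _ := hC c S₂ h₂ S₁ h₁ h₃
    _ ≤ K * (m ^ (tri l - 1) *
        (K' * (m ^ v * (∑ j, z j) ^ u * B ^ (2 * tri k - 2 * tri l)))) := by gcongr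
    _ = K * K' * ((m ^ (tri l - 1) * (m ^ v * (∑ j, z j) ^ u)) *
        B ^ (2 * tri k - 2 * tri l)) := by ring
    _ ≤ _ := by gcongr

end Decoupling

theorem card_pow_norm_sum_le {ι : Type*} [Fintype ι] [Nonempty ι] (f : ι → ℂ) {m M : ℕ}
    (hm : m ≠ 0) (hM : m ≤ M) :
    ‖∑ i, f i‖ ^ m ≤ (Fintype.card ι : ℝ) ^ M * ∑ i, ‖f i‖ ^ m := by
  refine (norm_sum_pow_le _ _ hm).trans ?_
  rw [Finset.card_univ]
  have h : (1 : ℝ) ≤ Fintype.card ι := by exact_mod_cast Fintype.card_pos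
  gcongr
  omega

/-- A sum is controlled by its diagonal part and the products of its distinct terms. -/
theorem norm_sum_pow_le_diag {ι : Type*} [Fintype ι] [Nonempty ι] [DecidableEq ι] (f
     : ι → ℂ) (m q : ℕ) :
    ‖∑ i, f i‖ ^ (m + q) ≤ 2 ^ (m + q) * ∑ i, ‖f i‖ ^ (m + q) +
      (2 * Fintype.card ι) ^ (m + q) * ∑ i, ∑ j ∈ Finset.univ.erase i, ‖f i‖ ^ m * ‖f j‖ ^ q := by
  obtain ⟨a, -, ha⟩ := Finset.exists_max_image Finset.univ (fun i => ‖f i‖) Finset.univ_nonempty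
  have hd0 : 0 ≤ ∑ i, ‖f i‖ ^ (m + q) := by positivity
  have ho0 : 0 ≤ ∑ i, ∑ j ∈ Finset.univ.erase i, ‖f i‖ ^ m * ‖f j‖ ^ q := by positivity
  have hd : ‖f a‖ ^ (m + q) ≤ ∑ i, ‖f i‖ ^ (m + q) :=
    Finset.single_le_sum (f := fun i => ‖f i‖ ^ (m + q)) (fun _ _ => by positivity)
      (Finset.mem_univ a)
  have hsplit : ‖∑ i, f i‖ ≤ ‖f a‖ + ∑ i ∈ Finset.univ.erase a, ‖f i‖ := by
    rw [← Finset.add_sum_erase _ _ (Finset.mem_univ a)]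
    exact (norm_add_le _ _).trans (by gcongr; exact norm_sum_le _ _)
  rcases (Finset.univ.erase a).eq_empty_or_nonempty with he | hne
  · rw [he, Finset.sum_empty, add_zero] at hsplit
    calc ‖∑ i, f i‖ ^ (m + q) ≤ ‖f a‖ ^ (m + q) := by gcongr
      _ ≤ 1 * ∑ i, ‖f i‖ ^ (m + q) := by rw [one_mul]; exact hd
      _ ≤ 2 ^ (m + q) * ∑ i, ‖f i‖ ^ (m + q) := by
        gcongr; exact one_le_pow₀ (by norm_num)
      _ ≤ _ := le_add_of_nonneg_right (by positivity)
  · obtain ⟨c, hc, hcmax⟩ := Finset.exists_max_image _ (fun i => ‖f i‖) hne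
    have hs2 : ∑ i ∈ Finset.univ.erase a, ‖f i‖ ≤ Fintype.card ι * ‖f c‖ := by
      calc _ ≤ ((Finset.univ.erase a).card : ℝ) * ‖f c‖ := by
            rw [← nsmul_eq_mul]; exact Finset.sum_le_card_nsmul _ _ _ hcmax
        _ ≤ _ := by
            gcongr
            exact (Finset.card_le_univ _)
    rcases le_or_gt (Fintype.card ι * ‖f c‖) ‖f a‖ with h | h
    · calc ‖∑ i, f i‖ ^ (m + q) ≤ (2 * ‖f a‖) ^ (m + q) := by gcongr; linarith
        _ = 2 ^ (m + q) * ‖f a‖ ^ (m + q) := by rw [mul_pow]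
        _ ≤ 2 ^ (m + q) * ∑ i, ‖f i‖ ^ (m + q) := by gcongr
        _ ≤ _ := le_add_of_nonneg_right (by positivity)
    · calc ‖∑ i, f i‖ ^ (m + q) ≤ (2 * Fintype.card ι * ‖f c‖) ^ (m + q) := by
            gcongr; linarith
        _ = (2 * Fintype.card ι) ^ (m + q) * (‖f c‖ ^ m * ‖f c‖ ^ q) := by
            rw [mul_pow, pow_add]
            ring
        _ ≤ (2 * Fintype.card ι) ^ (m + q) * (‖f a‖ ^ m * ‖f c‖ ^ q) := by
            gcongr; exact ha c (Finset.mem_univ _)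
        _ ≤ (2 * Fintype.card ι) ^ (m + q) *
            ∑ i, ∑ j ∈ Finset.univ.erase i, ‖f i‖ ^ m * ‖f j‖ ^ q := by
            gcongr
            calc _ ≤ ∑ j ∈ Finset.univ.erase a, ‖f a‖ ^ m * ‖f j‖ ^ q :=
                  Finset.single_le_sum (f := fun j => ‖f a‖ ^ m * ‖f j‖ ^ q)
                    (fun _ _ => by positivity) hc
              _ ≤ _ := Finset.single_le_sum (f := fun i =>
                  ∑ j ∈ Finset.univ.erase i, ‖f i‖ ^ m * ‖f j‖ ^ q)
                    (fun _ _ => by positivity) (Finset.mem_univ a)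
        _ ≤ _ := le_add_of_nonneg_left (by positivity)

section Decoupling

set_option linter.unusedSectionVars false

variable {p : ℕ} [Fact p.Prime]

theorem pieces_fiber_le {k n r : ℕ} (hk : 1 ≤ k) (h : r ≤ n) (b : ℤ → ℂ) (S : Finset ℤ)
    (j : ZMod (p ^ r)) : pieces p k n b (fiber p S id r j) ≤ pieces p k n b S := by
  rw [← sum_pieces_fiber hk h b S]
  exact Finset.single_le_sum (f := fun j => pieces p k n b (fiber p S id r j))
    (fun _ _ => pieces_nonneg _ _ _ _) (Finset.mem_univ j)

/-- A bilinear inequality at fine scales implies a lossy one at the coarsest scale. -/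
theorem Bil.coarse {k l a b n : ℕ} {K : ℝ} (hl : 1 ≤ l) (hlk : l < k) (ha : 1 ≤ a) (hb : 1 ≤ b)
    (han : a ≤ n) (hbn : b ≤ n) (h : Bil p k l a b n K) :
    Bil p k l 1 1 n (((p : ℝ) ^ a) ^ (2 * tri k + 1) * ((p : ℝ) ^ b) ^ (2 * tri k + 1) * K) := by
  intro c S₁ S₂ h₁ h₂ h₃ A B hA hB hA' hB'
  have hp : (1 : ℝ) ≤ p := one_le_prime
  have hk : 1 ≤ k := by omega
  have ht1 := tri_pos hl
  have ht2 := tri_lt_tri hlk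
  have hcard : ∀ r : ℕ, (Fintype.card (ZMod (p ^ r)) : ℝ) = (p : ℝ) ^ r := fun r => by
    rw [ZMod.card]; push_cast; rfl
  have key : ∀ i j, mixed p k l n (2 * tri k - 2 * tri l) c (fiber p S₂ id b j)
      (fiber p S₁ id a i) ≤ K * (A ^ (2 * tri l) * B ^ (2 * tri k - 2 * tri l)) := by
    intro i j
    refine h c _ _ (inClass_fiber _ _ _) (inClass_fiber _ _ _)
      (h₃.subset (fiber_subset _ _ _ _) (fiber_subset _ _ _ _)) A B hA hB ?_ ?_
    · refine le_trans ?_ hA'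
      have := pieces_fiber_le hk han c S₁ i
      have := pieces_nonneg (p := p) k n c (fiber p S₁ id a i)
      gcongr
    · refine le_trans ?_ hB'
      have := pieces_fiber_le hk hbn c S₂ j
      have := pieces_nonneg (p := p) k n c (fiber p S₂ id b j)
      gcongr
  have hpt : ∀ t : Fin (k + 1) → ZMod (p ^ (k * n)),
      ‖expSum p t id c S₂‖ ^ (2 * tri k - 2 * tri l) * ‖expSum p t id c S₁‖ ^ (2 * tri l) ≤
      ((p : ℝ) ^ a) ^ (2 * tri k) * ((p : ℝ) ^ b) ^ (2 * tri k) *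
        ∑ j : ZMod (p ^ b), ∑ i : ZMod (p ^ a),
          ‖expSum p t id c (fiber p S₂ id b j)‖ ^ (2 * tri k - 2 * tri l) *
            ‖expSum p t id c (fiber p S₁ id a i)‖ ^ (2 * tri l) := by
    intro t
    have g1 := card_pow_norm_sum_le (fun j => expSum p t id c (fiber p S₂ id b j))
      (m := 2 * tri k - 2 * tri l) (M := 2 * tri k) (by omega) (by omega)
    have g2 := card_pow_norm_sum_le (fun j => expSum p t id c (fiber p S₁ id a j))
      (m := 2 * tri l) (M := 2 * tri k) (by omega) (by omega)
    rw [sum_expSum_fiber, hcard] at g1 g2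
    refine (mul_le_mul g1 g2 (by positivity) (by positivity)).trans (le_of_eq ?_)
    rw [← Finset.sum_mul_sum]
    ring
  calc mixed p k l n (2 * tri k - 2 * tri l) c S₂ S₁ ≤ _ := Finset.sum_le_sum fun t _ => hpt t
    _ = ((p : ℝ) ^ a) ^ (2 * tri k) * ((p : ℝ) ^ b) ^ (2 * tri k) *
        ∑ j : ZMod (p ^ b), ∑ i : ZMod (p ^ a), mixed p k l n (2 * tri k - 2 * tri l) c
          (fiber p S₂ id b j) (fiber p S₁ id a i) := by
      rw [← Finset.mul_sum]
      congr 1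
      rw [Finset.sum_comm]
      refine Finset.sum_congr rfl fun j _ => ?_
      rw [Finset.sum_comm]
      rfl
    _ ≤ ((p : ℝ) ^ a) ^ (2 * tri k) * ((p : ℝ) ^ b) ^ (2 * tri k) *
        ∑ j : ZMod (p ^ b), ∑ i : ZMod (p ^ a),
          K * (A ^ (2 * tri l) * B ^ (2 * tri k - 2 * tri l)) := by
      gcongr with j _ i _
      exact key i j
    _ = _ := by
      simp only [Finset.sum_const, Finset.card_univ, nsmul_eq_mul, hcard]
      ring

theorem Dec.of_id {k n : ℕ} {K : ℝ} (h : ∀ (S : Finset ℤ) (b : ℤ → ℂ),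
    ∑ t : Fin (k + 1) → ZMod (p ^ (k * n)), ‖expSum p t id b S‖ ^ (2 * tri k) ≤
      K * (((p : ℝ) ^ n) ^ (tri k - 1) * pieces p k n b S)) : Dec p k n K := by
  classical
  intro S y b
  have e : ∀ S' ⊆ S, (∀ x ∈ S, ∀ x' ∈ S', y x = y x' → x ∈ S') →
      ∀ t : Fin (k + 1) → ZMod (p ^ (k * n)), expSum p t y b S' =
        expSum p t id (fun z => ∑ x ∈ S with y x = z, b x) (S'.image y) := by
    intro S' hS' hcl t
    simp only [expSum, id]
    rw [← Finset.sum_fiberwise_of_maps_to (g := y) (t := S'.image y)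
      fun x hx => Finset.mem_image_of_mem y hx]
    refine Finset.sum_congr rfl fun z hz => ?_
    rw [Finset.sum_mul]
    obtain ⟨x', hx', rfl⟩ := Finset.mem_image.1 hz
    have : S'.filter (fun x => y x = y x') = S.filter (fun x => y x = y x') := by
      ext x
      simp only [Finset.mem_filter]
      exact ⟨fun h => ⟨hS' h.1, h.2⟩, fun h => ⟨hcl x h.1 x' hx' h.2, h.2⟩⟩
    rw [← this]
    refine Finset.sum_congr rfl fun x hx => ?_
    rw [(Finset.mem_filter.1 hx).2]
  have hf : ∀ j : ZMod (p ^ n), fiber p (S.image y) id n j = (fiber p S y n j).image y := by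
    intro j
    ext z
    simp only [fiber, Finset.mem_filter, Finset.mem_image, id]
    constructor
    · rintro ⟨⟨x, hx, rfl⟩, h⟩
      exact ⟨x, ⟨hx, h⟩, rfl⟩
    · rintro ⟨x, ⟨hx, h⟩, rfl⟩
      exact ⟨⟨x, hx, rfl⟩, h⟩
  have h0 := h (S.image y) (fun z => ∑ x ∈ S with y x = z, b x)
  rw [mul_assoc]
  simp only [pieces, hf] at h0
  simp only [e S subset_rfl (fun x hx _ _ _ => hx)]
  refine h0.trans (le_of_eq ?_)
  congr 2
  refine Finset.sum_congr rfl fun j _ => Finset.sum_congr rfl fun t _ => ?_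
  rw [e _ (fiber_subset _ _ _ _)]
  intro x hx x' hx' hxx
  simp only [fiber, Finset.mem_filter] at hx' ⊢
  exact ⟨hx, by rw [hxx]; exact hx'.2⟩

theorem Dec.of_bil {k l n : ℕ} {K B : ℝ} (hl : 1 ≤ l) (hlk : l < k) (hn : 1 ≤ n) (hK : 0 ≤ K)
    (hB : 0 ≤ B) (hp : (2 : ℝ) ^ (2 * tri k + 1) ≤ (p : ℝ) ^ (tri k - 1))
    (hD : Dec p k (n - 1) K) (h : Bil p k l 1 1 n B) :
    Dec p k n (K / 2 + (2 * p) ^ (2 * tri k + 2) * B) := by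
  classical
  refine Dec.of_id fun S c => ?_
  have hp1 : (1 : ℝ) ≤ p := one_le_prime
  have hk : 1 ≤ k := by omega
  have ht1 := tri_pos hl
  have ht2 := tri_lt_tri hlk
  have hcard : (Fintype.card (ZMod (p ^ 1)) : ℝ) = p := by
    rw [ZMod.card]; push_cast; simp
  set W : ℝ := ((p : ℝ) ^ (n - 1)) ^ (tri k - 1) * pieces p k n c S with hW
  have hW0 : 0 ≤ W := mul_nonneg (by positivity) (pieces_nonneg _ _ _ _)
  set A : ℝ := W ^ ((2 * tri k : ℕ) : ℝ)⁻¹ with hA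
  have hA0 : 0 ≤ A := Real.rpow_nonneg hW0 _
  have hAW : A ^ (2 * tri k) = W := Real.rpow_inv_natCast_pow hW0 (by omega)
  have hdiag : ∑ i : ZMod (p ^ 1), ∑ t : Fin (k + 1) → ZMod (p ^ (k * n)),
      ‖expSum p t id c (fiber p S id 1 i)‖ ^ (2 * tri k) ≤ K * W := by
    calc _ ≤ ∑ i : ZMod (p ^ 1), K * (((p : ℝ) ^ (n - 1)) ^ (tri k - 1) *
          pieces p k n c (fiber p S id 1 i)) :=
          Finset.sum_le_sum fun i _ => hD.rescale hk hn hK c _ (inClass_fiber _ _ _)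
      _ = _ := by rw [← Finset.mul_sum, ← Finset.mul_sum, sum_pieces_fiber hk hn]
  have hoff : ∀ i j : ZMod (p ^ 1), j ∈ Finset.univ.erase i →
      ∑ t : Fin (k + 1) → ZMod (p ^ (k * n)),
        ‖expSum p t id c (fiber p S id 1 i)‖ ^ (2 * tri l) *
          ‖expSum p t id c (fiber p S id 1 j)‖ ^ (2 * tri k - 2 * tri l) ≤ B * W := by
    intro i j hij
    have hsep : Separated p (fiber p S id 1 i) (fiber p S id 1 j) := by
      intro x hx y hy hd
      have hx := (Finset.mem_filter.1 hx).2
      have hy := (Finset.mem_filter.1 hy).2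
      refine (Finset.mem_erase.1 hij).1 ?_
      rw [← hx, ← hy, id, id, ZMod.intCast_eq_intCast_iff_dvd_sub, pow_one]
      exact hd
    have := h c _ _ (inClass_fiber S 1 i) (inClass_fiber S 1 j) hsep A A hA0 hA0 (by
      rw [hAW, hW]
      have := pieces_fiber_le hk hn c S i
      gcongr) (by
      rw [hAW, hW]
      have := pieces_fiber_le hk hn c S j
      gcongr)
    rw [← pow_add, Nat.add_sub_cancel' (by omega), hAW] at this
    refine le_trans (le_of_eq ?_) this
    exact Finset.sum_congr rfl fun t _ => mul_comm _ _
  have hpt : ∀ t : Fin (k + 1) → ZMod (p ^ (k * n)), ‖expSum p t id c S‖ ^ (2 * tri k) ≤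
      2 ^ (2 * tri k) * ∑ i : ZMod (p ^ 1), ‖expSum p t id c (fiber p S id 1 i)‖ ^ (2 * tri k) +
      (2 * p) ^ (2 * tri k) * ∑ i : ZMod (p ^ 1), ∑ j ∈ Finset.univ.erase i,
        ‖expSum p t id c (fiber p S id 1 i)‖ ^ (2 * tri l) *
          ‖expSum p t id c (fiber p S id 1 j)‖ ^ (2 * tri k - 2 * tri l) := by
    intro t
    have := norm_sum_pow_le_diag (fun i => expSum p t id c (fiber p S id 1 i)) (2 * tri l)
      (2 * tri k - 2 * tri l)
    rwa [sum_expSum_fiber, hcard, Nat.add_sub_cancel' (by omega)] at this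
  have hn1 : ((p : ℝ) ^ n) ^ (tri k - 1) * pieces p k n c S = (p : ℝ) ^ (tri k - 1) * W := by
    rw [hW, ← mul_assoc, ← mul_pow, ← pow_succ', Nat.sub_add_cancel hn]
  have hsumoff : ∑ i : ZMod (p ^ 1), ∑ j ∈ Finset.univ.erase i, B * W ≤ p ^ 2 * (B * W) := by
    have hBW : 0 ≤ B * W := by positivity
    calc _ ≤ ∑ i : ZMod (p ^ 1), ∑ j : ZMod (p ^ 1), B * W :=
          Finset.sum_le_sum fun i _ => Finset.sum_le_univ_sum_of_nonneg fun _ => hBW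
      _ = _ := by
        simp only [Finset.sum_const, Finset.card_univ, nsmul_eq_mul, hcard]
        ring
  calc ∑ t : Fin (k + 1) → ZMod (p ^ (k * n)), ‖expSum p t id c S‖ ^ (2 * tri k)
      ≤ _ := Finset.sum_le_sum fun t _ => hpt t
    _ = 2 ^ (2 * tri k) * ∑ i : ZMod (p ^ 1), ∑ t : Fin (k + 1) → ZMod (p ^ (k * n)),
          ‖expSum p t id c (fiber p S id 1 i)‖ ^ (2 * tri k) +
        (2 * p) ^ (2 * tri k) * ∑ i : ZMod (p ^ 1), ∑ j ∈ Finset.univ.erase i,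
          ∑ t : Fin (k + 1) → ZMod (p ^ (k * n)),
          ‖expSum p t id c (fiber p S id 1 i)‖ ^ (2 * tri l) *
            ‖expSum p t id c (fiber p S id 1 j)‖ ^ (2 * tri k - 2 * tri l) := by
        rw [Finset.sum_add_distrib, ← Finset.mul_sum, ← Finset.mul_sum]
        congr 2
        · rw [Finset.sum_comm]
        · rw [Finset.sum_comm]
          refine Finset.sum_congr rfl fun i _ => ?_
          rw [Finset.sum_comm]
    _ ≤ 2 ^ (2 * tri k) * (K * W) + (2 * p) ^ (2 * tri k) * (p ^ 2 * (B * W)) := by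
        refine add_le_add (by gcongr) (mul_le_mul_of_nonneg_left ?_ (by positivity))
        exact (Finset.sum_le_sum fun i _ => Finset.sum_le_sum fun j hj => hoff i j hj).trans
          hsumoff
    _ ≤ _ := by
        rw [hn1]
        have i1 : 2 ^ (2 * tri k) * (K * W) ≤ K / 2 * ((p : ℝ) ^ (tri k - 1) * W) := by
          have : 0 ≤ K * W := by positivity
          rw [pow_succ] at hp
          nlinarith
        have i2 : (2 * (p : ℝ)) ^ (2 * tri k) * (p ^ 2 * (B * W)) ≤
            (2 * p) ^ (2 * tri k + 2) * B * ((p : ℝ) ^ (tri k - 1) * W) := by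
          have h1 : (1 : ℝ) ≤ (p : ℝ) ^ (tri k - 1) := one_le_pow₀ hp1
          calc (2 * (p : ℝ)) ^ (2 * tri k) * (p ^ 2 * (B * W))
              = (2 * (p : ℝ)) ^ (2 * tri k) * p ^ 2 * B * (1 * W) := by ring
            _ ≤ (2 * p) ^ (2 * tri k) * (2 * p) ^ 2 * B * ((p : ℝ) ^ (tri k - 1) * W) := by
              gcongr
              linarith
            _ = _ := by ring
        linarith

end Decoupling

/-- The gain exponents of the bilinear bootstrapping. -/
noncomputable def gain (k : ℕ) : ℕ → ℕ → ℝ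
  | _, 0 => 1
  | 0, _ + 1 => 0
  | r + 1, l + 1 => gain k r (k - (l + 1)) / (l + 1) +
      ((k : ℝ) - (l + 1)) / ((k : ℝ) - (l + 1) + 1) * gain k r l

theorem gain_zero_right (k r : ℕ) : gain k r 0 = 1 := by
  cases r <;> rfl

theorem gain_sum {k : ℕ} (hk : 1 ≤ k) (r : ℕ) :
    ∑ l ∈ Finset.range (k - 1), gain k r (l + 1) = r * ((k - 1) / k) := by
  obtain ⟨m, rfl⟩ : ∃ m, k = m + 1 := ⟨k - 1, by omega⟩
  rw [Nat.add_sub_cancel]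
  induction r with
  | zero => simp [gain]
  | succ r ih =>
    simp only [gain]
    rw [Finset.sum_add_distrib]
    have h1 : ∑ l ∈ Finset.range m, gain (m + 1) r (m + 1 - (l + 1)) / ((l : ℝ) + 1) =
        ∑ l ∈ Finset.range m, gain (m + 1) r (l + 1) * (1 / ((m : ℝ) - l)) := by
      rw [← Finset.sum_range_reflect]
      refine Finset.sum_congr rfl fun l hl => ?_
      have hl := Finset.mem_range.1 hl
      rw [show m + 1 - (m - 1 - l + 1) = l + 1 by omega, show m - 1 - l = m - (l + 1) by omega,
        Nat.cast_sub (by omega)]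
      push_cast
      ring_nf
    have h2 : ∑ l ∈ Finset.range m, (((m + 1 : ℕ) : ℝ) - (l + 1)) / (((m + 1 : ℕ) : ℝ) - (l + 1) + 1) *
          gain (m + 1) r l =
        (m : ℝ) / (m + 1) + ∑ l ∈ Finset.range m, gain (m + 1) r (l + 1) *
          (((m : ℝ) - l - 1) / (m - l)) := by
      have : ∑ l ∈ Finset.range (m + 1), (((m + 1 : ℕ) : ℝ) - (l + 1)) /
          (((m + 1 : ℕ) : ℝ) - (l + 1) + 1) * gain (m + 1) r l =
          ∑ l ∈ Finset.range m, (((m + 1 : ℕ) : ℝ) - (l + 1)) /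
          (((m + 1 : ℕ) : ℝ) - (l + 1) + 1) * gain (m + 1) r l := by
        rw [Finset.sum_range_succ]; simp
      rw [← this, Finset.sum_range_succ', gain_zero_right]
      push_cast
      rw [add_comm]
      congr 1
      · ring_nf
      · refine Finset.sum_congr rfl fun l hl => ?_
        ring_nf
    rw [h1, h2, add_left_comm, ← Finset.sum_add_distrib]
    have : ∀ l ∈ Finset.range m, gain (m + 1) r (l + 1) * (1 / ((m : ℝ) - l)) +
        gain (m + 1) r (l + 1) * (((m : ℝ) - l - 1) / (m - l)) = gain (m + 1) r (l + 1) := by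
      intro l hl
      have hl : (l : ℝ) < m := by exact_mod_cast Finset.mem_range.1 hl
      have : (m : ℝ) - l ≠ 0 := by linarith
      field_simp
      ring
    rw [Finset.sum_congr rfl this, ih]
    push_cast
    ring

theorem exists_gain_ge {k : ℕ} (hk : 2 ≤ k) (T : ℝ) :
    ∃ r l, 1 ≤ l ∧ l < k ∧ T ≤ gain k r l := by
  obtain ⟨r, hr⟩ := exists_nat_ge (T * k)
  have h := gain_sum (by omega : 1 ≤ k) r
  have hk0 : (0 : ℝ) < k := by exact_mod_cast (by omega : 0 < k)
  have : ∑ l ∈ Finset.range (k - 1), T ≤ ∑ l ∈ Finset.range (k - 1), gain k r (l + 1) := by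
    rw [h, Finset.sum_const, Finset.card_range, nsmul_eq_mul, Nat.cast_sub (by omega), Nat.cast_one]
    have : (1 : ℝ) ≤ k := by exact_mod_cast (by omega : 1 ≤ k)
    have h3 : T ≤ r / k := by rw [le_div_iff₀ hk0]; exact hr
    calc ((k : ℝ) - 1) * T ≤ (k - 1) * (r / k) :=
          mul_le_mul_of_nonneg_left h3 (by linarith)
      _ = _ := by ring
  obtain ⟨l, hl, hle⟩ := Finset.exists_le_of_sum_le (by simpa using (by omega : k - 1 ≠ 0)) this
  exact ⟨r, l + 1, by omega, by have := Finset.mem_range.1 hl; omega, hle⟩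

section Decoupling

set_option linter.unusedSectionVars false

variable {p : ℕ} [Fact p.Prime]

/-- Decoupling with exponent `η` in the number of scales. -/
def DecExp (p : ℕ) [Fact p.Prime] (k : ℕ) (η : ℝ) : Prop :=
  ∃ C : ℝ, 1 ≤ C ∧ ∀ n : ℕ, Dec p k n (C * (p : ℝ) ^ (η * n))

theorem one_lt_prime : (1 : ℝ) < p := by exact_mod_cast (Fact.out : p.Prime).one_lt

theorem DecExp.bil {k : ℕ} (hk : 2 ≤ k) (hkp : k < p) (hD : ∀ l, 1 ≤ l → l < k → DecEps p l)
    {η : ℝ} (hη : 0 ≤ η) (h : DecExp p k η) (r : ℕ) : ∀ ε : ℝ, 0 < ε → ∃ C : ℝ, 1 ≤ C ∧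
      ∀ n b l : ℕ, 1 ≤ l → l < k → k.factorial ^ (r + 1) ∣ b → b * k ^ (r + 1) ≤ n →
        Bil p k l ((k - l + 1) * b / l) b n
          (C * (p : ℝ) ^ (η * n - η * gain k r l * b + ε * n)) := by
  have hp := one_lt_prime (p := p)
  have hp0 : (0 : ℝ) < p := by linarith
  have hdvd : ∀ l r b : ℕ, 1 ≤ l → l < k → k.factorial ^ (r + 1) ∣ b → l ∣ b := by
    intro l r b hl hlk hb
    exact (Nat.dvd_factorial hl hlk.le).trans ((dvd_pow_self _ (Nat.succ_ne_zero r)).trans hb)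
  have hale : ∀ l b : ℕ, 1 ≤ l → (k - l + 1) * b / l ≤ k * b := by
    intro l b hl
    exact (Nat.div_le_self _ _).trans (Nat.mul_le_mul_right _ (by omega))
  obtain ⟨C₀, hC₀, hC₀'⟩ := h
  induction r with
  | zero =>
    intro ε hε
    refine ⟨C₀, hC₀, fun n b l hl hlk hb hbn => ?_⟩
    have hkb : k * b ≤ n := by simpa [mul_comm] using hbn
    have hbb : b ≤ n := le_trans (by nlinarith) hkb
    have haa := (hale l b hl).trans hkb
    have hg : gain k 0 l = 0 := by
      obtain ⟨m, rfl⟩ : ∃ m, l = m + 1 := ⟨l - 1, by omega⟩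
      rfl
    have hmono : ∀ m, m ≤ n → Dec p k (n - m)
        (C₀ * (p : ℝ) ^ (η * n - η * gain k 0 l * b + ε * n)) := by
      intro m hm
      refine (hC₀' (n - m)).mono ?_
      gcongr
      · exact hp.le
      · rw [hg, mul_zero, zero_mul, sub_zero]
        have : ((n - m : ℕ) : ℝ) ≤ n := by exact_mod_cast Nat.sub_le n m
        nlinarith [mul_nonneg hε.le (Nat.cast_nonneg (α := ℝ) n)]
    exact Bil.of_dec hl hlk haa hbb (by positivity) (hmono _ haa) (hmono _ hbb)
  | succ r ih =>
    intro ε hε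
    obtain ⟨C, hC, hC'⟩ := ih (ε / 2) (by linarith)
    have hcost : ∃ C₁ : ℝ, 1 ≤ C₁ ∧ ∀ l, 1 ≤ l → l < k → ∀ (n b q r r' : ℕ), r ≤ r' → b ≤ n →
        r' ≤ n → l * r' ≤ (k - l + 1) * b → q ≠ 0 → ∀ (a : ℤ → ℂ) (S₂ : Finset ℤ), InClass p b S₂ →
        Cost p k l n q a S₂ r r' (C₁ * (p : ℝ) ^ (ε / 2 * n)) := by
      have hβ : 1 < (p : ℝ) ^ (ε / 2) := Real.one_lt_rpow hp (by linarith)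
      choose! c hc1 hc2 using fun l (hl : 1 ≤ l) (hlk : l < k) =>
        (hD l hl hlk).cost hl hlk hkp hβ
      refine ⟨1 + ∑ l ∈ (Finset.range k).filter (1 ≤ ·), c l,
        le_add_of_nonneg_right (Finset.sum_nonneg fun l hl => ?_), ?_⟩
      · simp only [Finset.mem_filter, Finset.mem_range] at hl
        linarith [hc1 l hl.2 hl.1]
      intro l hl hlk n b q r r' hr hb hr'n hrb hq a S₂ hS₂
      refine (hc2 l hl hlk n b q r r' hr hb hrb hq a S₂ hS₂).mono ?_
      have h1 : c l ≤ 1 + ∑ l ∈ (Finset.range k).filter (1 ≤ ·), c l := by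
        have := Finset.single_le_sum (f := c) (s := (Finset.range k).filter (1 ≤ ·))
          (fun l hl => by
            simp only [Finset.mem_filter, Finset.mem_range] at hl
            linarith [hc1 l hl.2 hl.1]) (a := l) (by simp [hl, hlk])
        linarith
      have h2 : ((p : ℝ) ^ (ε / 2)) ^ r' ≤ (p : ℝ) ^ (ε / 2 * n) := by
        rw [← Real.rpow_natCast, ← Real.rpow_mul hp0.le]
        gcongr
        exact hp.le
      have := hc1 l hl hlk
      exact mul_le_mul h1 h2 (by positivity) (by linarith)
    obtain ⟨C₁, hC₁, hC₁'⟩ := hcost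
    refine ⟨C₀ * (C₁ * C), ?_, fun n b l hl hlk hb hbn => ?_⟩
    · exact one_le_mul_of_one_le_of_one_le hC₀ (one_le_mul_of_one_le_of_one_le hC₁ hC)
    have hkk : 1 ≤ k ^ (r + 1) := Nat.one_le_pow _ _ (by omega)
    have hbn' : (k * b) * k ^ (r + 1) ≤ n := by
      refine le_trans (le_of_eq ?_) hbn
      ring
    set a := (k - l + 1) * b / l with ha
    have hla : l * a = (k - l + 1) * b := by
      rw [ha]
      exact Nat.mul_div_cancel' (Dvd.dvd.mul_left (hdvd l _ b hl hlk hb) _)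
    have hakb : a ≤ k * b := hale l b hl
    have han : a * k ^ (r + 1) ≤ n := (Nat.mul_le_mul_right _ hakb).trans hbn'
    have hkan : k * a ≤ n := by
      refine le_trans ?_ han
      rw [mul_comm]
      exact Nat.mul_le_mul_left _ (Nat.le_self_pow (by omega) k)
    have hkbn : k * b ≤ n := le_trans (Nat.le_mul_of_pos_right _ hkk) hbn'
    have hbk : b * k ^ (r + 1) ≤ n := by
      refine le_trans ?_ hbn'
      exact Nat.mul_le_mul_right _ (Nat.le_mul_of_pos_left _ (by omega))
    have hbn1 : b ≤ n := le_trans (Nat.le_mul_of_pos_left _ (by omega)) hkbn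
    have han1 : a ≤ n := le_trans (Nat.le_mul_of_pos_left _ (by omega)) hkan
    have hda : k.factorial ^ (r + 1) ∣ a := by
      have : k.factorial ^ (r + 1) * l ∣ l * a := by
        rw [hla]
        refine Dvd.dvd.mul_left (Dvd.dvd.trans ?_ hb) _
        rw [pow_succ _ (r + 1)]
        exact mul_dvd_mul_left _ (Nat.dvd_factorial hl hlk.le)
      rw [mul_comm] at this
      exact Nat.dvd_of_mul_dvd_mul_left (by omega) this
    have hdb : k.factorial ^ (r + 1) ∣ b := (pow_dvd_pow _ (by omega)).trans hb
    have hq0 : ∀ l', l' < k → 2 * tri k - 2 * tri l' ≠ 0 := fun l' h => by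
      have := tri_lt_tri h; omega
    -- the two inputs of the interchange inequality
    have B₁ : Bil p k (k - l) b a n (C₁ * (p : ℝ) ^ (ε / 2 * n) *
        (C * (p : ℝ) ^ (η * n - η * gain k r (k - l) * a + ε / 2 * n))) := by
      set b' := (k - (k - l) + 1) * a / (k - l) with hb'
      have hlb' : (k - l) * b' = (k - (k - l) + 1) * a :=
        Nat.mul_div_cancel' (Dvd.dvd.mul_left (hdvd (k - l) _ a (by omega) (by omega) hda) _)
      have hbb' : b ≤ b' := by
        rw [Nat.sub_sub_self hlk.le] at hlb'
        have h1 : l * ((k - l) * b) ≤ l * ((k - l) * b') := by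
          calc l * ((k - l) * b) ≤ (l + 1) * ((k - l + 1) * b) := by gcongr <;> omega
            _ = l * ((k - l) * b') := by rw [hlb', ← hla]; ring
        exact Nat.le_of_mul_le_mul_left (Nat.le_of_mul_le_mul_left h1 hl) (by omega)
      have hb'n : b' ≤ n := (hale (k - l) a (by omega)).trans hkan
      exact Bil.of_cost (by omega) (by omega) hbb' hb'n (by positivity) (by positivity)
        (fun c S₂ hS₂ => hC₁' (k - l) (by omega) (by omega) n a _ b b' hbb' han1 hb'n hlb'.le
          (hq0 _ (by omega)) c S₂ hS₂) (hC' n a (k - l) (by omega) (by omega) hda han)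
    have B₂ : Bil p k (l - 1) a b n (C₀ * (C₁ * (p : ℝ) ^ (ε / 2 * n) *
        (C * (p : ℝ) ^ (η * n - η * gain k r (l - 1) * b + ε / 2 * n)))) := by
      rcases Nat.eq_or_lt_of_le hl with hl1 | hl1
      · rw [← hl1, Nat.sub_self, gain_zero_right]
        refine (Bil.zero (by omega) hbn1 (by positivity) (hC₀' (n - b))).mono ?_
        have i1 : (1 : ℝ) ≤ C₁ * (p : ℝ) ^ (ε / 2 * n) :=
          one_le_mul_of_one_le_of_one_le hC₁ (Real.one_le_rpow hp.le (by positivity))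
        have i2 : (p : ℝ) ^ (η * (n - b : ℕ)) ≤ C * (p : ℝ) ^ (η * n - η * 1 * b + ε / 2 * n) := by
          calc (p : ℝ) ^ (η * (n - b : ℕ)) = 1 * (p : ℝ) ^ (η * (n - b : ℕ)) := by rw [one_mul]
            _ ≤ _ := by
              gcongr
              · exact hp.le
              · rw [Nat.cast_sub hbn1]
                have : 0 ≤ ε / 2 * n := by positivity
                linarith
        gcongr
        refine i2.trans ?_
        exact le_mul_of_one_le_left (by positivity) i1
      · set a' := (k - (l - 1) + 1) * b / (l - 1) with ha'
        have hla' : (l - 1) * a' = (k - (l - 1) + 1) * b :=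
          Nat.mul_div_cancel' (Dvd.dvd.mul_left
            (hdvd (l - 1) _ b (by omega) (by omega) hdb) _)
        have haa' : a ≤ a' := by
          have h1 : (l - 1) * a ≤ (l - 1) * a' := by
            calc (l - 1) * a ≤ l * a := by gcongr; omega
              _ = (k - l + 1) * b := hla
              _ ≤ (k - (l - 1) + 1) * b := by gcongr; omega
              _ = _ := hla'.symm
          exact Nat.le_of_mul_le_mul_left h1 (by omega)
        have ha'n : a' ≤ n := (hale (l - 1) b (by omega)).trans hkbn
        have := Bil.of_cost (by omega) (by omega) haa' ha'n (by positivity) (by positivity)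
          (fun c S₂ hS₂ => hC₁' (l - 1) (by omega) (by omega) n b _ a a' haa' hbn1 ha'n hla'.le
            (hq0 _ (by omega)) c S₂ hS₂) (hC' n b (l - 1) (by omega) (by omega) hdb hbk)
        exact this.mono (le_mul_of_one_le_left (by positivity) hC₀)
    have hkl : (0 : ℝ) < (k : ℝ) - l + 1 := by
      have : (l : ℝ) < k := by exact_mod_cast hlk
      linarith
    set θ : ℝ := 1 / ((k : ℝ) - l + 1) with hθ
    have hθ0 : 0 < θ := by positivity
    have hθm : θ * ((k : ℝ) - l + 1) = 1 := by rw [hθ]; field_simp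
    refine (Bil.swap hl hlk (by positivity) (by positivity) hθm
      (B₁.mono (le_mul_of_one_le_left (by positivity) hC₀)) B₂).mono (le_of_eq ?_)
    have hreal : (l : ℝ) * a = ((k : ℝ) - l + 1) * b := by
      have : ((l * a : ℕ) : ℝ) = ((k - l + 1) * b : ℕ) := by rw [hla]
      push_cast [Nat.cast_sub hlk.le] at this
      exact this
    have hform : ∀ x : ℝ, C₀ * (C₁ * (p : ℝ) ^ (ε / 2 * n) * (C * (p : ℝ) ^ x)) =
        C₀ * (C₁ * C) * (p : ℝ) ^ (ε / 2 * n + x) := by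
      intro x
      rw [Real.rpow_add hp0]; ring
    have hCp : 0 < C₀ * (C₁ * C) := by positivity
    rw [hform, hform, Real.mul_rpow hCp.le (by positivity), Real.mul_rpow hCp.le (by positivity),
      mul_mul_mul_comm, ← Real.rpow_add hCp, ← Real.rpow_mul hp0.le, ← Real.rpow_mul hp0.le,
      ← Real.rpow_add hp0, add_sub_cancel, Real.rpow_one]
    congr 2
    obtain ⟨m, rfl⟩ : ∃ m, l = m + 1 := ⟨l - 1, by omega⟩
    simp only [gain, Nat.add_sub_cancel]
    push_cast at hreal hθ hkl ⊢
    have hbe : (b : ℝ) = (m + 1) * a * θ := by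
      rw [hreal, mul_right_comm, mul_comm _ θ]
      have := hθm
      push_cast at this
      rw [this, one_mul]
    have ht : ((k : ℝ) - (m + 1)) / ((k : ℝ) - (m + 1) + 1) = 1 - θ := by
      rw [hθ]; field_simp; ring
    rw [ht, hbe]
    field_simp
    ring

end Decoupling

theorem sum_stdAddChar_pi {N d : ℕ} [NeZero N] (v : Fin d → ZMod N) :
    ∑ t : Fin d → ZMod N, (ZMod.stdAddChar (∑ j, t j * v j) : ℂ) =
      if v = 0 then (N : ℂ) ^ d else 0 := by
  classical
  have h1 : ∀ t : Fin d → ZMod N, (ZMod.stdAddChar (∑ j, t j * v j) : ℂ) =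
      ∏ j, ZMod.stdAddChar (t j * v j) := by
    intro t
    induction (Finset.univ : Finset (Fin d)) using Finset.induction_on with
    | empty => simp
    | insert a s ha ih => rw [Finset.sum_insert ha, Finset.prod_insert ha, AddChar.map_add_eq_mul, ih]
  simp only [h1]
  rw [← Fintype.prod_sum (fun j (x : ZMod N) => (ZMod.stdAddChar (x * v j) : ℂ))]
  have h2 : ∀ j, ∑ x : ZMod N, (ZMod.stdAddChar (x * v j) : ℂ) = if v j = 0 then (N : ℂ) else 0 := by
    intro j
    rw [AddChar.sum_mulShift (v j) (ZMod.isPrimitive_stdAddChar N), ZMod.card]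
    split_ifs <;> simp
  simp only [h2]
  split_ifs with h
  · simp [h]
  · obtain ⟨j, hj⟩ := Function.ne_iff.1 h
    exact Finset.prod_eq_zero (Finset.mem_univ j) (if_neg hj)

section Decoupling

set_option linter.unusedSectionVars false

variable {p : ℕ} [Fact p.Prime]

theorem sum_phase_mul_conj {k M : ℕ} (x y : ℤ) :
    ∑ t : Fin (k + 1) → ZMod (p ^ M), phase p t x * (starRingEnd ℂ) (phase p t y) =
      if ∀ j : Fin (k + 1), (x : ZMod (p ^ M)) ^ (j : ℕ) = (y : ZMod (p ^ M)) ^ (j : ℕ) then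
        ((p ^ M : ℕ) : ℂ) ^ (k + 1) else 0 := by
  classical
  have h : ∀ t : Fin (k + 1) → ZMod (p ^ M), phase p t x * (starRingEnd ℂ) (phase p t y) =
      ZMod.stdAddChar (∑ j : Fin (k + 1), t j *
        ((x : ZMod (p ^ M)) ^ (j : ℕ) - (y : ZMod (p ^ M)) ^ (j : ℕ))) := by
    intro t
    simp only [phase]
    rw [← AddChar.map_neg_eq_conj, ← AddChar.map_add_eq_mul]
    congr 1
    rw [← sub_eq_add_neg, ← Finset.sum_sub_distrib]
    simp only [mul_sub]
  simp only [h]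
  rw [sum_stdAddChar_pi]
  simp only [funext_iff, Pi.zero_apply, sub_eq_zero]

theorem dec_one (n : ℕ) : Dec p 1 n 1 := by
  classical
  have ht : tri 1 = 1 := rfl
  refine Dec.of_id fun S b => ?_
  simp only [pieces, ht, Nat.sub_self, pow_zero, one_mul, mul_one]
  have key : ∀ S : Finset ℤ, ((∑ t : Fin (1 + 1) → ZMod (p ^ (1 * n)), ‖expSum p t id b S‖ ^ 2 : ℝ) : ℂ) =
      ∑ x ∈ S, ∑ y ∈ S, b x * (starRingEnd ℂ) (b y) *
        if (x : ZMod (p ^ n)) = y then ((p ^ n : ℕ) : ℂ) ^ 2 else 0 := by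
    intro S
    generalize hM : 1 * n = M
    rw [one_mul] at hM
    subst hM
    push_cast
    simp only [← Complex.mul_conj']
    have : ∀ t : Fin (1 + 1) → ZMod (p ^ n),
        expSum p t id b S * (starRingEnd ℂ) (expSum p t id b S) =
        ∑ x ∈ S, ∑ y ∈ S, b x * (starRingEnd ℂ) (b y) *
          (phase p t x * (starRingEnd ℂ) (phase p t y)) := by
      intro t
      simp only [expSum, map_sum, map_mul, Finset.sum_mul_sum, id]
      refine Finset.sum_congr rfl fun x _ => Finset.sum_congr rfl fun y _ => ?_
      ring
    simp only [this]
    rw [Finset.sum_comm]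
    refine Finset.sum_congr rfl fun x _ => ?_
    rw [Finset.sum_comm]
    refine Finset.sum_congr rfl fun y _ => ?_
    rw [← Finset.mul_sum, sum_phase_mul_conj]
    congr 1
    simp [Fin.forall_fin_two]
  refine le_of_eq ?_
  rw [← Complex.ofReal_inj, key, Complex.ofReal_sum]
  simp only [key]
  have hf : ∀ j : ZMod (p ^ n), (∑ x ∈ fiber p S id n j, ∑ y ∈ fiber p S id n j,
      b x * (starRingEnd ℂ) (b y) *
        if (x : ZMod (p ^ n)) = y then ((p ^ n : ℕ) : ℂ) ^ 2 else 0) =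
      ∑ x ∈ fiber p S id n j, ∑ y ∈ S,
      b x * (starRingEnd ℂ) (b y) *
        if (x : ZMod (p ^ n)) = y then ((p ^ n : ℕ) : ℂ) ^ 2 else 0 := by
    intro j
    refine Finset.sum_congr rfl fun x hx => ?_
    refine Finset.sum_subset (fiber_subset _ _ _ _) fun y hy hy' => ?_
    rw [if_neg, mul_zero]
    intro hxy
    refine hy' (Finset.mem_filter.2 ⟨hy, ?_⟩)
    rw [id, ← hxy]
    exact (Finset.mem_filter.1 hx).2
  simp only [hf]
  exact (Finset.sum_fiberwise S (fun x => ((id x : ℤ) : ZMod (p ^ n))) _).symm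

theorem decEps_one : DecEps p 1 := by
  intro β hβ
  exact ⟨1, le_rfl, fun n => (dec_one n).mono (by rw [one_mul]; exact one_le_pow₀ hβ.le)⟩

theorem dec_trivial {k : ℕ} (hk : 1 ≤ k) (n : ℕ) : Dec p k n (((p : ℝ) ^ n) ^ (2 * tri k)) := by
  refine Dec.of_id fun S b => ?_
  have hp : (1 : ℝ) ≤ p := one_le_prime
  have ht := tri_pos hk
  have h1 : ∑ t : Fin (k + 1) → ZMod (p ^ (k * n)), ‖expSum p t id b S‖ ^ (2 * tri k) ≤
      ((p : ℝ) ^ n) ^ (2 * tri k) * pieces p k n b S := by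
    rw [pieces, Finset.sum_comm, Finset.mul_sum]
    refine Finset.sum_le_sum fun t _ => ?_
    rw [← sum_expSum_fiber t id id b S n]
    have := card_pow_norm_sum_le (fun j => expSum p t id b (fiber p S id n j))
      (m := 2 * tri k) (by omega) le_rfl
    rw [ZMod.card] at this
    exact_mod_cast this
  refine h1.trans ?_
  gcongr
  exact le_mul_of_one_le_left (pieces_nonneg _ _ _ _) (one_le_pow₀ (one_le_pow₀ hp))

theorem DecExp.mono {k : ℕ} {η η' : ℝ} (h : DecExp p k η) (hη : η ≤ η') : DecExp p k η' := by
  obtain ⟨C, hC, h⟩ := h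
  refine ⟨C, hC, fun n => (h n).mono ?_⟩
  gcongr
  exact one_le_prime

theorem two_pow_le_prime_pow {k : ℕ} (hk : 2 ≤ k) (hp : 17 ≤ p) :
    (2 : ℝ) ^ (2 * tri k + 1) ≤ (p : ℝ) ^ (tri k - 1) := by
  have h1 : 3 ≤ tri k := by
    have := two_mul_tri k
    nlinarith
  have h2 : (16 : ℝ) ≤ p := by exact_mod_cast (by omega : 16 ≤ p)
  calc (2 : ℝ) ^ (2 * tri k + 1) ≤ 2 ^ (4 * (tri k - 1)) :=
        pow_le_pow_right₀ (by norm_num) (by omega)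
    _ = 16 ^ (tri k - 1) := by rw [pow_mul]; norm_num
    _ ≤ _ := by gcongr

theorem DecExp.improve {k : ℕ} (hk : 2 ≤ k) (hkp : k < p) (hp17 : 17 ≤ p)
    (hD : ∀ l, 1 ≤ l → l < k → DecEps p l) {η₀ : ℝ} (hη₀ : 0 < η₀) :
    ∃ δ : ℝ, 0 < δ ∧ δ ≤ η₀ ∧ ∀ η, η₀ ≤ η → DecExp p k η → DecExp p k (η - δ) := by
  have hp := one_lt_prime (p := p)
  have hp0 : (0 : ℝ) < p := by linarith
  set D : ℝ := (k + 1) * (2 * tri k + 1) with hDdef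
  obtain ⟨r, l, hl, hlk, hg⟩ := exists_gain_ge hk ((D + 1) / η₀)
  rw [div_le_iff₀ hη₀] at hg
  set U : ℕ := k.factorial ^ (r + 1) with hU
  set V : ℕ := k ^ (r + 1) with hV
  have hU0 : 0 < U := pow_pos (Nat.factorial_pos _) _
  have hV0 : 0 < V := pow_pos (by omega) _
  have hVr : (0 : ℝ) < V := by exact_mod_cast hV0
  set ε : ℝ := 1 / (4 * V) with hε
  have hε0 : 0 < ε := by positivity
  refine ⟨min ε η₀, lt_min hε0 hη₀, min_le_right _ _, fun η hη h => ?_⟩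
  have hη0 : 0 ≤ η := hη₀.le.trans hη
  set η' := η - min ε η₀ with hη'
  have hη'0 : 0 ≤ η' := by
    have := min_le_right ε η₀
    linarith
  obtain ⟨C, hC, hC'⟩ := h.bil hk hkp hD hη0 r ε hε0
  have hbil : ∀ n, U * V ≤ n → Bil p k l 1 1 n (C * (p : ℝ) ^ (η' * n)) := by
    intro n hn
    set q := n / (U * V) with hq
    have hq1 : 1 ≤ q := (Nat.le_div_iff_mul_le (by positivity)).2 (by simpa using hn)
    set b := U * q with hb
    have hb1 : 1 ≤ b := Nat.mul_pos hU0 hq1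
    have hbV : b * V ≤ n := by
      have := Nat.div_mul_le_self n (U * V)
      calc b * V = n / (U * V) * (U * V) := by rw [hb, hq]; ring
        _ ≤ n := this
    have hn2 : n ≤ 2 * (b * V) := by
      have h1 := Nat.lt_div_mul_add (a := n) (b := U * V) (by positivity)
      have h2 : U * V ≤ b * V := Nat.mul_le_mul_right _ (Nat.le_mul_of_pos_right _ hq1)
      have h3 : n / (U * V) * (U * V) = b * V := by rw [hb, hq]; ring
      omega
    set a := (k - l + 1) * b / l with ha
    have hla : l * a = (k - l + 1) * b := by
      refine Nat.mul_div_cancel' (Dvd.dvd.mul_left ?_ _)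
      exact ((Nat.dvd_factorial hl hlk.le).trans (dvd_pow_self _ (Nat.succ_ne_zero r))).trans
        (Dvd.intro _ rfl)
    have hak : a ≤ k * b := (Nat.div_le_self _ _).trans (Nat.mul_le_mul_right _ (by omega))
    have ha1 : 1 ≤ a := by
      rcases Nat.eq_zero_or_pos a with h0 | h0
      · rw [h0, mul_zero] at hla
        have : 0 < (k - l + 1) * b := by positivity
        omega
      · exact h0
    have hkV : k ≤ V := Nat.le_self_pow (by omega) k
    have han : a ≤ n := by
      refine hak.trans (le_trans ?_ hbV)
      rw [mul_comm]
      exact Nat.mul_le_mul_left _ hkV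
    have hbn : b ≤ n := le_trans (Nat.le_mul_of_pos_right _ hV0) hbV
    refine (Bil.coarse hl hlk ha1 hb1 han hbn
      (hC' n b l hl hlk (Dvd.intro _ rfl) hbV)).mono ?_
    have e : ((p : ℝ) ^ a) ^ (2 * tri k + 1) * ((p : ℝ) ^ b) ^ (2 * tri k + 1) =
        (p : ℝ) ^ (((a : ℝ) + b) * (2 * tri k + 1)) := by
      rw [← pow_mul, ← pow_mul, ← pow_add, ← Real.rpow_natCast]
      congr 1
      push_cast
      ring
    rw [e, mul_left_comm, ← Real.rpow_add hp0]
    gcongr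
    · exact hp.le
    have i1 : (a : ℝ) ≤ k * b := by exact_mod_cast hak
    have i2 : ((a : ℝ) + b) * (2 * tri k + 1) ≤ D * b := by
      have : (0 : ℝ) ≤ 2 * tri k + 1 := by positivity
      rw [hDdef]
      nlinarith
    have i3 : (D + 1) * b ≤ η * gain k r l * b := by
      have hbr : (0 : ℝ) ≤ b := Nat.cast_nonneg _
      have hD0 : 0 ≤ D := by rw [hDdef]; positivity
      have hg0 : 0 ≤ gain k r l := by
        by_contra hneg
        push Not at hneg
        nlinarith
      have : D + 1 ≤ η * gain k r l := by nlinarith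
      gcongr
    have i4 : 2 * ε * n ≤ b := by
      have : (n : ℝ) ≤ 2 * (b * V) := by exact_mod_cast hn2
      rw [hε]
      field_simp
      linarith
    have i5 : min ε η₀ * n ≤ ε * n := by gcongr; exact min_le_left _ _
    rw [hη']
    nlinarith
  set G : ℝ := (2 * p) ^ (2 * tri k + 2) * C with hG
  have hG0 : 0 ≤ G := by positivity
  set C₂ : ℝ := ((p : ℝ) ^ (U * V)) ^ (2 * tri k) + 2 * G with hC₂
  have hone : (1 : ℝ) ≤ ((p : ℝ) ^ (U * V)) ^ (2 * tri k) := one_le_pow₀ (one_le_pow₀ hp.le)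
  refine ⟨C₂, by linarith, fun n => ?_⟩
  induction n with
  | zero =>
    refine (dec_trivial (by omega) 0).mono ?_
    simp only [pow_zero, one_pow, Nat.cast_zero, mul_zero, Real.rpow_zero, mul_one]
    linarith
  | succ n ih =>
    have hpn : 1 ≤ (p : ℝ) ^ (η' * ((n + 1 : ℕ) : ℝ)) :=
      Real.one_le_rpow hp.le (by positivity)
    rcases le_or_gt (U * V) (n + 1) with h1 | h1
    · have := Dec.of_bil hl hlk (Nat.succ_pos n) (K := C₂ * (p : ℝ) ^ (η' * n)) (by positivity)
        (by positivity) (two_pow_le_prime_pow hk hp17) ih (hbil (n + 1) h1)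
      refine this.mono ?_
      have h2 : (p : ℝ) ^ (η' * (n : ℝ)) ≤ (p : ℝ) ^ (η' * ((n + 1 : ℕ) : ℝ)) := by
        gcongr
        · exact hp.le
        · omega
      have h3 : C₂ * (p : ℝ) ^ (η' * (n : ℝ)) ≤ C₂ * (p : ℝ) ^ (η' * ((n + 1 : ℕ) : ℝ)) := by
        gcongr
      rw [← mul_assoc]
      have h4 : G * (p : ℝ) ^ (η' * ((n + 1 : ℕ) : ℝ)) ≤
          C₂ / 2 * (p : ℝ) ^ (η' * ((n + 1 : ℕ) : ℝ)) := by
        gcongr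
        linarith
      rw [hG] at h4
      linarith
    · refine (dec_trivial (by omega) (n + 1)).mono ?_
      calc ((p : ℝ) ^ (n + 1)) ^ (2 * tri k) ≤ ((p : ℝ) ^ (U * V)) ^ (2 * tri k) := by
            gcongr
            exact hp.le
        _ ≤ C₂ * 1 := by linarith
        _ ≤ _ := by gcongr

theorem decExp_of_lower {k : ℕ} (hk : 2 ≤ k) (hkp : k < p) (hp17 : 17 ≤ p)
    (hD : ∀ l, 1 ≤ l → l < k → DecEps p l) {η₀ : ℝ} (hη₀ : 0 < η₀) : DecExp p k η₀ := by
  obtain ⟨δ, hδ, -, h⟩ := DecExp.improve hk hkp hp17 hD hη₀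
  have hp0 : (0 : ℝ) ≤ p := Nat.cast_nonneg _
  have key : ∀ j : ℕ, DecExp p k (max η₀ (2 * tri k - j * δ)) := by
    intro j
    induction j with
    | zero =>
      refine DecExp.mono (η := 2 * tri k) ⟨1, le_rfl, fun n => ?_⟩ (by simp)
      refine (dec_trivial (by omega) n).mono (le_of_eq ?_)
      rw [one_mul, ← pow_mul, ← Real.rpow_natCast]
      push_cast
      ring_nf
    | succ j ih =>
      refine (h _ (le_max_left _ _) ih).mono ?_
      push_cast
      rcases le_total η₀ (2 * tri k - j * δ) with h1 | h1
      · rw [max_eq_right h1]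
        refine le_max_of_le_right (by linarith)
      · rw [max_eq_left h1]
        exact le_max_of_le_left (by linarith)
  obtain ⟨j, hj⟩ := exists_nat_ge (2 * (tri k : ℝ) / δ)
  rw [div_le_iff₀ hδ] at hj
  have := key j
  rwa [max_eq_left (by linarith)] at this

/-- The `p`-adic `ℓ^{k(k+1)}` decoupling theorem for the moment curve. -/
theorem decEps (hp17 : 17 ≤ p) {k : ℕ} (hk : 1 ≤ k) (hkp : k < p) : DecEps p k := by
  induction k using Nat.strong_induction_on with
  | _ k ih =>
    rcases Nat.eq_or_lt_of_le hk with rfl | hk2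
    · exact decEps_one
    intro β hβ
    have hp := one_lt_prime (p := p)
    have hlp := Real.log_pos hp
    obtain ⟨C, hC, h⟩ := decExp_of_lower hk2 hkp hp17
      (fun l hl hlk => ih l hlk hl (hlk.trans hkp)) (div_pos (Real.log_pos hβ) hlp)
    refine ⟨C, hC, fun n => (h n).mono (le_of_eq ?_)⟩
    congr 1
    rw [Real.rpow_mul (by linarith), Real.rpow_natCast, Real.rpow_def_of_pos (by linarith),
      mul_div_cancel₀ _ hlp.ne', Real.exp_log (by linarith)]

end Decoupling

/-- The vector of power sums of degrees `0, …, k` of a tuple of integers. -/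
def powerSums (k : ℕ) {s : ℕ} (x : Fin s → ℤ) : Fin (k + 1) → ℤ := fun j => ∑ i, x i ^ (j : ℕ)

/-- The number of `s`-tuples from `[-N, N]` with given power sums. -/
noncomputable def powerSumCount (k s N : ℕ) (H : Fin (k + 1) → ℤ) : ℕ :=
  ((Fintype.piFinset fun _ : Fin s => Finset.Icc (-(N : ℤ)) N).filter
    fun x => powerSums k x = H).card

section Decoupling

set_option linter.unusedSectionVars false

variable {p : ℕ} [Fact p.Prime]

theorem prod_phase {k M s : ℕ} (t : Fin (k + 1) → ZMod (p ^ M)) (x : Fin s → ℤ) :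
    ∏ i, phase p t (x i) = ZMod.stdAddChar (∑ j, t j * (powerSums k x j : ZMod (p ^ M))) := by
  simp only [phase]
  have h : ∀ v : Fin s → ZMod (p ^ M), ∏ i, (ZMod.stdAddChar (v i) : ℂ) =
      ZMod.stdAddChar (∑ i, v i) := by
    intro v
    induction (Finset.univ : Finset (Fin s)) using Finset.induction_on with
    | empty => simp
    | insert a s ha ih => rw [Finset.sum_insert ha, Finset.prod_insert ha, AddChar.map_add_eq_mul, ih]
  rw [h, Finset.sum_comm]
  congr 1
  refine Finset.sum_congr rfl fun j _ => ?_
  simp [powerSums, Finset.mul_sum]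

theorem sum_sq_powerSumCount_le {k M s N : ℕ} (T : Finset (Fin (k + 1) → ℤ)) :
    (((p ^ M : ℕ) : ℝ) ^ (k + 1)) * ∑ H ∈ T, (powerSumCount k s N H : ℝ) ^ 2 ≤
      ∑ t : Fin (k + 1) → ZMod (p ^ M),
        ‖expSum p t id (fun _ => 1) (Finset.Icc (-(N : ℤ)) N)‖ ^ (2 * s) := by
  classical
  set X := Fintype.piFinset fun _ : Fin s => Finset.Icc (-(N : ℤ)) N with hX
  have h1 : ∀ t : Fin (k + 1) → ZMod (p ^ M),
      (expSum p t id (fun _ => 1) (Finset.Icc (-(N : ℤ)) N)) ^ s =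
      ∑ x ∈ X, ZMod.stdAddChar (∑ j, t j * (powerSums k x j : ZMod (p ^ M))) := by
    intro t
    simp only [expSum, one_mul, id, Finset.sum_pow', prod_phase, hX]
  have h2 : ∀ t : Fin (k + 1) → ZMod (p ^ M),
      ((‖expSum p t id (fun _ => 1) (Finset.Icc (-(N : ℤ)) N)‖ ^ (2 * s) : ℝ) : ℂ) =
      ∑ x ∈ X, ∑ y ∈ X, ZMod.stdAddChar (∑ j, t j *
        ((powerSums k x j : ZMod (p ^ M)) - (powerSums k y j : ZMod (p ^ M)))) := by
    intro t
    rw [mul_comm, pow_mul, ← norm_pow, Complex.ofReal_pow, ← Complex.mul_conj', h1, map_sum,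
      Finset.sum_mul_sum]
    refine Finset.sum_congr rfl fun x _ => Finset.sum_congr rfl fun y _ => ?_
    rw [← AddChar.map_neg_eq_conj, ← AddChar.map_add_eq_mul]
    congr 1
    rw [← sub_eq_add_neg, ← Finset.sum_sub_distrib]
    simp only [mul_sub]
  have h3 : ∑ t : Fin (k + 1) → ZMod (p ^ M),
        ‖expSum p t id (fun _ => 1) (Finset.Icc (-(N : ℤ)) N)‖ ^ (2 * s) =
      ∑ x ∈ X, ∑ y ∈ X, if (∀ j, (powerSums k x j : ZMod (p ^ M)) = powerSums k y j) then
        ((p ^ M : ℕ) : ℝ) ^ (k + 1) else 0 := by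
    rw [← Complex.ofReal_inj, Complex.ofReal_sum]
    simp only [h2]
    push_cast
    rw [Finset.sum_comm]
    refine Finset.sum_congr rfl fun x _ => ?_
    rw [Finset.sum_comm]
    refine Finset.sum_congr rfl fun y _ => ?_
    rw [sum_stdAddChar_pi fun j => (powerSums k x j : ZMod (p ^ M)) - (powerSums k y j : ZMod (p ^ M))]
    simp only [funext_iff, Pi.zero_apply, sub_eq_zero]
    split_ifs <;> simp
  rw [h3]
  have h4 : ∀ H, (powerSumCount k s N H : ℝ) ^ 2 =
      ∑ x ∈ X with powerSums k x = H, ∑ y ∈ X with powerSums k y = H, (1 : ℝ) := by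
    intro H
    simp [powerSumCount, hX, sq]
  have h5 : ∑ H ∈ T, (powerSumCount k s N H : ℝ) ^ 2 ≤
      ∑ x ∈ X, ∑ y ∈ X, if powerSums k x = powerSums k y then (1 : ℝ) else 0 := by
    calc _ = ∑ H ∈ T, ∑ x ∈ X with powerSums k x = H,
          ∑ y ∈ X, if powerSums k x = powerSums k y then (1 : ℝ) else 0 := by
          refine Finset.sum_congr rfl fun H _ => ?_
          rw [h4]
          refine Finset.sum_congr rfl fun x hx => ?_
          rw [Finset.sum_filter]
          refine Finset.sum_congr rfl fun y _ => ?_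
          rw [(Finset.mem_filter.1 hx).2]
          simp only [eq_comm]
      _ = ∑ x ∈ X with powerSums k x ∈ T,
          ∑ y ∈ X, if powerSums k x = powerSums k y then (1 : ℝ) else 0 := by
          rw [Finset.sum_filter]
          simp only [Finset.sum_filter]
          rw [Finset.sum_comm]
          refine Finset.sum_congr rfl fun x _ => ?_
          rw [Finset.sum_ite_eq]
      _ ≤ _ := by
          refine Finset.sum_le_sum_of_subset_of_nonneg (Finset.filter_subset _ _) fun x _ _ => ?_
          exact Finset.sum_nonneg fun y _ => by split_ifs <;> norm_num
  refine (mul_le_mul_of_nonneg_left h5 (by positivity)).trans ?_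
  rw [Finset.mul_sum]
  refine Finset.sum_le_sum fun x _ => ?_
  rw [Finset.mul_sum]
  refine Finset.sum_le_sum fun y _ => ?_
  split_ifs with ha hb
  · simp
  · exact absurd (fun j => by rw [ha]) hb
  · simp
  · simp

theorem sum_norm_expSum_Icc_le {k n N : ℕ} {K : ℝ} (hK : 0 ≤ K) (hk : 1 ≤ k) (hD : Dec p k n K)
    (hN : 2 * N < p ^ n) :
    ∑ t : Fin (k + 1) → ZMod (p ^ (k * n)),
        ‖expSum p t id (fun _ => 1) (Finset.Icc (-(N : ℤ)) N)‖ ^ (2 * tri k) ≤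
      K * ((p : ℝ) ^ n) ^ (tri k - 1) * ((2 * N + 1) * ((p ^ (k * n) : ℕ) : ℝ) ^ (k + 1)) := by
  classical
  refine (hD _ id _).trans (mul_le_mul_of_nonneg_left ?_ (by positivity))
  set S := Finset.Icc (-(N : ℤ)) N with hS
  have hcard : ∀ j : ZMod (p ^ n), (fiber p S id n j).card ≤ 1 := by
    intro j
    refine Finset.card_le_one.2 fun a ha b hb => ?_
    simp only [fiber, Finset.mem_filter, id, hS, Finset.mem_Icc] at ha hb
    have := ha.2.trans hb.2.symm
    rw [ZMod.intCast_eq_intCast_iff_dvd_sub] at this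
    have h0 := Int.eq_zero_of_abs_lt_dvd this (by push_cast; zify at hN; rw [abs_lt]; constructor <;> linarith)
    linarith
  have hle : ∀ (j : ZMod (p ^ n)) (t : Fin (k + 1) → ZMod (p ^ (k * n))),
      ‖expSum p t id (fun _ => 1) (fiber p S id n j)‖ ^ (2 * tri k) ≤ (fiber p S id n j).card := by
    intro j t
    have h1 : ‖expSum p t id (fun _ => 1) (fiber p S id n j)‖ ≤ (fiber p S id n j).card := by
      refine (norm_sum_le _ _).trans ?_
      simp [norm_phase]
    refine (pow_le_pow_left₀ (norm_nonneg _) h1 _).trans ?_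
    have : 2 * tri k ≠ 0 := by have := tri_pos hk; omega
    rcases Nat.le_one_iff_eq_zero_or_eq_one.1 (hcard j) with h | h <;> rw [h] <;> simp [this]
  calc _ ≤ ∑ j : ZMod (p ^ n), ∑ t : Fin (k + 1) → ZMod (p ^ (k * n)),
        ((fiber p S id n j).card : ℝ) := Finset.sum_le_sum fun j _ => Finset.sum_le_sum fun t _ => hle j t
    _ = _ := by
      simp only [Finset.sum_const, Finset.card_univ, Fintype.card_pi, ZMod.card, Finset.prod_const,
        Fintype.card_fin, nsmul_eq_mul]
      rw [← Finset.mul_sum, ← Nat.cast_sum]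
      have : ∑ j : ZMod (p ^ n), (fiber p S id n j).card = S.card :=
        (Finset.card_eq_sum_card_fiberwise (fun x _ => Finset.mem_univ _)).symm
      rw [this, hS, Int.card_Icc]
      have : ((N : ℤ) + 1 - -(N : ℤ)).toNat = 2 * N + 1 := by omega
      rw [this]
      push_cast
      ring

end Decoupling

/-- Vinogradov's mean value theorem at the critical exponent. -/
theorem vinogradov {k : ℕ} (hk : 1 ≤ k) {ε : ℝ} (hε : 0 < ε) :
    ∃ C ≥ (1 : ℝ), ∀ N : ℕ, 1 ≤ N → ∀ T : Finset (Fin (k + 1) → ℤ),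
      ∑ H ∈ T, (powerSumCount k (tri k) N H : ℝ) ^ 2 ≤ C * (N : ℝ) ^ ((tri k : ℝ) + ε) := by
  obtain ⟨p, hp, hprime⟩ := Nat.exists_infinite_primes (max 17 (k + 1))
  have : Fact p.Prime := ⟨hprime⟩
  have hp1 : (1 : ℝ) < p := by exact_mod_cast hprime.one_lt
  have hp0 : (0 : ℝ) < p := by linarith
  obtain ⟨C, hC, hD⟩ := decEps ((le_max_left _ _).trans hp) hk
    (Nat.lt_of_succ_le ((le_max_right _ _).trans hp)) ((p : ℝ) ^ ε) (Real.one_lt_rpow hp1 hε)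
  have hs := tri_pos hk
  refine ⟨C * (3 * p) ^ ((tri k : ℝ) + ε), ?_, fun N hN T => ?_⟩
  · refine one_le_mul_of_one_le_of_one_le hC (Real.one_le_rpow (by linarith) (by positivity))
  have hN0 : (0 : ℝ) < N := by exact_mod_cast hN
  have hN1 : (1 : ℝ) ≤ N := by exact_mod_cast hN
  set n := Nat.log p (2 * N) + 1 with hn
  have h1 : 2 * N < p ^ n := Nat.lt_pow_succ_log_self hprime.one_lt _
  have h2 : p ^ n ≤ p * (2 * N) := by
    rw [hn, pow_succ, mul_comm]
    exact Nat.mul_le_mul_left _ (Nat.pow_log_le_self p (by omega))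
  have h2' : (p : ℝ) ^ n ≤ p * (2 * N) := by exact_mod_cast h2
  have hK : 0 ≤ C * ((p : ℝ) ^ ε) ^ n := by positivity
  have h3 := (sum_sq_powerSumCount_le (p := p) (M := k * n) (s := tri k) (N := N) T).trans
    (sum_norm_expSum_Icc_le hK hk (hD n) h1)
  have hQ : (0 : ℝ) < ((p ^ (k * n) : ℕ) : ℝ) ^ (k + 1) := by
    have := hprime.pos
    positivity
  have h4 : ∑ H ∈ T, (powerSumCount k (tri k) N H : ℝ) ^ 2 ≤
      C * ((p : ℝ) ^ ε) ^ n * ((p : ℝ) ^ n) ^ (tri k - 1) * (2 * N + 1) := by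
    refine le_of_mul_le_mul_left (h3.trans (le_of_eq ?_)) hQ
    ring
  refine h4.trans ?_
  have h5 : ((p : ℝ) ^ ε) ^ n = ((p : ℝ) ^ n) ^ ε := by
    rw [← Real.rpow_natCast, ← Real.rpow_natCast, ← Real.rpow_mul hp0.le, ← Real.rpow_mul hp0.le,
      mul_comm]
  have h6 : (p : ℝ) ^ n ≤ 3 * p * N := by nlinarith
  have h7 : (2 * N + 1 : ℝ) ≤ 3 * p * N := by nlinarith
  calc C * ((p : ℝ) ^ ε) ^ n * ((p : ℝ) ^ n) ^ (tri k - 1) * (2 * N + 1)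
      ≤ C * (3 * p * N) ^ ε * (3 * p * N) ^ (tri k - 1) * (3 * p * N) := by
        rw [h5]
        gcongr
    _ = C * ((3 * p * N) ^ ε * (3 * p * N) ^ (tri k)) := by
        obtain ⟨r, hr⟩ : ∃ r, tri k = r + 1 := ⟨tri k - 1, by omega⟩
        rw [hr, pow_succ, Nat.add_sub_cancel]
        ring
    _ = C * (3 * p * N) ^ ((tri k : ℝ) + ε) := by
        rw [← Real.rpow_natCast (3 * p * N : ℝ), ← Real.rpow_add (by positivity), add_comm ε]
    _ = _ := by
        rw [Real.mul_rpow (by positivity) hN0.le]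
        ring

/-- The additive character `x ↦ exp (2 * π * i * x)`. -/
noncomputable def e (x : ℝ) : ℂ := Complex.exp (2 * Real.pi * Complex.I * x)

theorem e_add (x y : ℝ) : e (x + y) = e x * e y := by
  rw [e, e, e, ← Complex.exp_add]
  congr 1
  push_cast
  ring

theorem e_zero : e 0 = 1 := by simp [e]

theorem norm_e (x : ℝ) : ‖e x‖ = 1 := by
  rw [e, show (2 * Real.pi * Complex.I * x : ℂ) = ((2 * Real.pi * x : ℝ) : ℂ) * Complex.I by
    push_cast; ring, Complex.norm_exp_ofReal_mul_I]

theorem conj_e (x : ℝ) : (starRingEnd ℂ) (e x) = e (-x) := by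
  rw [e, e, ← Complex.exp_conj]
  congr 1
  simp only [map_mul, Complex.conj_I, Complex.conj_ofReal, map_ofNat]
  push_cast
  ring

theorem e_int (n : ℤ) : e n = 1 := by
  rw [e, Complex.exp_eq_one_iff]
  exact ⟨n, by push_cast; ring⟩

theorem e_nat_mul (n : ℕ) (x : ℝ) : e (n * x) = e x ^ n := by
  rw [e, e, ← Complex.exp_nat_mul]
  congr 1
  push_cast
  ring

theorem e_sum {ι : Type*} (s : Finset ι) (f : ι → ℝ) : e (∑ i ∈ s, f i) = ∏ i ∈ s, e (f i) := by
  classical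
  induction s using Finset.induction_on with
  | empty => simp [e_zero]
  | insert a s ha ih => rw [Finset.sum_insert ha, Finset.prod_insert ha, e_add, ih]

/-- The distance to the nearest integer. -/
noncomputable def ndist (x : ℝ) : ℝ := |x - round x|

theorem ndist_nonneg (x : ℝ) : 0 ≤ ndist x := abs_nonneg _

theorem ndist_neg (x : ℝ) : ndist (-x) = ndist x := by
  refine le_antisymm ?_ ?_
  · have := round_le (-x) (-round x)
    rw [ndist, ndist]
    refine this.trans (le_of_eq ?_)
    rw [← abs_neg]
    push_cast
    ring_nf
  · have := round_le x (-round (-x))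
    rw [ndist, ndist]
    refine this.trans (le_of_eq ?_)
    rw [← abs_neg]
    push_cast
    ring_nf

theorem four_mul_ndist_le (x : ℝ) : 4 * ndist x ≤ ‖e x - 1‖ := by
  have h1 : e x = Complex.exp (Complex.I * ((2 * Real.pi * (x - round x) : ℝ) : ℂ)) := by
    have : x = (x - round x) + ((round x : ℤ) : ℝ) := by ring
    conv_lhs => rw [this, e_add, e_int, mul_one, e]
    congr 1
    push_cast
    ring
  have hpi := Real.pi_pos
  have habs := abs_sub_round x
  have h2 : |Real.pi * (x - round x)| ≤ Real.pi / 2 := by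
    rw [abs_mul, abs_of_pos hpi]
    nlinarith
  have h3 := Real.mul_abs_le_abs_sin h2
  rw [h1, Complex.norm_exp_I_mul_ofReal_sub_one, norm_mul, Real.norm_eq_abs, Real.norm_eq_abs,
    show 2 * Real.pi * (x - round x) / 2 = Real.pi * (x - round x) by ring, abs_two]
  rw [abs_mul Real.pi, abs_of_pos hpi] at h3
  rw [ndist]
  have : 2 / Real.pi * (Real.pi * |x - round x|) = 2 * |x - round x| := by
    field_simp
  linarith

/-- An upper bound for a geometric sum of length `L` with frequency `x`. -/
noncomputable def geomBound (L x : ℝ) : ℝ := 2 * L / (1 + 2 * L * ndist x)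

theorem geomBound_nonneg {L : ℝ} (hL : 0 ≤ L) (x : ℝ) : 0 ≤ geomBound L x := by
  have := ndist_nonneg x
  rw [geomBound]
  positivity

theorem geomBound_le {L : ℝ} (hL : 0 ≤ L) (x : ℝ) : geomBound L x ≤ 2 * L := by
  have := ndist_nonneg x
  rw [geomBound]
  refine div_le_self (by positivity) ?_
  have : 0 ≤ 2 * L * ndist x := by positivity
  linarith

theorem geomBound_le_inv {L : ℝ} (hL : 0 ≤ L) {x : ℝ} (hx : 0 < ndist x) :
    geomBound L x ≤ (ndist x)⁻¹ := by
  have : 0 ≤ 2 * L * ndist x := by positivity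
  rw [geomBound, div_le_iff₀ (by linarith)]
  field_simp
  linarith

theorem geomBound_mono {L L' : ℝ} (hL : 0 ≤ L) (h : L ≤ L') (x : ℝ) :
    geomBound L x ≤ geomBound L' x := by
  have := ndist_nonneg x
  have h1 : 0 ≤ 2 * L * ndist x := by positivity
  have h2 : 0 ≤ 2 * L' * ndist x := mul_nonneg (by linarith) this
  rw [geomBound, geomBound, div_le_div_iff₀ (by linarith) (by linarith)]
  nlinarith

theorem geomBound_neg (L x : ℝ) : geomBound L (-x) = geomBound L x := by
  rw [geomBound, geomBound, ndist_neg]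

theorem sum_Ico_int {M : Type*} [AddCommMonoid M] (f : ℤ → M) (c : ℤ) (L : ℕ) :
    ∑ n ∈ Finset.Ico c (c + L), f n = ∑ i ∈ Finset.range L, f (c + i) := by
  refine Finset.sum_nbij' (fun n => (n - c).toNat) (fun i => c + i) ?_ ?_ ?_ ?_ ?_
  · intro a ha; rw [Finset.mem_Ico] at ha; rw [Finset.mem_range]; omega
  · intro a ha; rw [Finset.mem_range] at ha; rw [Finset.mem_Ico]; omega
  · intro a ha; rw [Finset.mem_Ico] at ha; omega
  · intro a ha; omega
  · intro a ha; rw [Finset.mem_Ico] at ha; congr 1; omega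

theorem norm_sum_e_le (x : ℝ) (c : ℤ) (L : ℕ) :
    ‖∑ n ∈ Finset.Ico c (c + L), e (x * n)‖ ≤ geomBound L x := by
  rw [sum_Ico_int]
  have h1 : ∑ i ∈ Finset.range L, e (x * ((c + i : ℤ) : ℝ)) =
      e (x * c) * ∑ i ∈ Finset.range L, e x ^ i := by
    rw [Finset.mul_sum]
    refine Finset.sum_congr rfl fun i _ => ?_
    rw [← e_nat_mul, ← e_add]
    congr 1
    push_cast
    ring
  rw [h1, norm_mul, norm_e, one_mul]
  set S := ∑ i ∈ Finset.range L, e x ^ i with hS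
  have h2 : ‖S‖ ≤ L := by
    refine (norm_sum_le _ _).trans ?_
    simp [norm_e]
  have h3 : ‖S‖ * ‖e x - 1‖ ≤ 2 := by
    rw [← norm_mul, hS, geom_sum_mul]
    refine (norm_sub_le _ _).trans ?_
    rw [norm_pow, norm_e]
    norm_num
  have h4 := four_mul_ndist_le x
  have hd := ndist_nonneg x
  have h0 := norm_nonneg S
  have hL : (0 : ℝ) ≤ L := Nat.cast_nonneg L
  have h5 : ‖S‖ * (2 * ndist x) ≤ 1 := by nlinarith
  rw [geomBound, le_div_iff₀ (by positivity)]
  nlinarith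

theorem geomBound_int_div (L : ℝ) {q : ℕ} (hq : 0 < q) (x : ℤ) :
    geomBound L (x / q) = geomBound L (((x : ZMod q).val : ℝ) / q) := by
  have : NeZero q := ⟨hq.ne'⟩
  have hq' : (q : ℝ) ≠ 0 := by exact_mod_cast hq.ne'
  have h : (((x : ZMod q).val : ℕ) : ℤ) = x % q := ZMod.val_intCast x
  have h2 : ((x : ZMod q).val : ℝ) = x - q * ((x / q : ℤ) : ℝ) := by
    have := Int.emod_def x q
    rw [← h] at this
    exact_mod_cast this
  rw [geomBound, geomBound, h2, ndist, ndist, sub_div, mul_div_cancel_left₀ _ hq', round_sub_intCast]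
  push_cast
  ring_nf

theorem sum_geomBound_range_le {L : ℝ} (hL : 0 ≤ L) {q : ℕ} (hq : 0 < q) :
    ∑ r ∈ Finset.range q, geomBound L (r / q) ≤ 2 * L + 2 * q * (1 + Real.log q) := by
  obtain ⟨n, rfl⟩ : ∃ n, q = n + 1 := ⟨q - 1, by omega⟩
  rw [Finset.sum_range_succ']
  have hq0 : (0 : ℝ) < ((n + 1 : ℕ) : ℝ) := by positivity
  have h0 : geomBound L (((0 : ℕ) : ℝ) / ((n + 1 : ℕ) : ℝ)) ≤ 2 * L := geomBound_le hL _
  have h1 : ∀ i ∈ Finset.range n, geomBound L (((i + 1 : ℕ) : ℝ) / ((n + 1 : ℕ) : ℝ)) ≤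
      ((n + 1 : ℕ) : ℝ) * (((i + 1 : ℕ) : ℝ)⁻¹ + ((n - i : ℕ) : ℝ)⁻¹) := by
    intro i hi
    rw [Finset.mem_range] at hi
    have hi0 : (0 : ℝ) < ((i + 1 : ℕ) : ℝ) := by positivity
    have hni : (0 : ℝ) < ((n - i : ℕ) : ℝ) := by
      have : 0 < n - i := by omega
      exact_mod_cast this
    have hsub : ((n - i : ℕ) : ℝ) = (n : ℝ) - i := Nat.cast_sub hi.le
    have hfr : Int.fract (((i + 1 : ℕ) : ℝ) / ((n + 1 : ℕ) : ℝ)) =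
        ((i + 1 : ℕ) : ℝ) / ((n + 1 : ℕ) : ℝ) := by
      rw [Int.fract_eq_self]
      refine ⟨by positivity, ?_⟩
      rw [div_lt_one hq0]
      exact_mod_cast Nat.succ_lt_succ hi
    have h1 : 1 - ((i + 1 : ℕ) : ℝ) / ((n + 1 : ℕ) : ℝ) = ((n - i : ℕ) : ℝ) / ((n + 1 : ℕ) : ℝ) := by
      rw [hsub]
      field_simp
      push_cast
      ring
    have hd : ndist (((i + 1 : ℕ) : ℝ) / ((n + 1 : ℕ) : ℝ)) =
        min (((i + 1 : ℕ) : ℝ) / ((n + 1 : ℕ) : ℝ)) (((n - i : ℕ) : ℝ) / ((n + 1 : ℕ) : ℝ)) := by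
      rw [ndist, abs_sub_round_eq_min, hfr, h1]
    have hpos : 0 < ndist (((i + 1 : ℕ) : ℝ) / ((n + 1 : ℕ) : ℝ)) := by
      rw [hd]
      exact lt_min (by positivity) (by positivity)
    refine (geomBound_le_inv hL hpos).trans ?_
    rw [hd]
    rcases min_choice (((i + 1 : ℕ) : ℝ) / ((n + 1 : ℕ) : ℝ)) (((n - i : ℕ) : ℝ) / ((n + 1 : ℕ) : ℝ))
      with h | h <;> rw [h, inv_div, div_eq_mul_inv]
    · exact mul_le_mul_of_nonneg_left (by linarith [inv_pos.2 hni]) hq0.le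
    · exact mul_le_mul_of_nonneg_left (by linarith [inv_pos.2 hi0]) hq0.le
  have hH : ∑ i ∈ Finset.range n, ((i + 1 : ℕ) : ℝ)⁻¹ ≤ 1 + Real.log ((n + 1 : ℕ) : ℝ) := by
    have h := harmonic_le_one_add_log n
    rw [harmonic] at h
    push_cast at h ⊢
    refine h.trans ?_
    rcases Nat.eq_zero_or_pos n with rfl | hn
    · simp
    · have : (0 : ℝ) < n := by exact_mod_cast hn
      have := Real.log_le_log this (by linarith : (n : ℝ) ≤ n + 1)
      linarith
  have hH' : ∑ i ∈ Finset.range n, ((n - i : ℕ) : ℝ)⁻¹ = ∑ i ∈ Finset.range n, ((i + 1 : ℕ) : ℝ)⁻¹ := by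
    rw [← Finset.sum_range_reflect]
    refine Finset.sum_congr rfl fun i hi => ?_
    rw [Finset.mem_range] at hi
    congr 2
    omega
  have hsum := Finset.sum_le_sum h1
  rw [← Finset.mul_sum, Finset.sum_add_distrib, hH'] at hsum
  nlinarith

theorem sum_geomBound_period_le {L : ℝ} (hL : 0 ≤ L) {q : ℕ} (hq : 0 < q) {a : ℤ}
    (ha : IsCoprime a (q : ℤ)) (c : ℤ) :
    ∑ n ∈ Finset.Ico c (c + q), geomBound L (a * n / q) ≤ 2 * L + 2 * q * (1 + Real.log q) := by
  have : NeZero q := ⟨hq.ne'⟩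
  set F : ZMod q → ℝ := fun z => geomBound L ((z.val : ℝ) / q) with hF
  have h1 : ∀ n : ℤ, geomBound L (a * n / q) = F ((a : ZMod q) * (n : ZMod q)) := by
    intro n
    have := geomBound_int_div L hq (a * n)
    push_cast at this
    rw [this]
  simp only [h1]
  have h2 : ∑ n ∈ Finset.Ico c (c + q), F ((a : ZMod q) * (n : ZMod q)) =
      ∑ z : ZMod q, F ((a : ZMod q) * z) := by
    have hinj : Set.InjOn (fun n : ℤ => (n : ZMod q)) (Finset.Ico c (c + q) : Finset ℤ) := by
      intro x hx y hy hxy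
      simp only [Finset.coe_Ico, Set.mem_Ico] at hx hy
      have := hxy
      simp only [ZMod.intCast_eq_intCast_iff_dvd_sub] at this
      have := Int.eq_zero_of_abs_lt_dvd this (by rw [abs_lt]; constructor <;> linarith)
      linarith
    have himg : (Finset.Ico c (c + q)).image (fun n : ℤ => (n : ZMod q)) = Finset.univ := by
      refine Finset.eq_univ_of_card _ ?_
      rw [Finset.card_image_of_injOn hinj, Int.card_Ico, ZMod.card]
      omega
    rw [← himg, Finset.sum_image hinj]
  rw [h2]
  have hu : IsUnit (a : ZMod q) := by
    obtain ⟨u, v, huv⟩ := ha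
    have := congrArg (Int.cast : ℤ → ZMod q) huv
    push_cast at this
    rw [ZMod.natCast_self, mul_zero, add_zero] at this
    exact IsUnit.of_mul_eq_one _ (by rw [mul_comm]; exact this)
  have h3 : ∑ z : ZMod q, F ((a : ZMod q) * z) = ∑ z : ZMod q, F z := by
    obtain ⟨u, hu⟩ := hu
    rw [← hu]
    exact Equiv.sum_comp (Units.mulLeft u) F
  rw [h3]
  have h4 : ∑ z : ZMod q, F z = ∑ r ∈ Finset.range q, geomBound L (r / q) := by
    refine Finset.sum_nbij' (fun z => z.val) (fun r => (r : ZMod q)) ?_ ?_ ?_ ?_ ?_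
    · intro z _; exact Finset.mem_range.2 (ZMod.val_lt z)
    · intro r _; exact Finset.mem_univ _
    · intro z _; exact ZMod.natCast_zmod_val z
    · intro r hr; exact ZMod.val_cast_of_lt (Finset.mem_range.1 hr)
    · intro z _; rfl
  rw [h4]
  exact sum_geomBound_range_le hL hq

/-- Geometric sums along a multiple of a rational frequency. -/
theorem sum_geomBound_le {L : ℝ} (hL : 0 ≤ L) {m : ℕ} (hm : 0 < m) (a c : ℤ) (M : ℕ) :
    ∑ n ∈ Finset.Ico c (c + M), geomBound L (a * n / m) ≤
      (M / (m / Int.gcd a m : ℕ) + 1) * (2 * L + 2 * (m / Int.gcd a m : ℕ) *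
        (1 + Real.log (m / Int.gcd a m : ℕ))) := by
  set g := Int.gcd a m with hg
  have hg0 : 0 < g := Int.gcd_pos_of_ne_zero_right _ (by exact_mod_cast hm.ne')
  obtain ⟨q, hq⟩ : g ∣ m := by exact_mod_cast Int.gcd_dvd_right a (m : ℤ)
  obtain ⟨a', ha'⟩ : (g : ℤ) ∣ a := Int.gcd_dvd_left a (m : ℤ)
  have hmq : m / g = q := by rw [hq, Nat.mul_div_cancel_left _ hg0]
  have hq0 : 0 < q := Nat.pos_of_ne_zero fun h => by rw [h, mul_zero] at hq; omega
  have hcop : IsCoprime a' (q : ℤ) := by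
    rw [Int.isCoprime_iff_gcd_eq_one]
    have h1 : g = g * Int.gcd a' q := by
      conv_lhs => rw [hg, ha', hq]
      rw [Nat.cast_mul, Int.gcd_mul_left, Int.natAbs_natCast]
    exact (Nat.eq_of_mul_eq_mul_left hg0 (by rw [mul_one]; exact h1)).symm
  rw [hmq]
  have hgR : (g : ℝ) ≠ 0 := by exact_mod_cast hg0.ne'
  have hqR : (0 : ℝ) < q := by exact_mod_cast hq0
  have hrew : ∀ n : ℤ, (a : ℝ) * n / m = a' * n / q := by
    intro n
    have h1 : (a : ℝ) = g * a' := by exact_mod_cast ha'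
    have h2 : (m : ℝ) = g * q := by exact_mod_cast hq
    rw [h1, h2, mul_assoc, mul_div_mul_left _ _ hgR]
  simp only [hrew]
  set K := 2 * L + 2 * q * (1 + Real.log q) with hK
  have hblocks : ∀ j : ℕ, ∑ n ∈ Finset.Ico c (c + (j * q : ℕ)), geomBound L (a' * n / q) ≤ j * K := by
    intro j
    induction j with
    | zero => simp
    | succ j ih =>
      have h1 : c ≤ c + (j * q : ℕ) := by omega
      have h2 : c + (j * q : ℕ) ≤ c + ((j + 1) * q : ℕ) := by push_cast; nlinarith
      rw [← Finset.Ico_union_Ico_eq_Ico h1 h2,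
        Finset.sum_union (Finset.Ico_disjoint_Ico_consecutive _ _ _)]
      have h3 := sum_geomBound_period_le hL hq0 hcop (c + (j * q : ℕ))
      have h4 : c + (((j + 1) * q : ℕ) : ℤ) = c + (j * q : ℕ) + q := by push_cast; ring
      rw [h4]
      push_cast at ih h3 ⊢
      linarith
  have hKn : 0 ≤ K := by
    have : 0 ≤ Real.log q := Real.log_natCast_nonneg q
    positivity
  have hsub : Finset.Ico c (c + M) ⊆ Finset.Ico c (c + ((M / q + 1) * q : ℕ)) := by
    refine Finset.Ico_subset_Ico le_rfl ?_
    have := Nat.lt_div_mul_add (a := M) hq0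
    have h2 : M ≤ (M / q + 1) * q := by rw [add_mul]; omega
    exact_mod_cast add_le_add_right (Int.ofNat_le.2 h2) c
  refine (Finset.sum_le_sum_of_subset_of_nonneg hsub fun n _ _ => geomBound_nonneg hL _).trans ?_
  refine (hblocks _).trans (mul_le_mul_of_nonneg_right ?_ hKn)
  push_cast
  have := Nat.cast_div_le (α := ℝ) (m := M) (n := q)
  linarith

/-- The saving `1/q + 1/N + q/N^k`, where `h/m` has reduced denominator `q`. -/
noncomputable def saving (k m N h : ℕ) : ℝ :=
  (Nat.gcd h m : ℝ) / m + 1 / N + (m : ℝ) / ((Nat.gcd h m : ℝ) * (N : ℝ) ^ k)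

theorem saving_eq {k m N h : ℕ} (hm : 1 ≤ m) :
    saving k m N h = ((m / Nat.gcd h m : ℕ) : ℝ)⁻¹ + (N : ℝ)⁻¹ +
      ((m / Nat.gcd h m : ℕ) : ℝ) / (N : ℝ) ^ k := by
  have hg : 0 < Nat.gcd h m := Nat.gcd_pos_of_pos_right _ hm
  have hg' : (Nat.gcd h m : ℝ) ≠ 0 := by exact_mod_cast hg.ne'
  rw [saving, Nat.cast_div (Nat.gcd_dvd_right h m) hg', inv_div, one_div, div_div]

theorem saving_nonneg (k m N h : ℕ) : 0 ≤ saving k m N h := by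
  rw [saving]
  positivity

theorem one_add_log_le {k N : ℕ} (hN : 1 ≤ N) {ε : ℝ} (hε : 0 < ε) :
    1 + k * Real.log N ≤ (1 + k / ε) * (N : ℝ) ^ ε := by
  have h1 := Real.log_le_rpow_div (Nat.cast_nonneg N) hε
  have h2 : (1 : ℝ) ≤ (N : ℝ) ^ ε := Real.one_le_rpow (by exact_mod_cast hN) hε.le
  have h3 : (k : ℝ) * Real.log N ≤ k * ((N : ℝ) ^ ε / ε) :=
    mul_le_mul_of_nonneg_left h1 (Nat.cast_nonneg k)
  have h4 : (1 + k / ε) * (N : ℝ) ^ ε = (N : ℝ) ^ ε + k * ((N : ℝ) ^ ε / ε) := by ring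
  linarith

theorem sum_geomBound_le_saving {k u v : ℕ} (huv : u + v = k) (hu : 1 ≤ u) (hv : 1 ≤ v) {D : ℝ}
    (hD : 1 ≤ D) {B : ℤ} (hB : B ≠ 0) {ε : ℝ} (hε : 0 < ε) :
    ∃ C ≥ (1 : ℝ), ∀ m N h : ℕ, 1 ≤ m → 1 ≤ N → 1 ≤ h →
      ((m / Nat.gcd h m : ℕ) : ℝ) ≤ (N : ℝ) ^ k → ∀ (c : ℤ) (M : ℕ) (L : ℝ),
      (M : ℝ) ≤ D * (N : ℝ) ^ u → 0 ≤ L → L ≤ D * (N : ℝ) ^ v →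
      ∑ n ∈ Finset.Ico c (c + M), geomBound L (((h * B : ℤ) : ℝ) * n / m) ≤
        C * (N : ℝ) ^ ε * ((N : ℝ) ^ k * saving k m N h) := by
  set A := B.natAbs with hA
  have hA1 : 1 ≤ A := Int.natAbs_pos.2 hB
  have hA1' : (1 : ℝ) ≤ A := by exact_mod_cast hA1
  refine ⟨4 * (D * D * A) * (1 + k / ε), ?_, ?_⟩
  · have h1 : (1 : ℝ) ≤ D * D * A := one_le_mul_of_one_le_of_one_le
      (one_le_mul_of_one_le_of_one_le hD hD) hA1'
    have h2 : (1 : ℝ) ≤ 1 + k / ε := by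
      have : 0 ≤ (k : ℝ) / ε := by positivity
      linarith
    nlinarith
  intro m N h hm hN hh hq c M L hM hL0 hL
  have hN0 : (0 : ℝ) < N := by exact_mod_cast hN
  have hN1 : (1 : ℝ) ≤ N := by exact_mod_cast hN
  refine (sum_geomBound_le hL0 hm (h * B) c M).trans ?_
  set g := Nat.gcd h m with hg
  set G := Int.gcd (h * B) m with hG
  have hG' : G = Nat.gcd (h * A) m := by
    rw [hG, Int.gcd_def, Int.natAbs_mul, Int.natAbs_natCast, Int.natAbs_natCast]
  have hg0 : 0 < g := Nat.gcd_pos_of_pos_right _ hm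
  have hG0 : 0 < G := by rw [hG']; exact Nat.gcd_pos_of_pos_right _ hm
  have hgG : g ∣ G := by
    rw [hG']
    exact Nat.gcd_dvd_gcd_mul_right_left _ _ _
  have hGA : G ∣ g * A := by
    rw [hG', hg]
    exact (Nat.gcd_mul_left_dvd_mul_gcd m h A).trans
      (mul_dvd_mul_left _ (Nat.gcd_dvd_left A m))
  set q := m / G with hqdef
  set q' := m / g with hq'def
  have hmq : m = G * q := (Nat.mul_div_cancel' (by rw [hG']; exact Nat.gcd_dvd_right _ _)).symm
  have hmq' : m = g * q' := (Nat.mul_div_cancel' (Nat.gcd_dvd_right _ _)).symm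
  have hq0 : 0 < q := Nat.pos_of_ne_zero fun h0 => by rw [h0, mul_zero] at hmq; omega
  have hq'0 : 0 < q' := Nat.pos_of_ne_zero fun h0 => by rw [h0, mul_zero] at hmq'; omega
  have hqq' : q ≤ q' := Nat.div_le_div_left (Nat.le_of_dvd hG0 hgG) hg0
  have hq'A : q' ≤ A * q := by
    have h1 : G ≤ g * A := Nat.le_of_dvd (Nat.mul_pos hg0 hA1) hGA
    have h2 : g * q' ≤ g * (A * q) := by
      rw [← hmq', ← mul_assoc]
      calc m = G * q := hmq
        _ ≤ g * A * q := Nat.mul_le_mul_right _ h1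
    exact Nat.le_of_mul_le_mul_left h2 hg0
  have hq0R : (0 : ℝ) < q := by exact_mod_cast hq0
  have hq'0R : (0 : ℝ) < q' := by exact_mod_cast hq'0
  have hqq'R : (q : ℝ) ≤ q' := by exact_mod_cast hqq'
  have hq'AR : (q' : ℝ) ≤ A * q := by exact_mod_cast hq'A
  set E := (1 + k / ε) * (N : ℝ) ^ ε with hE
  have hE1 : 1 + Real.log q ≤ E := by
    refine le_trans ?_ (one_add_log_le hN hε)
    have : Real.log q ≤ Real.log ((N : ℝ) ^ k) := Real.log_le_log hq0R (hqq'R.trans hq)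
    rw [Real.log_pow] at this
    linarith
  have hE0 : 1 ≤ E := by
    have : 0 ≤ Real.log (q : ℝ) := Real.log_natCast_nonneg q
    linarith
  have hNu : (1 : ℝ) ≤ (N : ℝ) ^ u := one_le_pow₀ hN1
  have hNv : (1 : ℝ) ≤ (N : ℝ) ^ v := one_le_pow₀ hN1
  have h1 : (M : ℝ) / q + 1 ≤ D * A * ((N : ℝ) ^ u / q' + 1) := by
    have h2 : (M : ℝ) / q ≤ D * A * ((N : ℝ) ^ u / q') := by
      rw [mul_div_assoc', div_le_div_iff₀ hq0R hq'0R]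
      calc (M : ℝ) * q' ≤ (D * (N : ℝ) ^ u) * (A * q) := by gcongr
        _ = _ := by ring
    have h3 : 1 ≤ D * A := one_le_mul_of_one_le_of_one_le hD hA1'
    linarith
  have h2 : 2 * L + 2 * q * (1 + Real.log q) ≤ 2 * D * E * ((N : ℝ) ^ v + q') := by
    have h3 : L ≤ D * E * (N : ℝ) ^ v := by
      calc L ≤ D * (N : ℝ) ^ v := hL
        _ ≤ D * (N : ℝ) ^ v * E := le_mul_of_one_le_right (by positivity) hE0
        _ = _ := by ring
    have h4 : q * (1 + Real.log q) ≤ D * E * q' := by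
      calc (q : ℝ) * (1 + Real.log q) ≤ q' * E := by
            have : 0 ≤ Real.log (q : ℝ) := Real.log_natCast_nonneg q
            gcongr
        _ ≤ D * (q' * E) := le_mul_of_one_le_left (by positivity) hD
        _ = _ := by ring
    linarith
  have hlog : 0 ≤ Real.log (q : ℝ) := Real.log_natCast_nonneg q
  have hk1 : (N : ℝ) ^ k = N ^ (k - 1) * N := by
    rw [← pow_succ]
    congr 1
    omega
  have h5 : ((N : ℝ) ^ u / q' + 1) * ((N : ℝ) ^ v + q') ≤ 2 * ((N : ℝ) ^ k * saving k m N h) := by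
    have h6 : (N : ℝ) ^ u ≤ N ^ (k - 1) := pow_le_pow_right₀ hN1 (by omega)
    have h7 : (N : ℝ) ^ v ≤ N ^ (k - 1) := pow_le_pow_right₀ hN1 (by omega)
    have h8 : (N : ℝ) ^ k * saving k m N h = (N : ℝ) ^ k / q' + N ^ (k - 1) + q' := by
      rw [saving_eq hm, mul_add, mul_add, mul_div_cancel₀]
      · congr 1
        congr 1
        rw [hk1, mul_assoc, mul_inv_cancel₀ hN0.ne', mul_one]
      · positivity
    rw [h8]
    have h9 : ((N : ℝ) ^ u / q' + 1) * ((N : ℝ) ^ v + q') =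
        (N : ℝ) ^ k / q' + N ^ u + N ^ v + q' := by
      rw [← huv, pow_add]
      field_simp
      ring
    rw [h9]
    have : 0 ≤ (N : ℝ) ^ k / q' := by positivity
    linarith
  calc (M / q + 1) * (2 * L + 2 * q * (1 + Real.log q))
      ≤ (D * A * ((N : ℝ) ^ u / q' + 1)) * (2 * D * E * ((N : ℝ) ^ v + q')) := by
        gcongr
    _ = (2 * D * D * A * E) * (((N : ℝ) ^ u / q' + 1) * ((N : ℝ) ^ v + q')) := by ring
    _ ≤ (2 * D * D * A * E) * (2 * ((N : ℝ) ^ k * saving k m N h)) := by gcongr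
    _ = _ := by rw [hE]; ring

/-- Fourier completion of the indicator function of `[1, N]` modulo `3 * N`. -/
theorem exists_completion {N : ℕ} (hN : 1 ≤ N) :
    ∃ w : ℕ → ℂ, (∀ n : ℤ, 1 - (N : ℤ) ≤ n → n ≤ 2 * N →
      ∑ r ∈ Finset.range (3 * N), w r * e (r * n / (3 * N : ℕ)) =
        if 1 ≤ n ∧ n ≤ N then 1 else 0) ∧
      ∑ r ∈ Finset.range (3 * N), ‖w r‖ ≤ 3 + 2 * Real.log (3 * N : ℕ) := by
  have hQ0 : (0 : ℝ) < ((3 * N : ℕ) : ℝ) := by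
    have : 0 < 3 * N := by omega
    exact_mod_cast this
  set Q := 3 * N with hQ
  have horth : ∀ t : ℤ, |t| < Q →
      ∑ r ∈ Finset.range Q, e (r * (t / Q)) = if t = 0 then (Q : ℂ) else 0 := by
    intro t ht
    simp only [e_nat_mul]
    split_ifs with h0
    · simp [h0, e_zero]
    · have h1 : e (t / Q) ≠ 1 := by
        intro h
        rw [e, Complex.exp_eq_one_iff] at h
        obtain ⟨n, hn⟩ := h
        have h2 : (2 * Real.pi * Complex.I : ℂ) ≠ 0 := Complex.two_pi_I_ne_zero
        rw [mul_comm (n : ℂ), mul_right_inj' h2] at hn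
        have h3 : (t : ℝ) / Q = n := by exact_mod_cast hn
        rw [div_eq_iff hQ0.ne'] at h3
        have h4 : t = n * Q := by exact_mod_cast h3
        exact h0 (Int.eq_zero_of_abs_lt_dvd ⟨n, by rw [h4, mul_comm]⟩ ht)
      have h2 := geom_sum_mul (e (t / Q)) Q
      rw [← e_nat_mul, mul_div_cancel₀ _ hQ0.ne', e_int, sub_self] at h2
      exact (mul_eq_zero.1 h2).resolve_right (sub_ne_zero.2 h1)
  refine ⟨fun r => (Q : ℂ)⁻¹ * ∑ u ∈ Finset.Ico (1 : ℤ) (1 + N), e (-(r / Q) * u), ?_, ?_⟩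
  · intro n hn1 hn2
    have hQC : (Q : ℂ) ≠ 0 := by exact_mod_cast hQ0.ne'
    have h1 : ∀ r : ℕ, (Q : ℂ)⁻¹ * (∑ u ∈ Finset.Ico (1 : ℤ) (1 + N), e (-(r / Q) * u)) *
        e (r * n / Q) = (Q : ℂ)⁻¹ * ∑ u ∈ Finset.Ico (1 : ℤ) (1 + N), e (r * ((n - u : ℤ) / Q)) := by
      intro r
      rw [mul_assoc, Finset.sum_mul]
      congr 1
      refine Finset.sum_congr rfl fun u _ => ?_
      rw [← e_add]
      congr 1
      push_cast
      ring
    simp only [h1]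
    rw [← Finset.mul_sum, Finset.sum_comm]
    have h2 : ∀ u ∈ Finset.Ico (1 : ℤ) (1 + N), ∑ r ∈ Finset.range Q, e (r * ((n - u : ℤ) / Q)) =
        if n = u then (Q : ℂ) else 0 := by
      intro u hu
      rw [Finset.mem_Ico] at hu
      rw [horth _ (by rw [abs_lt, hQ]; push_cast; constructor <;> linarith)]
      simp only [sub_eq_zero]
    rw [Finset.sum_congr rfl h2, Finset.sum_ite_eq]
    simp only [Finset.mem_Ico, mul_ite, mul_zero, inv_mul_cancel₀ hQC]
    congr 1
    simp only [eq_iff_iff]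
    constructor <;> intro h <;> constructor <;> linarith [h.1, h.2]
  · have h1 : ∀ r ∈ Finset.range Q, ‖(Q : ℂ)⁻¹ * ∑ u ∈ Finset.Ico (1 : ℤ) (1 + N), e (-(r / Q) * u)‖ ≤
        (Q : ℝ)⁻¹ * geomBound N (r / Q) := by
      intro r _
      rw [norm_mul, norm_inv, Complex.norm_natCast, ← geomBound_neg]
      exact mul_le_mul_of_nonneg_left (norm_sum_e_le _ _ _) (by positivity)
    refine (Finset.sum_le_sum h1).trans ?_
    rw [← Finset.mul_sum, inv_mul_le_iff₀ hQ0]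
    refine (sum_geomBound_range_le (Nat.cast_nonneg N) (by omega)).trans ?_
    have : (2 * N : ℝ) ≤ Q := by
      rw [hQ]
      push_cast
      linarith [Nat.cast_nonneg (α := ℝ) N]
    linarith

theorem sum_norm_sq_box_le {d : ℕ} (o : Fin d → ℤ) (ℓ : Fin d → ℕ) (Y : Finset ℤ) (θ : ℤ → ℂ)
    (hθ : ∀ y, ‖θ y‖ ≤ 1) (c : ℤ → Fin d → ℝ) :
    ∑ H ∈ Fintype.piFinset fun j => Finset.Ico (o j) (o j + ℓ j),
        ‖∑ y ∈ Y, θ y * e (∑ j, H j * c y j)‖ ^ 2 ≤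
      ∑ y ∈ Y, ∑ z ∈ Y, ∏ j, geomBound (ℓ j) (c y j - c z j) := by
  classical
  set Box := Fintype.piFinset fun j => Finset.Ico (o j) (o j + ℓ j) with hBox
  have h1 : ((∑ H ∈ Box, ‖∑ y ∈ Y, θ y * e (∑ j, H j * c y j)‖ ^ 2 : ℝ) : ℂ) =
      ∑ y ∈ Y, ∑ z ∈ Y, θ y * (starRingEnd ℂ) (θ z) *
        ∏ j, ∑ n ∈ Finset.Ico (o j) (o j + ℓ j), e ((c y j - c z j) * n) := by
    push_cast
    have h2 : ∀ H ∈ Box, (‖∑ y ∈ Y, θ y * e (∑ j, H j * c y j)‖ : ℂ) ^ 2 =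
        ∑ y ∈ Y, ∑ z ∈ Y, θ y * (starRingEnd ℂ) (θ z) * ∏ j, e ((c y j - c z j) * H j) := by
      intro H _
      rw [← Complex.mul_conj', map_sum, Finset.sum_mul_sum]
      refine Finset.sum_congr rfl fun y _ => Finset.sum_congr rfl fun z _ => ?_
      rw [map_mul, conj_e, ← e_sum]
      rw [show θ y * e (∑ j, H j * c y j) * ((starRingEnd ℂ) (θ z) * e (-∑ j, H j * c z j)) =
        θ y * (starRingEnd ℂ) (θ z) * (e (∑ j, H j * c y j) * e (-∑ j, H j * c z j)) by ring,
        ← e_add, ← sub_eq_add_neg, ← Finset.sum_sub_distrib]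
      congr 2
      refine Finset.sum_congr rfl fun j _ => ?_
      ring
    rw [Finset.sum_congr rfl h2, Finset.sum_comm]
    refine Finset.sum_congr rfl fun y _ => ?_
    rw [Finset.sum_comm]
    refine Finset.sum_congr rfl fun z _ => ?_
    rw [← Finset.mul_sum, Finset.prod_univ_sum]
  have h0 : 0 ≤ ∑ H ∈ Box, ‖∑ y ∈ Y, θ y * e (∑ j, H j * c y j)‖ ^ 2 :=
    Finset.sum_nonneg fun _ _ => by positivity
  rw [← abs_of_nonneg h0, ← Real.norm_eq_abs, ← Complex.norm_real, h1]
  refine (norm_sum_le _ _).trans (Finset.sum_le_sum fun y _ => ?_)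
  refine (norm_sum_le _ _).trans (Finset.sum_le_sum fun z _ => ?_)
  rw [norm_mul, norm_mul, RCLike.norm_conj, norm_prod]
  have h3 : ∏ j, ‖∑ n ∈ Finset.Ico (o j) (o j + ℓ j), e ((c y j - c z j) * n)‖ ≤
      ∏ j, geomBound (ℓ j) (c y j - c z j) :=
    Finset.prod_le_prod (fun _ _ => norm_nonneg _) fun j _ => norm_sum_e_le _ _ _
  refine (mul_le_mul_of_nonneg_left h3 (by positivity)).trans ?_
  refine mul_le_of_le_one_left (Finset.prod_nonneg fun j _ => geomBound_nonneg (Nat.cast_nonneg _) _) ?_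
  exact mul_le_one₀ (hθ y) (norm_nonneg _) (hθ z)

theorem sum_eval_add {g : ℤ[X]} {d s : ℕ} (hg : g.natDegree = d + 1) (x : Fin s → ℤ) (y : ℤ) :
    ∑ i, g.eval (x i + y) = ∑ j : Fin (d + 1), powerSums d x j * (taylor y g).coeff j +
      g.coeff (d + 1) * ∑ i, x i ^ (d + 1) := by
  have h1 : ∀ z : ℤ, g.eval (z + y) =
      ∑ j : Fin (d + 1), z ^ (j : ℕ) * (taylor y g).coeff j + g.coeff (d + 1) * z ^ (d + 1) := by
    intro z
    rw [← taylor_eval, eval_eq_sum_range, natDegree_taylor, hg, Finset.sum_range_succ,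
      Finset.sum_range]
    congr 1
    · exact Finset.sum_congr rfl fun j _ => mul_comm _ _
    · congr 1
      rw [← hg]
      exact coeff_taylor_natDegree ..
  simp only [h1, Finset.sum_add_distrib, ← Finset.mul_sum]
  rw [Finset.sum_comm]
  congr 1
  refine Finset.sum_congr rfl fun j _ => ?_
  rw [← Finset.sum_mul]
  rfl

theorem coeff_taylor_pred {g : ℤ[X]} {d : ℕ} (hg : g.natDegree ≤ d + 1) (y : ℤ) :
    (taylor y g).coeff d = g.coeff d + (d + 1) * g.coeff (d + 1) * y := by
  have h0 : (hasseDeriv d g).natDegree ≤ 1 := by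
    have := natDegree_hasseDeriv_le g d
    omega
  rw [taylor_coeff, eval_eq_sum_range' (Nat.lt_succ_of_le h0)]
  simp [Finset.sum_range_succ, hasseDeriv_coeff, add_comm 1 d]

theorem sq_sum_norm_pow_le {g : ℤ[X]} {d s N : ℕ} (hg : g.natDegree = d + 1) (α : ℝ)
    (b : ℤ → ℂ) (hb : ∀ x, ‖b x‖ = 1) (Y : Finset ℤ) :
    (∑ y ∈ Y, ‖∑ x ∈ Finset.Icc (-(N : ℤ)) N, b x * e (α * (g.eval (x + y) : ℤ))‖ ^ s) ^ 2 ≤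
      (∑ H ∈ Fintype.piFinset fun j : Fin (d + 1) => Finset.Ico (-((s * N ^ (j : ℕ) : ℕ) : ℤ))
          (-((s * N ^ (j : ℕ) : ℕ) : ℤ) + ((2 * (s * N ^ (j : ℕ)) + 1 : ℕ) : ℤ)),
        (powerSumCount d s N H : ℝ) ^ 2) *
      ∑ y ∈ Y, ∑ z ∈ Y, ∏ j : Fin (d + 1), geomBound ((2 * (s * N ^ (j : ℕ)) + 1 : ℕ))
        (α * ((taylor y g).coeff j : ℤ) - α * ((taylor z g).coeff j : ℤ)) := by
  classical
  set X := Fintype.piFinset fun _ : Fin s => Finset.Icc (-(N : ℤ)) N with hX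
  set Box := Fintype.piFinset fun j : Fin (d + 1) => Finset.Ico (-((s * N ^ (j : ℕ) : ℕ) : ℤ))
          (-((s * N ^ (j : ℕ) : ℕ) : ℤ) + ((2 * (s * N ^ (j : ℕ)) + 1 : ℕ) : ℤ)) with hBox
  set U : ℤ → ℂ := fun y => ∑ x ∈ Finset.Icc (-(N : ℤ)) N, b x * e (α * (g.eval (x + y) : ℤ)) with hU
  set θ : ℤ → ℂ := fun y => (starRingEnd ℂ) (U y ^ s) / ‖U y ^ s‖ with hθ
  have hθ1 : ∀ y, ‖θ y‖ ≤ 1 := by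
    intro y
    rw [hθ]
    simp only [norm_div, RCLike.norm_conj, Complex.norm_real, norm_norm]
    exact div_self_le_one _
  have hθU : ∀ y, θ y * U y ^ s = ((‖U y‖ ^ s : ℝ) : ℂ) := by
    intro y
    rw [hθ, ← norm_pow]
    simp only
    rw [div_mul_eq_mul_div, mul_comm, Complex.mul_conj']
    rcases eq_or_ne (‖U y ^ s‖ : ℂ) 0 with h | h
    · rw [h]; simp
    · rw [sq, mul_div_cancel_right₀ _ h]
  set G : (Fin (d + 1) → ℤ) → ℂ := fun H =>
    ∑ y ∈ Y, θ y * e (∑ j, H j * (α * ((taylor y g).coeff j : ℤ))) with hG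
  set β : (Fin s → ℤ) → ℂ := fun x =>
    (∏ i, b (x i)) * e (α * (g.coeff (d + 1) * ∑ i, x i ^ (d + 1) : ℤ)) with hβ
  have hβ1 : ∀ x, ‖β x‖ = 1 := by
    intro x
    rw [hβ]
    simp only [norm_mul, norm_e, norm_prod, hb, Finset.prod_const_one, mul_one]
  have hUs : ∀ y, U y ^ s = ∑ x ∈ X, β x * e (∑ j, powerSums d x j * (α * ((taylor y g).coeff j : ℤ))) := by
    intro y
    rw [hU]
    simp only
    rw [Finset.sum_pow']
    refine Finset.sum_congr rfl fun x _ => ?_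
    rw [Finset.prod_mul_distrib, hβ, ← e_sum]
    simp only
    rw [mul_assoc, ← e_add, ← Finset.mul_sum]
    congr 2
    have := congrArg (Int.cast : ℤ → ℝ) (sum_eval_add hg x y)
    push_cast at this ⊢
    rw [this, mul_add, Finset.mul_sum, add_comm]
    congr 1
    refine Finset.sum_congr rfl fun j _ => ?_
    ring
  have hsum : ((∑ y ∈ Y, ‖U y‖ ^ s : ℝ) : ℂ) = ∑ x ∈ X, β x * G (powerSums d x) := by
    rw [Complex.ofReal_sum]
    simp only [← hθU, hUs, hG, Finset.mul_sum]
    rw [Finset.sum_comm]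
    refine Finset.sum_congr rfl fun x _ => Finset.sum_congr rfl fun y _ => ?_
    ring
  have hmem : ∀ x ∈ X, powerSums d x ∈ Box := by
    intro x hx
    rw [hX, Fintype.mem_piFinset] at hx
    rw [hBox, Fintype.mem_piFinset]
    intro j
    have h1 : |powerSums d x j| ≤ ((s * N ^ (j : ℕ) : ℕ) : ℤ) := by
      refine (Finset.abs_sum_le_sum_abs _ _).trans ?_
      refine (Finset.sum_le_sum (g := fun _ => (N : ℤ) ^ (j : ℕ)) fun i _ => ?_).trans ?_
      · rw [abs_pow]
        have := Finset.mem_Icc.1 (hx i)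
        exact pow_le_pow_left₀ (abs_nonneg _) (abs_le.2 this) _
      · simp
    rw [Finset.mem_Ico]
    rw [abs_le] at h1
    push_cast at h1 ⊢
    constructor <;> linarith [h1.1, h1.2]
  have h1 : ∑ y ∈ Y, ‖U y‖ ^ s ≤ ∑ H ∈ Box, (powerSumCount d s N H : ℝ) * ‖G H‖ := by
    have h0 : 0 ≤ ∑ y ∈ Y, ‖U y‖ ^ s := Finset.sum_nonneg fun _ _ => by positivity
    rw [← abs_of_nonneg h0, ← Real.norm_eq_abs, ← Complex.norm_real, hsum]
    refine (norm_sum_le _ _).trans (le_of_eq ?_)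
    simp only [norm_mul, hβ1, one_mul]
    rw [← Finset.sum_fiberwise_of_maps_to hmem]
    refine Finset.sum_congr rfl fun H _ => ?_
    rw [Finset.sum_congr rfl (g := fun _ => ‖G H‖) fun x hx => by rw [(Finset.mem_filter.1 hx).2]]
    rw [Finset.sum_const, nsmul_eq_mul]
    rfl
  have h0 : 0 ≤ ∑ y ∈ Y, ‖U y‖ ^ s := Finset.sum_nonneg fun _ _ => by positivity
  calc (∑ y ∈ Y, ‖U y‖ ^ s) ^ 2 ≤ (∑ H ∈ Box, (powerSumCount d s N H : ℝ) * ‖G H‖) ^ 2 :=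
        pow_le_pow_left₀ h0 h1 2
    _ ≤ (∑ H ∈ Box, (powerSumCount d s N H : ℝ) ^ 2) * ∑ H ∈ Box, ‖G H‖ ^ 2 :=
        Finset.sum_mul_sq_le_sq_mul_sq _ _ _
    _ ≤ _ := by
        refine mul_le_mul_of_nonneg_left ?_ (Finset.sum_nonneg fun _ _ => by positivity)
        exact sum_norm_sq_box_le _ _ Y θ hθ1 _

/-- Sums over `[1, N]` are controlled by averages of shifted sums over `[-N, N]`. -/
theorem mul_norm_sum_pow_le {N s : ℕ} (hN : 1 ≤ N) (f : ℤ → ℂ) {E : ℝ}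
    (hE : ∀ b : ℤ → ℂ, (∀ x, ‖b x‖ = 1) →
      ∑ y ∈ Finset.Ico (1 : ℤ) (1 + N),
        ‖∑ x ∈ Finset.Icc (-(N : ℤ)) N, b x * f (x + y)‖ ^ s ≤ E) :
    N * ‖∑ n ∈ Finset.Ico (1 : ℤ) (1 + N), f n‖ ^ s ≤ (3 + 2 * Real.log (3 * N : ℕ)) ^ s * E := by
  obtain ⟨w, hw1, hw2⟩ := exists_completion hN
  set S := ∑ n ∈ Finset.Ico (1 : ℤ) (1 + N), f n with hS
  set R := Finset.range (3 * N) with hR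
  set U : ℕ → ℤ → ℂ := fun r y =>
    ∑ x ∈ Finset.Icc (-(N : ℤ)) N, e (r * x / (3 * N : ℕ)) * f (x + y) with hU
  have hSy : ∀ y ∈ Finset.Ico (1 : ℤ) (1 + N), ‖S‖ ≤ ∑ r ∈ R, ‖w r‖ * ‖U r y‖ := by
    intro y hy
    rw [Finset.mem_Ico] at hy
    have h1 : S = ∑ x ∈ Finset.Icc (-(N : ℤ)) N,
        (if 1 ≤ x + y ∧ x + y ≤ N then (1 : ℂ) else 0) * f (x + y) := by
      simp only [ite_mul, one_mul, zero_mul]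
      rw [← Finset.sum_filter, hS]
      refine Finset.sum_nbij' (fun n => n - y) (fun x => x + y) ?_ ?_ ?_ ?_ ?_
      · intro n hn
        rw [Finset.mem_Ico] at hn
        rw [Finset.mem_filter, Finset.mem_Icc]
        omega
      · intro x hx
        rw [Finset.mem_filter, Finset.mem_Icc] at hx
        rw [Finset.mem_Ico]
        omega
      · intro n _; ring
      · intro x _; ring
      · intro n _; congr 1; ring
    have h2 : S = ∑ r ∈ R, w r * e (r * y / (3 * N : ℕ)) * U r y := by
      rw [h1]
      simp only [hU, Finset.mul_sum]
      rw [Finset.sum_comm]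
      refine Finset.sum_congr rfl fun x hx => ?_
      rw [Finset.mem_Icc] at hx
      rw [← hw1 (x + y) (by linarith [hx.1, hy.1]) (by linarith [hx.2, hy.2]), Finset.sum_mul]
      refine Finset.sum_congr rfl fun r _ => ?_
      have : e (r * ((x + y : ℤ) : ℝ) / (3 * N : ℕ)) =
          e (r * y / (3 * N : ℕ)) * e (r * x / (3 * N : ℕ)) := by
        rw [← e_add]
        congr 1
        push_cast
        ring
      rw [this]
      ring
    rw [h2]
    refine (norm_sum_le _ _).trans (le_of_eq ?_)
    simp only [norm_mul, norm_e, mul_one]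
  set W := ∑ r ∈ R, ‖w r‖ with hW
  have hW0 : 0 ≤ W := Finset.sum_nonneg fun _ _ => norm_nonneg _
  have hWpos : 0 < W := by
    rcases hW0.eq_or_lt with h | h
    · exfalso
      have h1 := hw1 1 (by omega) (by omega)
      rw [if_pos (by omega)] at h1
      have h2 : ∀ r ∈ R, ‖w r‖ = 0 := by
        rw [← Finset.sum_eq_zero_iff_of_nonneg fun _ _ => norm_nonneg _]
        exact h.symm
      rw [Finset.sum_eq_zero fun r hr => by rw [norm_eq_zero.1 (h2 r hr), zero_mul]] at h1
      exact zero_ne_one h1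
    · exact h
  have hSy' : ∀ y ∈ Finset.Ico (1 : ℤ) (1 + N), ‖S‖ ^ s ≤ W ^ s * ∑ r ∈ R, ‖w r‖ / W * ‖U r y‖ ^ s := by
    intro y hy
    have h1 := Real.pow_arith_mean_le_arith_mean_pow R (fun r => ‖w r‖ / W) (fun r => ‖U r y‖)
      (fun _ _ => by positivity) (by rw [← Finset.sum_div, div_self hWpos.ne'])
      (fun _ _ => norm_nonneg _) s
    calc ‖S‖ ^ s ≤ (W * ∑ r ∈ R, ‖w r‖ / W * ‖U r y‖) ^ s := by
          refine pow_le_pow_left₀ (norm_nonneg _) ((hSy y hy).trans (le_of_eq ?_)) s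
          rw [Finset.mul_sum]
          refine Finset.sum_congr rfl fun r _ => ?_
          field_simp
      _ ≤ _ := by
          rw [mul_pow]
          exact mul_le_mul_of_nonneg_left h1 (by positivity)
  have hEr : ∀ r : ℕ, ∑ y ∈ Finset.Ico (1 : ℤ) (1 + N), ‖U r y‖ ^ s ≤ E := fun r =>
    hE (fun x => e (r * x / (3 * N : ℕ))) fun x => norm_e _
  have hE0 : 0 ≤ E := (Finset.sum_nonneg fun _ _ => by positivity).trans (hEr 0)
  calc (N : ℝ) * ‖S‖ ^ s = ∑ y ∈ Finset.Ico (1 : ℤ) (1 + N), ‖S‖ ^ s := by simp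
    _ ≤ ∑ y ∈ Finset.Ico (1 : ℤ) (1 + N), W ^ s * ∑ r ∈ R, ‖w r‖ / W * ‖U r y‖ ^ s :=
        Finset.sum_le_sum hSy'
    _ = W ^ s * ∑ r ∈ R, ‖w r‖ / W * ∑ y ∈ Finset.Ico (1 : ℤ) (1 + N), ‖U r y‖ ^ s := by
        rw [← Finset.mul_sum, Finset.sum_comm]
        simp only [Finset.mul_sum]
    _ ≤ W ^ s * ∑ r ∈ R, ‖w r‖ / W * E := by
        gcongr with r _
        exact hEr r
    _ = W ^ s * E := by
        rw [← Finset.sum_mul, ← Finset.sum_div, div_self hWpos.ne', one_mul]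
    _ ≤ _ := by gcongr

/-- The Weyl sum of `g` with frequency `h / m`. -/
noncomputable def weylSum (g : ℤ[X]) (m N h : ℕ) : ℂ :=
  ∑ n ∈ Finset.Ico (1 : ℤ) (1 + N), e ((h * g.eval n : ℤ) / m)

theorem norm_weylSum_le (g : ℤ[X]) (m N h : ℕ) : ‖weylSum g m N h‖ ≤ N := by
  refine (norm_sum_le _ _).trans ?_
  simp [norm_e]

/-- Extracting roots from a bound on a power of a Weyl sum. -/
theorem weyl_bound_of_pow_le {g : ℤ[X]} {k M : ℕ} (hM : M ≠ 0) {ε C : ℝ} (hε : 0 ≤ ε) (hC : 1 ≤ C)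
    (h : ∀ m N h : ℕ, 1 ≤ m → 1 ≤ N → 1 ≤ h → ((m / Nat.gcd h m : ℕ) : ℝ) ≤ (N : ℝ) ^ k →
      ‖weylSum g m N h‖ ^ M ≤ C * ((N : ℝ) ^ ((1 : ℝ) + ε)) ^ M * saving k m N h) :
    ∀ m N h : ℕ, 1 ≤ m → 1 ≤ N → 1 ≤ h →
      ‖weylSum g m N h‖ ≤ C * (N : ℝ) ^ ((1 : ℝ) + ε) * saving k m N h ^ ((M : ℝ)⁻¹) := by
  intro m N r hm hN hr
  have hN1 : (1 : ℝ) ≤ N := by exact_mod_cast hN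
  have hs := saving_nonneg k m N r
  have hM0 : (0 : ℝ) ≤ (M : ℝ)⁻¹ := by positivity
  rcases le_or_gt (((m / Nat.gcd r m : ℕ) : ℝ)) ((N : ℝ) ^ k) with hq | hq
  · have h1 := Real.rpow_le_rpow (by positivity) (h m N r hm hN hr hq) hM0
    rw [Real.pow_rpow_inv_natCast (norm_nonneg _) hM, Real.mul_rpow (by positivity) hs,
      Real.mul_rpow (by positivity) (by positivity),
      Real.pow_rpow_inv_natCast (by positivity) hM] at h1
    refine h1.trans ?_
    have h2 : C ^ ((M : ℝ)⁻¹) ≤ C := by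
      conv_rhs => rw [← Real.rpow_one C]
      refine Real.rpow_le_rpow_of_exponent_le hC (inv_le_one_of_one_le₀ ?_)
      exact_mod_cast Nat.one_le_iff_ne_zero.2 hM
    gcongr
  · have h1 : 1 ≤ saving k m N r := by
      rw [saving_eq hm]
      have h2 : 1 ≤ ((m / Nat.gcd r m : ℕ) : ℝ) / (N : ℝ) ^ k := by
        rw [one_le_div (by positivity)]
        exact hq.le
      have h3 : (0 : ℝ) ≤ ((m / Nat.gcd r m : ℕ) : ℝ)⁻¹ := by positivity
      have h4 : (0 : ℝ) ≤ (N : ℝ)⁻¹ := by positivity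
      linarith
    calc ‖weylSum g m N r‖ ≤ N := norm_weylSum_le _ _ _ _
      _ ≤ (N : ℝ) ^ ((1 : ℝ) + ε) := by
          conv_lhs => rw [← Real.rpow_one (N : ℝ)]
          exact Real.rpow_le_rpow_of_exponent_le hN1 (by linarith)
      _ ≤ C * (N : ℝ) ^ ((1 : ℝ) + ε) := le_mul_of_one_le_left (by positivity) hC
      _ ≤ _ := le_mul_of_one_le_right (by positivity) (Real.one_le_rpow h1 hM0)

theorem sum_range_add_eq (d : ℕ) : 2 * (∑ j : Fin d, (j : ℕ)) + 2 * d = 2 * tri d := by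
  rw [two_mul_tri, Fin.sum_univ_eq_sum_range (fun i => i), mul_comm 2 (∑ i ∈ _, _), Finset.sum_range_id_mul_two]
  rcases d with _ | d
  · rfl
  · simp only [Nat.add_sub_cancel]; ring

theorem sum_prod_geomBound_le {g : ℤ[X]} {d : ℕ} (hd : 1 ≤ d) (hg : g.natDegree = d + 1)
    {s : ℕ} (hs : 1 ≤ s) {ε : ℝ} (hε : 0 < ε) :
    ∃ C ≥ (1 : ℝ), ∀ m N h : ℕ, 1 ≤ m → 1 ≤ N → 1 ≤ h →
      ((m / Nat.gcd h m : ℕ) : ℝ) ≤ (N : ℝ) ^ (d + 1) →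
      ∑ y ∈ Finset.Ico (1 : ℤ) (1 + N), ∑ z ∈ Finset.Ico (1 : ℤ) (1 + N),
        ∏ j : Fin (d + 1), geomBound ((2 * (s * N ^ (j : ℕ)) + 1 : ℕ))
          ((h / m : ℝ) * ((taylor y g).coeff j : ℤ) - (h / m : ℝ) * ((taylor z g).coeff j : ℤ)) ≤
      C * (N : ℝ) ^ ε * ((N : ℝ) ^ (tri d + 2) * saving (d + 1) m N h) := by
  have hlead : g.coeff (d + 1) ≠ 0 := by
    rw [← hg]
    exact leadingCoeff_ne_zero.2 fun h0 => by rw [h0, natDegree_zero] at hg; omega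
  have hsR : (1 : ℝ) ≤ s := by exact_mod_cast hs
  obtain ⟨C, hC, hB⟩ := sum_geomBound_le_saving (k := d + 1) (u := 1) (v := d) (by omega) le_rfl hd
    (D := 3 * s) (by linarith) (B := (d + 1) * g.coeff (d + 1))
    (mul_ne_zero (by positivity) hlead) hε
  refine ⟨(6 * s) ^ d * C, ?_, ?_⟩
  · exact one_le_mul_of_one_le_of_one_le (one_le_pow₀ (by linarith)) hC
  intro m N h hm hN hh hq
  have hN1 : (1 : ℝ) ≤ N := by exact_mod_cast hN
  have hN0 : (0 : ℝ) < N := by linarith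
  have hℓ : ∀ j : ℕ, ((2 * (s * N ^ j) + 1 : ℕ) : ℝ) ≤ 3 * s * (N : ℝ) ^ j := by
    intro j
    push_cast
    have : 1 ≤ s * (N : ℝ) ^ j := one_le_mul_of_one_le_of_one_le hsR (one_le_pow₀ hN1)
    linarith
  set P : ℝ := ∏ j : Fin d, (6 * s * (N : ℝ) ^ (j : ℕ)) with hP
  have hP0 : 0 ≤ P := Finset.prod_nonneg fun _ _ => by positivity
  set L : ℝ := ((2 * (s * N ^ d) + 1 : ℕ) : ℝ) with hL
  have h1 : ∀ y z : ℤ, ∏ j : Fin (d + 1), geomBound ((2 * (s * N ^ (j : ℕ)) + 1 : ℕ))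
          ((h / m : ℝ) * ((taylor y g).coeff j : ℤ) - (h / m : ℝ) * ((taylor z g).coeff j : ℤ)) ≤
      P * geomBound L (((h * ((d + 1) * g.coeff (d + 1)) : ℤ) : ℝ) * ((z - y : ℤ) : ℝ) / m) := by
    intro y z
    rw [Fin.prod_univ_castSucc]
    refine mul_le_mul ?_ (le_of_eq ?_) (geomBound_nonneg (Nat.cast_nonneg _) _) hP0
    · refine Finset.prod_le_prod (fun _ _ => geomBound_nonneg (Nat.cast_nonneg _) _) fun j _ => ?_
      refine (geomBound_le (Nat.cast_nonneg _) _).trans ?_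
      have := hℓ (j : ℕ)
      simp only [Fin.val_castSucc]
      linarith
    · rw [← geomBound_neg]
      simp only [Fin.val_last, coeff_taylor_pred hg.le]
      rw [hL]
      congr 1
      push_cast
      ring
  have h2 : ∀ y : ℤ, ∑ z ∈ Finset.Ico (1 : ℤ) (1 + N),
      geomBound L (((h * ((d + 1) * g.coeff (d + 1)) : ℤ) : ℝ) * ((z - y : ℤ) : ℝ) / m) ≤
      C * (N : ℝ) ^ ε * ((N : ℝ) ^ (d + 1) * saving (d + 1) m N h) := by
    intro y
    have h3 := hB m N h hm hN hh hq (1 - y) N L (by rw [pow_one]; nlinarith) (Nat.cast_nonneg _) (hℓ d)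
    refine le_trans (le_of_eq ?_) h3
    rw [sum_Ico_int, sum_Ico_int]
    refine Finset.sum_congr rfl fun i _ => ?_
    congr 2
    push_cast
    ring
  have hPeq : P * N = (6 * s) ^ d * (N : ℝ) ^ (tri d - d + 1) := by
    rw [hP, Finset.prod_mul_distrib, Finset.prod_const, Finset.card_univ, Fintype.card_fin,
      Finset.prod_pow_eq_pow_sum, pow_succ, mul_assoc]
    have := sum_range_add_eq d
    congr 3
    omega
  have htd : d ≤ tri d := by have := sum_range_add_eq d; omega
  calc _ ≤ ∑ y ∈ Finset.Ico (1 : ℤ) (1 + N), ∑ z ∈ Finset.Ico (1 : ℤ) (1 + N),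
        P * geomBound L (((h * ((d + 1) * g.coeff (d + 1)) : ℤ) : ℝ) * ((z - y : ℤ) : ℝ) / m) :=
        Finset.sum_le_sum fun y _ => Finset.sum_le_sum fun z _ => h1 y z
    _ ≤ ∑ y ∈ Finset.Ico (1 : ℤ) (1 + N),
        P * (C * (N : ℝ) ^ ε * ((N : ℝ) ^ (d + 1) * saving (d + 1) m N h)) := by
        refine Finset.sum_le_sum fun y _ => ?_
        rw [← Finset.mul_sum]
        exact mul_le_mul_of_nonneg_left (h2 y) hP0
    _ = (P * N) * (C * (N : ℝ) ^ ε * ((N : ℝ) ^ (d + 1) * saving (d + 1) m N h)) := by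
        rw [Finset.sum_const, Int.card_Ico, nsmul_eq_mul]
        have : (1 + (N : ℤ) - 1).toNat = N := by omega
        rw [this]
        ring
    _ = _ := by
        rw [hPeq]
        have : tri d + 2 = (tri d - d + 1) + (d + 1) := by omega
        rw [this, pow_add]
        ring

theorem weyl_bound_vinogradov {g : ℤ[X]} {d : ℕ} (hd : 1 ≤ d) (hg : g.natDegree = d + 1)
    {ε : ℝ} (hε : 0 < ε) :
    ∃ C ≥ (1 : ℝ), ∀ m N h : ℕ, 1 ≤ m → 1 ≤ N → 1 ≤ h →
      ‖weylSum g m N h‖ ≤ C * (N : ℝ) ^ ((1 : ℝ) + ε) *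
        saving (d + 1) m N h ^ (((2 * tri d : ℕ) : ℝ)⁻¹) := by
  set s := tri d with hs
  have hs1 : 1 ≤ s := tri_pos hd
  have hsR : (1 : ℝ) ≤ s := by exact_mod_cast hs1
  set δ : ℝ := ε * (2 * s) / (2 * s + 2) with hδ
  have hδ0 : 0 < δ := by positivity
  obtain ⟨C₁, hC₁, h₁⟩ := vinogradov hd hδ0
  obtain ⟨C₂, hC₂, h₂⟩ := sum_prod_geomBound_le hd hg hs1 hδ0
  have hlog3 : 0 ≤ Real.log 3 := Real.log_nonneg (by norm_num)
  set C₃ : ℝ := 3 + 2 * Real.log 3 + 2 / δ with hC₃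
  have hC₃1 : 1 ≤ C₃ := by
    have : 0 ≤ 2 / δ := by positivity
    linarith
  have hC : 1 ≤ C₃ ^ (2 * s) * (C₁ * C₂) := one_le_mul_of_one_le_of_one_le (one_le_pow₀ hC₃1)
    (one_le_mul_of_one_le_of_one_le hC₁ hC₂)
  refine ⟨_, hC, weyl_bound_of_pow_le (by omega) hε.le hC ?_⟩
  intro m N h hm hN hh hq
  have hN1 : (1 : ℝ) ≤ N := by exact_mod_cast hN
  have hN0 : (0 : ℝ) < N := by linarith
  have hsav := saving_nonneg (d + 1) m N h
  set E2 : ℝ := C₁ * (N : ℝ) ^ ((s : ℝ) + δ) *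
    (C₂ * (N : ℝ) ^ δ * ((N : ℝ) ^ (s + 2) * saving (d + 1) m N h)) with hE2
  have hE20 : 0 ≤ E2 := by positivity
  have h3 : N * ‖weylSum g m N h‖ ^ s ≤ (3 + 2 * Real.log (3 * N : ℕ)) ^ s * √E2 := by
    refine mul_norm_sum_pow_le hN (fun n => e ((h * g.eval n : ℤ) / m)) fun b hb => ?_
    refine Real.le_sqrt_of_sq_le ?_
    have h4 := sq_sum_norm_pow_le (s := s) (N := N) hg (h / m : ℝ) b hb (Finset.Ico (1 : ℤ) (1 + N))
    have h5 : ∀ n : ℤ, e ((h * g.eval n : ℤ) / m) = e ((h / m : ℝ) * (g.eval n : ℤ)) := by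
      intro n
      congr 1
      push_cast
      ring
    simp only [h5]
    refine h4.trans ?_
    refine mul_le_mul (h₁ N hN _) (h₂ m N h hm hN hh hq) ?_ (by positivity)
    exact Finset.sum_nonneg fun _ _ => Finset.sum_nonneg fun _ _ => Finset.prod_nonneg fun _ _ =>
      geomBound_nonneg (Nat.cast_nonneg _) _
  have hW : 3 + 2 * Real.log (3 * N : ℕ) ≤ C₃ * (N : ℝ) ^ δ := by
    have h4 := one_add_log_le (k := 2) hN hδ0
    have h5 : (1 : ℝ) ≤ (N : ℝ) ^ δ := Real.one_le_rpow hN1 hδ0.le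
    rw [Nat.cast_mul, Nat.cast_ofNat, Real.log_mul (by norm_num) hN0.ne']
    push_cast at h4
    rw [hC₃]
    nlinarith
  have hW0 : 0 ≤ 3 + 2 * Real.log (3 * N : ℕ) := by
    have := Real.log_natCast_nonneg (3 * N)
    linarith
  have h4 : (N * ‖weylSum g m N h‖ ^ s) ^ 2 ≤ ((C₃ * (N : ℝ) ^ δ) ^ s * √E2) ^ 2 := by
    refine pow_le_pow_left₀ (by positivity) (h3.trans ?_) 2
    gcongr
  rw [mul_pow, mul_pow, Real.sq_sqrt hE20, ← pow_mul, ← pow_mul, mul_comm s 2] at h4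
  refine le_of_mul_le_mul_left (h4.trans (le_of_eq ?_)) (by positivity : (0 : ℝ) < (N : ℝ) ^ 2)
  have hexp : (N : ℝ) ^ 2 * ((N : ℝ) ^ ((1 : ℝ) + ε)) ^ (2 * s) =
      ((N : ℝ) ^ δ) ^ (2 * s) * ((N : ℝ) ^ ((s : ℝ) + δ) * ((N : ℝ) ^ δ * (N : ℝ) ^ (s + 2))) := by
    rw [← Real.rpow_natCast (N : ℝ) 2, ← Real.rpow_natCast (N : ℝ) (s + 2),
      ← Real.rpow_natCast ((N : ℝ) ^ ((1 : ℝ) + ε)), ← Real.rpow_natCast ((N : ℝ) ^ δ),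
      ← Real.rpow_mul hN0.le, ← Real.rpow_mul hN0.le, ← Real.rpow_add hN0, ← Real.rpow_add hN0,
      ← Real.rpow_add hN0, ← Real.rpow_add hN0]
    congr 1
    have : δ * (2 * s + 2) = ε * (2 * s) := by
      rw [hδ]
      field_simp
    push_cast
    linarith
  calc (C₃ * (N : ℝ) ^ δ) ^ (2 * s) * E2
      = C₃ ^ (2 * s) * (C₁ * C₂) * (((N : ℝ) ^ δ) ^ (2 * s) *
          ((N : ℝ) ^ ((s : ℝ) + δ) * ((N : ℝ) ^ δ * (N : ℝ) ^ (s + 2)))) *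
          saving (d + 1) m N h := by rw [mul_pow, hE2]; ring
    _ = _ := by rw [← hexp]; ring

/-- The divisor bound. -/
theorem card_divisors_le {ε : ℝ} (hε : 0 < ε) :
    ∃ C ≥ (1 : ℝ), ∀ n : ℕ, n ≠ 0 → (n.divisors.card : ℝ) ≤ C * (n : ℝ) ^ ε := by
  have hlog : 0 < Real.log 2 := Real.log_pos (by norm_num)
  set c : ℝ := 1 + 1 / (ε * Real.log 2) with hc
  have hc1 : 1 ≤ c := by
    have : 0 < 1 / (ε * Real.log 2) := by positivity
    linarith
  set P : ℕ := ⌈(2 : ℝ) ^ ε⁻¹⌉₊ with hP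
  refine ⟨c ^ P, one_le_pow₀ hc1, fun n hn => ?_⟩
  have hfac : ∀ p ∈ n.primeFactors, ((n.factorization p + 1 : ℕ) : ℝ) ≤
      (if p < P then c else 1) * ((p ^ n.factorization p : ℕ) : ℝ) ^ ε := by
    intro p hp
    have hp2 : (2 : ℝ) ≤ p := by exact_mod_cast (Nat.prime_of_mem_primeFactors hp).two_le
    have hp0 : (0 : ℝ) ≤ p := by linarith
    set a := n.factorization p with ha
    have h1 : ((p ^ a : ℕ) : ℝ) ^ ε = ((p : ℝ) ^ ε) ^ a := by
      push_cast
      rw [← Real.rpow_natCast, ← Real.rpow_natCast, ← Real.rpow_mul hp0, ← Real.rpow_mul hp0,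
        mul_comm]
    rw [h1]
    split_ifs with hpP
    · have h2 : 1 + ε * Real.log 2 ≤ (p : ℝ) ^ ε := by
        calc 1 + ε * Real.log 2 ≤ Real.exp (Real.log 2 * ε) := by
              have := Real.add_one_le_exp (Real.log 2 * ε)
              linarith
          _ = (2 : ℝ) ^ ε := (Real.rpow_def_of_pos (by norm_num) _).symm
          _ ≤ _ := Real.rpow_le_rpow (by norm_num) hp2 hε.le
      have h3 : 1 + a * (ε * Real.log 2) ≤ ((p : ℝ) ^ ε) ^ a := by
        refine (one_add_mul_le_pow ?_ a).trans (pow_le_pow_left₀ (by positivity) h2 a)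
        have : 0 < ε * Real.log 2 := by positivity
        linarith
      have h4 : c * (1 + a * (ε * Real.log 2)) = 1 + a + (1 / (ε * Real.log 2) + a * (ε * Real.log 2)) := by
        rw [hc]
        field_simp
        ring
      have h5 : 0 ≤ 1 / (ε * Real.log 2) + a * (ε * Real.log 2) := by positivity
      have h6 := mul_le_mul_of_nonneg_left h3 (by linarith : 0 ≤ c)
      push_cast
      linarith
    · rw [one_mul]
      have h2 : (2 : ℝ) ≤ (p : ℝ) ^ ε := by
        have h3 : (2 : ℝ) ^ ε⁻¹ ≤ p := (Nat.le_ceil _).trans (by exact_mod_cast not_lt.1 hpP)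
        have h4 := Real.rpow_le_rpow (by positivity) h3 hε.le
        rwa [← Real.rpow_mul (by norm_num), inv_mul_cancel₀ hε.ne', Real.rpow_one] at h4
      calc ((a + 1 : ℕ) : ℝ) ≤ (2 : ℝ) ^ a := by exact_mod_cast Nat.lt_two_pow_self
        _ ≤ _ := pow_le_pow_left₀ (by norm_num) h2 a
  rw [Nat.card_divisors hn, Nat.cast_prod]
  refine (Finset.prod_le_prod (fun _ _ => Nat.cast_nonneg _) hfac).trans ?_
  rw [Finset.prod_mul_distrib]
  have h1 : ∏ p ∈ n.primeFactors, ((p ^ n.factorization p : ℕ) : ℝ) ^ ε = (n : ℝ) ^ ε := by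
    rw [Real.finsetProd_rpow _ _ fun _ _ => Nat.cast_nonneg _, ← Nat.cast_prod]
    congr 2
    exact Nat.prod_factorization_pow_eq_self hn
  have h2 : ∏ p ∈ n.primeFactors, (if p < P then c else 1) ≤ c ^ P := by
    rw [← Finset.prod_filter, Finset.prod_const]
    refine pow_le_pow_right₀ hc1 ?_
    calc _ ≤ (Finset.range P).card := Finset.card_le_card fun p hp =>
          Finset.mem_range.2 (Finset.mem_filter.1 hp).2
      _ = P := Finset.card_range P
  rw [h1]
  gcongr

theorem card_filter_dvd_le {N : ℕ} {n : ℤ} (hn : n ≠ 0) :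
    ((Finset.Ioo (-(N : ℤ)) N).filter fun h => h ∣ n).card ≤ 2 * n.natAbs.divisors.card := by
  classical
  have hsub : ((Finset.Ioo (-(N : ℤ)) N).filter fun h => h ∣ n) ⊆
      n.natAbs.divisors.image (fun d : ℕ => (d : ℤ)) ∪
        n.natAbs.divisors.image (fun d : ℕ => -(d : ℤ)) := by
    intro h hh
    have hd : h.natAbs ∈ n.natAbs.divisors :=
      Nat.mem_divisors.2 ⟨Int.natAbs_dvd_natAbs.2 (Finset.mem_filter.1 hh).2, Int.natAbs_ne_zero.2 hn⟩
    rw [Finset.mem_union, Finset.mem_image, Finset.mem_image]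
    rcases Int.natAbs_eq h with h1 | h1
    · exact Or.inl ⟨_, hd, h1.symm⟩
    · exact Or.inr ⟨_, hd, h1.symm⟩
  refine (Finset.card_le_card hsub).trans ((Finset.card_union_le _ _).trans ?_)
  rw [two_mul]
  exact add_le_add Finset.card_image_le Finset.card_image_le

/-- The iterated average of geometric sums produced by Weyl differencing. -/
noncomputable def weylAvg (N : ℕ) : ℕ → ℝ → ℝ
  | 0, x => geomBound N x
  | j + 1, x => ∑ h ∈ Finset.Ioo (-(N : ℤ)) N, weylAvg N j ((j + 2) * h * x)

theorem card_Ioo_le (N : ℕ) : ((Finset.Ioo (-(N : ℤ)) N).card : ℝ) ≤ 2 * N := by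
  rw [Int.card_Ioo]
  have : ((N : ℤ) - -(N : ℤ) - 1).toNat ≤ 2 * N := by omega
  exact_mod_cast this

theorem weylAvg_le (N j : ℕ) (x : ℝ) : weylAvg N j x ≤ (2 * N : ℝ) ^ (j + 1) := by
  induction j generalizing x with
  | zero => rw [zero_add, pow_one]; exact geomBound_le (Nat.cast_nonneg N) x
  | succ j ih =>
    calc weylAvg N (j + 1) x ≤ ∑ h ∈ Finset.Ioo (-(N : ℤ)) N, (2 * N : ℝ) ^ (j + 1) :=
          Finset.sum_le_sum fun h _ => ih _
      _ = (Finset.Ioo (-(N : ℤ)) N).card * (2 * N : ℝ) ^ (j + 1) := by simp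
      _ ≤ (2 * N) * (2 * N : ℝ) ^ (j + 1) :=
          mul_le_mul_of_nonneg_right (card_Ioo_le N) (by positivity)
      _ = _ := by ring

theorem norm_sq_sum_Ico_le {N : ℕ} (f : ℤ → ℂ) (c : ℤ) {M : ℕ} (hM : M ≤ N) :
    ∃ (c' : ℤ → ℤ) (M' : ℤ → ℕ), (∀ h, M' h ≤ N) ∧
      ‖∑ n ∈ Finset.Ico c (c + M), f n‖ ^ 2 ≤ ∑ h ∈ Finset.Ioo (-(N : ℤ)) N,
        ‖∑ n ∈ Finset.Ico (c' h) (c' h + M' h), f (n + h) * (starRingEnd ℂ) (f n)‖ := by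
  refine ⟨fun h => max c (c - h), fun h => (min (c + M) (c + M - h) - max c (c - h)).toNat,
    fun h => by dsimp only; omega, ?_⟩
  set I := Finset.Ico c (c + M) with hI
  have h1 : ∀ n ∈ I, ∑ m ∈ I, f m * (starRingEnd ℂ) (f n) =
      ∑ h ∈ Finset.Ioo (-(N : ℤ)) N, if n + h ∈ I then f (n + h) * (starRingEnd ℂ) (f n) else 0 := by
    intro n hn
    rw [← Finset.sum_filter]
    refine Finset.sum_nbij' (fun m => m - n) (fun h => n + h) ?_ ?_ ?_ ?_ ?_
    · intro m hm
      rw [hI, Finset.mem_Ico] at hm hn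
      rw [Finset.mem_filter, Finset.mem_Ioo, hI, Finset.mem_Ico]
      omega
    · intro h hh
      exact (Finset.mem_filter.1 hh).2
    · intro m _; ring
    · intro h _; ring
    · intro m _; congr 2; ring
  have h2 : ((‖∑ n ∈ I, f n‖ ^ 2 : ℝ) : ℂ) = ∑ h ∈ Finset.Ioo (-(N : ℤ)) N,
      ∑ n ∈ Finset.Ico (max c (c - h)) (max c (c - h) +
        (min (c + M) (c + M - h) - max c (c - h)).toNat), f (n + h) * (starRingEnd ℂ) (f n) := by
    push_cast
    rw [← Complex.mul_conj', map_sum, Finset.sum_mul_sum, Finset.sum_comm,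
      Finset.sum_congr rfl h1, Finset.sum_comm]
    refine Finset.sum_congr rfl fun h _ => ?_
    rw [← Finset.sum_filter]
    refine Finset.sum_congr ?_ fun _ _ => rfl
    ext n
    rw [Finset.mem_filter, hI, Finset.mem_Ico, Finset.mem_Ico, Finset.mem_Ico]
    omega
  rw [← abs_of_nonneg (by positivity : 0 ≤ ‖∑ n ∈ I, f n‖ ^ 2), ← Real.norm_eq_abs,
    ← Complex.norm_real, h2]
  exact norm_sum_le _ _

theorem natDegree_taylor_sub_le {f : ℤ[X]} {d : ℕ} (hf : f.natDegree ≤ d + 1) (h : ℤ) :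
    (taylor h f - f).natDegree ≤ d := by
  rw [natDegree_le_iff_coeff_eq_zero]
  intro i hi
  have h0 : (hasseDeriv i f).natDegree ≤ 0 := by
    have := natDegree_hasseDeriv_le f i
    omega
  rw [coeff_sub, taylor_coeff, eval_eq_sum_range' (Nat.lt_succ_of_le h0)]
  simp [hasseDeriv_coeff]

/-- Weyl's inequality before averaging over the differences. -/
theorem norm_sum_pow_le_weylAvg {N : ℕ} (α : ℝ) (j : ℕ) (f : ℤ[X]) (hf : f.natDegree ≤ j + 1)
    (c : ℤ) {M : ℕ} (hM : M ≤ N) :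
    ‖∑ n ∈ Finset.Ico c (c + M), e (α * (f.eval n : ℤ))‖ ^ 2 ^ j ≤
      (2 * N : ℝ) ^ (2 ^ j - (j + 1)) * weylAvg N j (α * f.coeff (j + 1)) := by
  induction j generalizing f c M with
  | zero =>
    have h1 : ∀ n : ℤ, e (α * (f.eval n : ℤ)) = e (α * f.coeff 1 * n) * e (α * f.coeff 0) := by
      intro n
      rw [← e_add, eval_eq_sum_range' (Nat.lt_succ_of_le hf)]
      congr 1
      simp only [Finset.sum_range_succ, Finset.sum_range_zero]
      push_cast
      ring
    simp only [h1]
    rw [← Finset.sum_mul, norm_mul, norm_e]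
    simp only [zero_add, pow_zero, pow_one, mul_one, Nat.sub_self, one_mul, weylAvg]
    exact (norm_sum_e_le _ _ _).trans
      (geomBound_mono (Nat.cast_nonneg M) (by exact_mod_cast hM) _)
  | succ j ih =>
    obtain ⟨c', M', hM', hS⟩ := norm_sq_sum_Ico_le (N := N) (fun n => e (α * (f.eval n : ℤ))) c hM
    set S := ∑ n ∈ Finset.Ico c (c + M), e (α * (f.eval n : ℤ)) with hSdef
    have h1 : ∀ h n : ℤ, e (α * (f.eval (n + h) : ℤ)) * (starRingEnd ℂ) (e (α * (f.eval n : ℤ))) =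
        e (α * ((taylor h f - f).eval n : ℤ)) := by
      intro h n
      rw [conj_e, ← e_add, eval_sub, taylor_eval]
      congr 1
      push_cast
      ring
    simp only [h1] at hS
    set A : ℤ → ℝ := fun h =>
      ‖∑ n ∈ Finset.Ico (c' h) (c' h + M' h), e (α * ((taylor h f - f).eval n : ℤ))‖ with hA
    have h2 : ∀ h, A h ^ 2 ^ j ≤ (2 * N : ℝ) ^ (2 ^ j - (j + 1)) *
        weylAvg N j ((j + 2) * h * (α * f.coeff (j + 1 + 1))) := by
      intro h
      refine (ih (taylor h f - f) (natDegree_taylor_sub_le hf h) (c' h) (hM' h)).trans (le_of_eq ?_)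
      rw [coeff_sub, coeff_taylor_pred hf]
      congr 2
      push_cast
      ring
    have hlt : j + 1 ≤ 2 ^ j := Nat.lt_two_pow_self
    have hN0 : (0 : ℝ) ≤ 2 * N := by positivity
    calc ‖S‖ ^ 2 ^ (j + 1) = (‖S‖ ^ 2) ^ 2 ^ j := by rw [← pow_mul, pow_succ, mul_comm]
      _ ≤ (∑ h ∈ Finset.Ioo (-(N : ℤ)) N, A h) ^ 2 ^ j := pow_le_pow_left₀ (by positivity) hS _
      _ ≤ ((Finset.Ioo (-(N : ℤ)) N).card : ℝ) ^ (2 ^ j - 1) *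
          ∑ h ∈ Finset.Ioo (-(N : ℤ)) N, A h ^ 2 ^ j := by
          obtain ⟨r, hr⟩ : ∃ r, 2 ^ j = r + 1 := ⟨2 ^ j - 1, by omega⟩
          rw [hr, Nat.add_sub_cancel]
          exact pow_sum_le_card_mul_sum_pow (fun h _ => norm_nonneg _) r
      _ ≤ (2 * N : ℝ) ^ (2 ^ j - 1) * ∑ h ∈ Finset.Ioo (-(N : ℤ)) N,
          (2 * N : ℝ) ^ (2 ^ j - (j + 1)) *
            weylAvg N j ((j + 2) * h * (α * f.coeff (j + 1 + 1))) := by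
          refine mul_le_mul (pow_le_pow_left₀ (Nat.cast_nonneg _) (card_Ioo_le N) _)
            (Finset.sum_le_sum fun h _ => h2 h)
            (Finset.sum_nonneg fun h _ => pow_nonneg (norm_nonneg _) _) (by positivity)
      _ = _ := by
          rw [← Finset.mul_sum, ← mul_assoc, ← pow_add, weylAvg]
          congr 2
          rw [pow_succ]
          omega

/-- The range of the multipliers in `weylAvg_le_sum`. -/
noncomputable def multRange (N j : ℕ) : Finset ℤ :=
  (Finset.Icc (-(((j + 1).factorial * N ^ j : ℕ) : ℤ)) ((j + 1).factorial * N ^ j : ℕ)).filter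
    fun n => n ≠ 0

theorem mem_multRange {N j : ℕ} {n : ℤ} :
    n ∈ multRange N j ↔ n.natAbs ≤ (j + 1).factorial * N ^ j ∧ n ≠ 0 := by
  rw [multRange, Finset.mem_filter, Finset.mem_Icc]
  generalize (j + 1).factorial * N ^ j = K
  constructor <;> rintro ⟨h1, h2⟩ <;> refine ⟨?_, h2⟩ <;> omega

theorem mul_mem_multRange {N j : ℕ} {h n : ℤ} (hh : h ∈ Finset.Ioo (-(N : ℤ)) N) (h0 : h ≠ 0)
    (hn : n ∈ multRange N j) : (j + 2 : ℤ) * h * n ∈ multRange N (j + 1) := by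
  rw [mem_multRange] at hn ⊢
  rw [Finset.mem_Ioo] at hh
  refine ⟨?_, mul_ne_zero (mul_ne_zero (by omega) h0) hn.2⟩
  have h1 : h.natAbs ≤ N := by omega
  have h2 : (j + 2 : ℤ).natAbs = j + 2 := by omega
  rw [Int.natAbs_mul, Int.natAbs_mul, h2, Nat.factorial_succ (j + 1), pow_succ]
  calc (j + 2) * h.natAbs * n.natAbs ≤ (j + 2) * N * ((j + 1).factorial * N ^ j) :=
        Nat.mul_le_mul (Nat.mul_le_mul_left _ h1) hn.1
    _ = _ := by ring

theorem card_fiber_mul_le {N j : ℕ} {y : ℤ} (hy : y ≠ 0) (J : Finset ℤ) :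
    ((((Finset.Ioo (-(N : ℤ)) N).filter fun h => h ≠ 0) ×ˢ J).filter
      fun p => (j + 2 : ℤ) * p.1 * p.2 = y).card ≤ 2 * y.natAbs.divisors.card := by
  refine le_trans ?_ (card_filter_dvd_le (N := N) hy)
  refine Finset.card_le_card_of_injOn Prod.fst ?_ ?_
  · intro p hp
    simp only [Finset.coe_filter, Finset.mem_product, Finset.mem_filter, Set.mem_ofPred_eq] at hp ⊢
    exact ⟨hp.1.1.1, ⟨(j + 2) * p.2, by rw [← hp.2]; ring⟩⟩
  · intro p hp p' hp' hpp
    simp only [Finset.coe_filter, Finset.mem_product, Finset.mem_filter, Set.mem_ofPred_eq] at hp hp'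
    have h1 := hp.2.trans hp'.2.symm
    rw [← hpp] at h1
    exact Prod.ext hpp (mul_left_cancel₀ (mul_ne_zero (by omega) hp.1.1.2) h1)

/-- The iterated averages are controlled by a single sum over multiples, by the divisor bound. -/
theorem weylAvg_le_sum (j : ℕ) {ε : ℝ} (hε : 0 < ε) :
    ∃ C ≥ (1 : ℝ), ∀ N : ℕ, 1 ≤ N → ∀ x : ℝ,
      weylAvg N j x ≤ C * (N : ℝ) ^ j + C * (N : ℝ) ^ ε *
        ∑ n ∈ multRange N j, geomBound N (n * x) := by
  induction j generalizing ε with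
  | zero =>
    refine ⟨1, le_rfl, fun N hN x => ?_⟩
    have hN1 : (1 : ℝ) ≤ N := by exact_mod_cast hN
    have h1 : (1 : ℤ) ∈ multRange N 0 := by simp [mem_multRange]
    have h2 := Finset.single_le_sum (f := fun n : ℤ => geomBound N (n * x))
      (fun n _ => geomBound_nonneg (Nat.cast_nonneg N) _) h1
    have h3 : weylAvg N 0 x = geomBound N (((1 : ℤ) : ℝ) * x) := by
      rw [Int.cast_one, one_mul, weylAvg]
    have h4 := le_mul_of_one_le_left
      ((geomBound_nonneg (Nat.cast_nonneg N) _).trans h2) (Real.one_le_rpow hN1 hε.le)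
    rw [h3, one_mul, one_mul, pow_zero]
    linarith
  | succ j ih =>
    obtain ⟨C₁, hC₁, h₁⟩ := ih (half_pos hε)
    have hδ : 0 < ε / (2 * (j + 1)) := by positivity
    set δ := ε / (2 * (j + 1)) with hδdef
    obtain ⟨C₂, hC₂, h₂⟩ := card_divisors_le hδ
    set K : ℝ := ((j + 2).factorial : ℝ) ^ δ with hK
    have hK0 : 0 ≤ K := by positivity
    have hC : 1 ≤ 2 ^ (j + 1) + 2 * C₁ + 2 * C₁ * C₂ * K := by
      have : 0 ≤ 2 * C₁ * C₂ * K := by positivity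
      have : (0 : ℝ) ≤ 2 ^ (j + 1) := by positivity
      linarith
    refine ⟨_, hC, fun N hN x => ?_⟩
    have hN1 : (1 : ℝ) ≤ N := by exact_mod_cast hN
    have hN0 : (0 : ℝ) < N := by linarith
    set I := Finset.Ioo (-(N : ℤ)) N with hI
    set I' := I.filter fun h => h ≠ 0 with hI'
    set J := multRange N j with hJ
    set G : ℤ → ℝ := fun y => geomBound N (y * x) with hG
    have hG0 : ∀ y, 0 ≤ G y := fun y => geomBound_nonneg hN0.le _
    have hterm : ∀ h ∈ I, weylAvg N j ((j + 2) * h * x) ≤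
        (if h = 0 then (2 * N : ℝ) ^ (j + 1) else 0) + C₁ * (N : ℝ) ^ j +
          C₁ * (N : ℝ) ^ (ε / 2) * (if h ≠ 0 then ∑ n ∈ J, G ((j + 2) * h * n) else 0) := by
      intro h _
      by_cases h0 : h = 0
      · have h3 := weylAvg_le N j ((j + 2) * h * x)
        have h4 : 0 ≤ C₁ * (N : ℝ) ^ j := by positivity
        rw [if_pos h0, if_neg (not_not.2 h0)]
        linarith
      · rw [if_neg h0, if_pos h0, zero_add]
        refine (h₁ N hN _).trans (le_of_eq ?_)
        congr 2
        refine Finset.sum_congr rfl fun n _ => ?_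
        rw [hG]
        dsimp only
        congr 1
        push_cast
        ring
    have hfiber : ∀ y ∈ multRange N (j + 1),
        (((I' ×ˢ J).filter fun p => (j + 2 : ℤ) * p.1 * p.2 = y).card : ℝ) ≤
          2 * C₂ * K * (N : ℝ) ^ (ε / 2) := by
      intro y hy
      rw [mem_multRange] at hy
      have h3 : (((I' ×ˢ J).filter fun p => (j + 2 : ℤ) * p.1 * p.2 = y).card : ℝ) ≤
          2 * (y.natAbs.divisors.card : ℝ) := by exact_mod_cast card_fiber_mul_le hy.2 J
      have h4 := h₂ y.natAbs (Int.natAbs_ne_zero.2 hy.2)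
      have h5 : (y.natAbs : ℝ) ^ δ ≤ K * (N : ℝ) ^ (ε / 2) := by
        calc (y.natAbs : ℝ) ^ δ ≤ (((j + 2).factorial : ℝ) * (N : ℝ) ^ (j + 1)) ^ δ :=
              Real.rpow_le_rpow (Nat.cast_nonneg _) (by exact_mod_cast hy.1) hδ.le
          _ = _ := by
              rw [Real.mul_rpow (by positivity) (by positivity), ← Real.rpow_natCast,
                ← Real.rpow_mul hN0.le]
              congr 2
              rw [hδdef]
              push_cast
              field_simp
      have h6 := mul_le_mul_of_nonneg_left h5 (by linarith : 0 ≤ C₂)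
      linarith
    have hdouble : ∑ h ∈ I', ∑ n ∈ J, G ((j + 2) * h * n) ≤
        2 * C₂ * K * (N : ℝ) ^ (ε / 2) * ∑ y ∈ multRange N (j + 1), G y := by
      rw [← Finset.sum_product', ← Finset.sum_fiberwise_of_maps_to
        (t := multRange N (j + 1)) (g := fun p : ℤ × ℤ => (j + 2 : ℤ) * p.1 * p.2), Finset.mul_sum]
      · refine Finset.sum_le_sum fun y hy => ?_
        rw [Finset.sum_congr rfl fun p hp => by rw [(Finset.mem_filter.1 hp).2], Finset.sum_const,
          nsmul_eq_mul]
        exact mul_le_mul_of_nonneg_right (hfiber y hy) (hG0 y)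
      · intro p hp
        rw [Finset.mem_product, hI', Finset.mem_filter] at hp
        exact mul_mem_multRange hp.1.1 hp.1.2 hp.2
    have hsplit : (N : ℝ) ^ (ε / 2) * (N : ℝ) ^ (ε / 2) = (N : ℝ) ^ ε := by
      rw [← Real.rpow_add hN0, add_halves]
    have hS0 : 0 ≤ ∑ y ∈ multRange N (j + 1), G y := Finset.sum_nonneg fun y _ => hG0 y
    set S := ∑ y ∈ multRange N (j + 1), G y with hS
    have hzero : (0 : ℤ) ∈ I := by rw [hI, Finset.mem_Ioo]; omega
    calc weylAvg N (j + 1) x ≤ ∑ h ∈ I, ((if h = 0 then (2 * N : ℝ) ^ (j + 1) else 0) +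
          C₁ * (N : ℝ) ^ j + C₁ * (N : ℝ) ^ (ε / 2) *
            (if h ≠ 0 then ∑ n ∈ J, G ((j + 2) * h * n) else 0)) := Finset.sum_le_sum hterm
      _ = (2 * N : ℝ) ^ (j + 1) + I.card * (C₁ * (N : ℝ) ^ j) +
          C₁ * (N : ℝ) ^ (ε / 2) * ∑ h ∈ I', ∑ n ∈ J, G ((j + 2) * h * n) := by
          rw [Finset.sum_add_distrib, Finset.sum_add_distrib, Finset.sum_ite_eq' I 0,
            if_pos hzero, Finset.sum_const, nsmul_eq_mul, ← Finset.mul_sum, ← Finset.sum_filter]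
      _ ≤ (2 * N : ℝ) ^ (j + 1) + (2 * N) * (C₁ * (N : ℝ) ^ j) +
          C₁ * (N : ℝ) ^ (ε / 2) * (2 * C₂ * K * (N : ℝ) ^ (ε / 2) * S) := by
          gcongr
          exact card_Ioo_le N
      _ = (2 ^ (j + 1) + 2 * C₁) * (N : ℝ) ^ (j + 1) +
          2 * C₁ * C₂ * K * (N : ℝ) ^ ε * S := by
          rw [← hsplit]
          ring
      _ ≤ _ := by
          have h3 : 0 ≤ 2 * C₁ * C₂ * K := by positivity
          have h4 : (0 : ℝ) ≤ 2 ^ (j + 1) := by positivity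
          have h5 : 0 ≤ (N : ℝ) ^ ε * S := by positivity
          rw [mul_assoc _ _ S, mul_assoc _ _ S]
          refine add_le_add (mul_le_mul_of_nonneg_right ?_ (by positivity))
            (mul_le_mul_of_nonneg_right ?_ h5) <;> linarith

/-- Weyl's inequality. -/
theorem weyl_bound_differencing {g : ℤ[X]} {d : ℕ} (hd : 1 ≤ d) (hg : g.natDegree = d + 1)
    {ε : ℝ} (hε : 0 < ε) :
    ∃ C ≥ (1 : ℝ), ∀ m N h : ℕ, 1 ≤ m → 1 ≤ N → 1 ≤ h →
      ‖weylSum g m N h‖ ≤ C * (N : ℝ) ^ ((1 : ℝ) + ε) *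
        saving (d + 1) m N h ^ (((2 ^ d : ℕ) : ℝ)⁻¹) := by
  set D : ℝ := 3 * (d + 1).factorial with hD
  have hfac : (1 : ℝ) ≤ (d + 1).factorial := by exact_mod_cast Nat.factorial_pos (d + 1)
  have hD1 : 1 ≤ D := by linarith
  have hB : g.coeff (d + 1) ≠ 0 := by
    rw [← hg]
    exact leadingCoeff_ne_zero.2 fun h0 => by simp [h0] at hg
  obtain ⟨C₁, hC₁, h₁⟩ := weylAvg_le_sum d (half_pos hε)
  obtain ⟨C₂, hC₂, h₂⟩ := sum_geomBound_le_saving (k := d + 1) (u := d) (v := 1) rfl hd le_rfl hD1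
    hB (half_pos hε)
  have hC : 1 ≤ 2 ^ 2 ^ d * (C₁ + C₁ * C₂) := by
    have h3 : (1 : ℝ) ≤ 2 ^ 2 ^ d := one_le_pow₀ (by norm_num)
    have h4 : 0 ≤ C₁ * C₂ := by positivity
    nlinarith
  refine ⟨_, hC, weyl_bound_of_pow_le (by positivity) hε.le hC ?_⟩
  intro m N h hm hN hh hq
  have hN1 : (1 : ℝ) ≤ N := by exact_mod_cast hN
  have hN0 : (0 : ℝ) < N := by linarith
  have hsav := saving_nonneg (d + 1) m N h
  set σ := saving (d + 1) m N h with hσ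
  have hsum : ‖weylSum g m N h‖ ^ 2 ^ d ≤ (2 * N : ℝ) ^ (2 ^ d - (d + 1)) *
      weylAvg N d ((h / m : ℝ) * g.coeff (d + 1)) := by
    have h3 : weylSum g m N h =
        ∑ n ∈ Finset.Ico (1 : ℤ) (1 + N), e ((h / m : ℝ) * (g.eval n : ℤ)) := by
      rw [weylSum]
      refine Finset.sum_congr rfl fun n _ => ?_
      congr 1
      push_cast
      ring
    rw [h3]
    exact norm_sum_pow_le_weylAvg _ d g hg.le 1 le_rfl
  have hgeom : ∑ n ∈ multRange N d, geomBound N (n * ((h / m : ℝ) * g.coeff (d + 1))) ≤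
      C₂ * (N : ℝ) ^ (ε / 2) * ((N : ℝ) ^ (d + 1) * σ) := by
    set K := (d + 1).factorial * N ^ d with hK
    have h3 := h₂ m N h hm hN hh hq (-(K : ℤ)) (2 * K + 1) N ?_ hN0.le ?_
    · refine le_trans ?_ h3
      refine (Finset.sum_le_sum_of_subset_of_nonneg ?_ fun n _ _ =>
        geomBound_nonneg hN0.le _).trans (le_of_eq (Finset.sum_congr rfl fun n _ => ?_))
      · intro n hn
        rw [mem_multRange, ← hK] at hn
        rw [Finset.mem_Ico]
        omega
      · congr 1
        push_cast
        ring
    · have h4 : 1 ≤ K := Nat.mul_pos (Nat.factorial_pos _) (pow_pos hN d)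
      have h5 : ((2 * K + 1 : ℕ) : ℝ) ≤ 3 * K := by exact_mod_cast (by omega : 2 * K + 1 ≤ 3 * K)
      refine h5.trans (le_of_eq ?_)
      rw [hK, hD]
      push_cast
      ring
    · rw [pow_one]
      exact le_mul_of_one_le_left hN0.le hD1
  have htriv : (N : ℝ) ^ d ≤ (N : ℝ) ^ (d + 1) * σ := by
    have h3 : (N : ℝ)⁻¹ ≤ σ := by
      rw [hσ, saving_eq hm]
      have : (0 : ℝ) ≤ (((m / Nat.gcd h m : ℕ) : ℝ))⁻¹ := by positivity
      have : (0 : ℝ) ≤ ((m / Nat.gcd h m : ℕ) : ℝ) / (N : ℝ) ^ (d + 1) := by positivity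
      linarith
    calc (N : ℝ) ^ d = (N : ℝ) ^ (d + 1) * (N : ℝ)⁻¹ := by rw [pow_succ]; field_simp
      _ ≤ _ := by gcongr
  have hlt : d + 1 ≤ 2 ^ d := Nat.lt_two_pow_self
  have hsplit : (N : ℝ) ^ (ε / 2) * (N : ℝ) ^ (ε / 2) = (N : ℝ) ^ ε := by
    rw [← Real.rpow_add hN0, add_halves]
  have hNε : 1 ≤ (N : ℝ) ^ ε := Real.one_le_rpow hN1 hε.le
  have havg : weylAvg N d ((h / m : ℝ) * g.coeff (d + 1)) ≤
      (C₁ + C₁ * C₂) * (N : ℝ) ^ ε * ((N : ℝ) ^ (d + 1) * σ) := by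
    set T := (N : ℝ) ^ (d + 1) * σ with hT
    have hT0 : 0 ≤ T := by positivity
    calc _ ≤ C₁ * (N : ℝ) ^ d + C₁ * (N : ℝ) ^ (ε / 2) *
          ∑ n ∈ multRange N d, geomBound N (n * ((h / m : ℝ) * g.coeff (d + 1))) := h₁ N hN _
      _ ≤ C₁ * ((N : ℝ) ^ ε * T) + C₁ * (N : ℝ) ^ (ε / 2) * (C₂ * (N : ℝ) ^ (ε / 2) * T) := by
          gcongr
          exact htriv.trans (le_mul_of_one_le_left hT0 hNε)
      _ = _ := by rw [← hsplit]; ring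
  have hpow : (N : ℝ) ^ (2 ^ d) * (N : ℝ) ^ ε ≤ ((N : ℝ) ^ ((1 : ℝ) + ε)) ^ 2 ^ d := by
    rw [Real.rpow_add hN0, Real.rpow_one, mul_pow]
    gcongr
    exact le_self_pow₀ hNε (by positivity)
  calc ‖weylSum g m N h‖ ^ 2 ^ d ≤ (2 * N : ℝ) ^ (2 ^ d - (d + 1)) *
        ((C₁ + C₁ * C₂) * (N : ℝ) ^ ε * ((N : ℝ) ^ (d + 1) * σ)) := hsum.trans (by gcongr)
    _ = 2 ^ (2 ^ d - (d + 1)) * (C₁ + C₁ * C₂) *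
        (((N : ℝ) ^ (2 ^ d - (d + 1)) * (N : ℝ) ^ (d + 1)) * (N : ℝ) ^ ε) * σ := by
        rw [mul_pow]; ring
    _ = 2 ^ (2 ^ d - (d + 1)) * (C₁ + C₁ * C₂) * ((N : ℝ) ^ (2 ^ d) * (N : ℝ) ^ ε) * σ := by
        rw [← pow_add, Nat.sub_add_cancel hlt]
    _ ≤ 2 ^ 2 ^ d * (C₁ + C₁ * C₂) * ((N : ℝ) ^ ((1 : ℝ) + ε)) ^ 2 ^ d * σ := by
        gcongr
        · norm_num
        · omega

end WeylSum

theorem WeylSum.sum_exp_eq_weylSum (g : ℤ[X]) (m N h : ℕ) :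
    ∑ n ∈ Finset.Icc 1 N,
      Complex.exp (2 * Real.pi * Complex.I * ((h : ℤ) * g.eval (n : ℤ) : ℤ) / (m : ℂ)) =
      WeylSum.weylSum g m N h := by
  rw [WeylSum.weylSum]
  refine Finset.sum_nbij' (fun n : ℕ => (n : ℤ)) (fun n : ℤ => n.toNat) ?_ ?_ ?_ ?_ ?_
  · intro n hn
    rw [Finset.mem_Icc] at hn
    rw [Finset.mem_Ico]
    omega
  · intro n hn
    rw [Finset.mem_Ico] at hn
    rw [Finset.mem_Icc]
    omega
  · intro n _
    simp
  · intro n hn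
    rw [Finset.mem_Ico] at hn
    omega
  · intro n _
    rw [WeylSum.e]
    congr 1
    push_cast
    ring

theorem squarefree_values_stmt11 (g : Polynomial ℤ) (k : ℕ) (hk : 2 ≤ k)
    (hdeg : g.natDegree = k) (ε : ℝ) (hε : 0 < ε) :
    ∃ C > 0, ∀ m N h : ℕ, 1 ≤ m → 1 ≤ N → 1 ≤ h →
      ‖∑ n ∈ Finset.Icc 1 N,
          Complex.exp (2 * Real.pi * Complex.I * ((h : ℤ) * g.eval (n : ℤ) : ℤ) / (m : ℂ))‖ ≤
        C * (N : ℝ) ^ ((1 : ℝ) + ε) *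
          ((Nat.gcd h m : ℝ) / m + 1 / N +
              (m : ℝ) / ((Nat.gcd h m : ℝ) * (N : ℝ) ^ k)) ^ (eta k) := by
  obtain ⟨d, rfl⟩ : ∃ d, k = d + 1 := ⟨k - 1, by omega⟩
  have hbound : ∃ C ≥ (1 : ℝ), ∀ m N h : ℕ, 1 ≤ m → 1 ≤ N → 1 ≤ h →
      ‖WeylSum.weylSum g m N h‖ ≤ C * (N : ℝ) ^ ((1 : ℝ) + ε) *
        WeylSum.saving (d + 1) m N h ^ _root_.eta (d + 1) := by
    by_cases h5 : d + 1 ≤ 5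
    · have heta : _root_.eta (d + 1) = ((2 ^ d : ℕ) : ℝ)⁻¹ := by
        rw [_root_.eta, if_pos h5, Nat.cast_pow, Nat.cast_ofNat, ← zpow_natCast, ← zpow_neg]
        congr 1
        push_cast
        ring
      rw [heta]
      exact WeylSum.weyl_bound_differencing (by omega) hdeg hε
    · have heta : _root_.eta (d + 1) = ((2 * WeylSum.tri d : ℕ) : ℝ)⁻¹ := by
        rw [_root_.eta, if_neg h5, WeylSum.two_mul_tri, one_div]
        congr 1
        push_cast
        ring
      rw [heta]
      exact WeylSum.weyl_bound_vinogradov (by omega) hdeg hε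
  obtain ⟨C, hC, h⟩ := hbound
  refine ⟨C, by linarith, fun m N r hm hN hr => ?_⟩
  rw [WeylSum.sum_exp_eq_weylSum]
  exact h m N r hm hN hr
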